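/- arXiv:2402.13269 — 2 statements merged into one kernel-verified Lean document; each statement's English description precedes it below -/
import Mathlib

section
/- In the renormalization setting: for every y > 0 one has b′(t_y) ≥ b′(t_{y+1}), i.e. the free boundary moves no faster when it crosses the point y + 1 than when it crosses the point y; consequently, for every t ≥ t₂, 0 ≤ b′(t) ≤ c̄ where c̄ := max_{z∈[1,2]} b′(t_z). -/
open MeasureTheory Set Filter

noncomputable section

/-- Condition (F1): `f` and `κ` are `C²`, 1-periodic in `x`, `f(x,0)=0`, and there is `θ > 0`
with `f(x,u) > 0` for `u > θ` and `κ(x) > θ`. -/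
def CondF1 (f : ℝ → ℝ → ℝ) (κ : ℝ → ℝ) (θ : ℝ) : Prop :=
  ContDiff ℝ 2 (Function.uncurry f) ∧ ContDiff ℝ 2 κ ∧
  (∀ x u, f (x + 1) u = f x u) ∧ (∀ x, κ (x + 1) = κ x) ∧
  (∀ x, f x 0 = 0) ∧ 0 < θ ∧ (∀ x u, θ < u → 0 < f x u) ∧ (∀ x, θ < κ x)

/-- `κ₀ := min κ` (over a period). -/
def kappaMin (κ : ℝ → ℝ) : ℝ := sInf (κ '' Icc 0 1)

/-- `κ⁰ := max κ` (over a period). -/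
def kappaMax (κ : ℝ → ℝ) : ℝ := sSup (κ '' Icc 0 1)

/-- Condition (F2): existence of a compactly supported traveling subsolution profile `φ₀`
with speed `c₀`. -/
def CondF2 (m : ℝ) (f : ℝ → ℝ → ℝ) (κ : ℝ → ℝ) (c₀ l₀ : ℝ) (φ₀ : ℝ → ℝ) : Prop :=
  0 < c₀ ∧ 0 < l₀ ∧ ContDiffOn ℝ 2 φ₀ (Icc (-l₀) l₀) ∧
  φ₀ (-l₀) = 0 ∧ φ₀ l₀ = 0 ∧ (∀ z ∈ Ioo (-l₀) l₀, 0 < φ₀ z) ∧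
  c₀ < -(derivWithin φ₀ (Icc (-l₀) l₀) l₀) ∧
  ∀ (x : ℝ), ∀ z ∈ Icc (-l₀) l₀,
    0 ≤ derivWithin (derivWithin (fun w => φ₀ w ^ m) (Icc (-l₀) l₀)) (Icc (-l₀) l₀) z
        + c₀ * derivWithin φ₀ (Icc (-l₀) l₀) z
        + f x (φ₀ z) * (κ x - φ₀ z)

/-- A (bounded, continuous) very weak solution of `u_t = (u^m)_{xx} + f(x,u)(κ(x)-u)`
on `ℝ × (0,τ)` with initial data `u₀`. -/
def VeryWeakSol (m : ℝ) (f : ℝ → ℝ → ℝ) (κ : ℝ → ℝ) (τ : ℝ)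
    (u₀ : ℝ → ℝ) (u : ℝ → ℝ → ℝ) : Prop :=
  ContinuousOn (fun q : ℝ × ℝ => u q.1 q.2) (univ ×ˢ Ioc (0:ℝ) τ) ∧
  (∃ M : ℝ, ∀ x : ℝ, ∀ t ∈ Ioc (0:ℝ) τ, |u x t| ≤ M) ∧
  ∀ φ : ℝ → ℝ → ℝ, ContDiff ℝ (⊤ : ℕ∞) (Function.uncurry φ) →
    HasCompactSupport (Function.uncurry φ) →
    ∫ x : ℝ, u x τ * φ x τ =
      (∫ x : ℝ, u₀ x * φ x 0)
      + (∫ t in Ioo (0:ℝ) τ, ∫ x : ℝ, f x (u x t) * (κ x - u x t) * φ x t)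
      + (∫ t in Ioo (0:ℝ) τ, ∫ x : ℝ,
          (u x t * deriv (fun s => φ x s) t + u x t ^ m * deriv (deriv (fun y => φ y t)) x))

/-- A global very weak solution: a very weak solution on `ℝ × (0,τ)` for every `τ > 0`. -/
def GlobalVeryWeakSol (m : ℝ) (f : ℝ → ℝ → ℝ) (κ : ℝ → ℝ)
    (u₀ : ℝ → ℝ) (u : ℝ → ℝ → ℝ) : Prop :=
  ∀ τ > (0:ℝ), VeryWeakSol m f κ τ u₀ u

/-- Left spatial derivative of the pressure `v = (m/(m-1)) u^{m-1}` at the point `z`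
(at time `t`). -/
def pressureDx (m : ℝ) (u : ℝ → ℝ → ℝ) (z t : ℝ) : ℝ :=
  derivWithin (fun y => (m / (m - 1)) * u y t ^ (m - 1)) (Iic z) z

/-- The renormalization setting: (F1), (F2), a positive 1-periodic stationary solution `p`
with `p ≥ κ₀` lying strictly above all translates of `φ₀`, a global very weak solution `u`
with Heaviside-type initial data `p·H(-x)` possessing a `C¹`, strictly increasing free
boundary `b → ∞` along which Darcy's law holds with nonnegative speed, and the crossing
times `ty y` defined by `b (ty y) = y` for `y > 0`. -/
def RenormSetting (m : ℝ) (f : ℝ → ℝ → ℝ) (κ : ℝ → ℝ) (θ c₀ l₀ : ℝ) (φ₀ p : ℝ → ℝ)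
    (u : ℝ → ℝ → ℝ) (b : ℝ → ℝ) (ty : ℝ → ℝ) : Prop :=
  CondF1 f κ θ ∧ CondF2 m f κ c₀ l₀ φ₀ ∧
  ContDiff ℝ 2 p ∧ (∀ x, 0 < p x) ∧ (∀ x, p (x + 1) = p x) ∧
  (∀ x, deriv (deriv (fun y => p y ^ m)) x + f x (p x) * (κ x - p x) = 0) ∧
  (∀ x, kappaMin κ ≤ p x) ∧
  (∀ x₀ : ℝ, ∀ x ∈ Icc (x₀ - l₀) (x₀ + l₀), φ₀ (x - x₀) < p x) ∧
  GlobalVeryWeakSol m f κ (fun x => if x ≤ 0 then p x else 0) u ∧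
  (∀ t > (0:ℝ), DifferentiableAt ℝ b t) ∧
  ContinuousOn (deriv b) (Ioi 0) ∧
  (∀ t > (0:ℝ), ∀ x : ℝ, (x < b t → 0 < u x t) ∧ (b t ≤ x → u x t = 0)) ∧
  StrictMonoOn b (Ioi 0) ∧
  Tendsto b atTop atTop ∧
  (∀ x t : ℝ, 0 < t → 0 < u x t →
      DifferentiableAt ℝ (fun s => u x s) t ∧
      DifferentiableAt ℝ (fun y => u y t) x ∧
      DifferentiableAt ℝ (deriv (fun y => u y t)) x) ∧
  (∀ t > (0:ℝ), deriv b t = -(pressureDx m u (b t) t) ∧ 0 ≤ deriv b t) ∧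
  (∀ y > (0:ℝ), 0 < ty y ∧ b (ty y) = y)

/-! ### Explicit finite-difference scheme for the dual problem -/

/-- Second difference of a grid function. -/
def secondDiff (φ : ℤ → ℝ) (i : ℤ) : ℝ := φ (i + 1) - 2 * φ i + φ (i - 1)

/-- One explicit step of the dual equation with mesh ratio `l` and time step `τ`. -/
def dualStep (l τ : ℝ) (a c φ : ℤ → ℝ) (i : ℤ) : ℝ :=
  φ i + (l * a i * secondDiff φ i + τ * c i * φ i)

/-- The iterates of the explicit dual scheme. -/
def dualSeq (l τ : ℝ) (a c : ℕ → ℤ → ℝ) (ψ : ℤ → ℝ) : ℕ → ℤ → ℝ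
  | 0 => ψ
  | j + 1 => dualStep l τ (a j) (c j) (dualSeq l τ a c ψ j)

/-- A grid function vanishing outside the open discrete interval `(-N, N)`. -/
def VanishOut (N : ℕ) (φ : ℤ → ℝ) : Prop := ∀ i : ℤ, (N : ℤ) ≤ |i| → φ i = 0

/-- Nonnegative up to some index and nonpositive afterwards. -/
def SignPattern (φ : ℤ → ℝ) : Prop :=
  ∃ k : ℤ, (∀ i ≤ k, 0 ≤ φ i) ∧ ∀ i > k, φ i ≤ 0

lemma VanishOut.dualStep {N : ℕ} {l τ : ℝ} {a c φ : ℤ → ℝ} (ha : VanishOut N a)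
    (hφ : VanishOut N φ) : VanishOut N (dualStep l τ a c φ) := by
  intro i hi
  simp [_root_.dualStep, ha i hi, hφ i hi]

lemma VanishOut.dualSeq {N : ℕ} {l τ : ℝ} {a c : ℕ → ℤ → ℝ} {ψ : ℤ → ℝ}
    (ha : ∀ j, VanishOut N (a j)) (hψ : VanishOut N ψ) (j : ℕ) :
    VanishOut N (dualSeq l τ a c ψ j) := by
  induction j with
  | zero => exact hψ
  | succ j ih => exact VanishOut.dualStep (ha j) ih

lemma dualSeq_linear (l τ : ℝ) (a c : ℕ → ℤ → ℝ) (ψ₁ ψ₂ : ℤ → ℝ) (α β : ℝ) (j : ℕ) (i : ℤ) :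
    dualSeq l τ a c (fun i => α * ψ₁ i - β * ψ₂ i) j i
      = α * dualSeq l τ a c ψ₁ j i - β * dualSeq l τ a c ψ₂ j i := by
  induction j generalizing i with
  | zero => rfl
  | succ j ih => simp only [dualSeq, dualStep, secondDiff, ih]; ring

lemma dualStep_nonneg {l τ A K : ℝ} {a c φ : ℤ → ℝ} (hl : 0 ≤ l) (hτ : 0 ≤ τ)
    (ha : ∀ i, 0 ≤ a i ∧ a i ≤ A) (hc : ∀ i, |c i| ≤ K) (hs : 3 * l * A + τ * K ≤ 1)
    (hφ : ∀ i, 0 ≤ φ i) (i : ℤ) : 0 ≤ dualStep l τ a c φ i := by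
  have h1 : l * a i ≤ l * A := mul_le_mul_of_nonneg_left (ha i).2 hl
  have h0 : 0 ≤ l * a i := mul_nonneg hl (ha i).1
  have h2 : τ * (-K) ≤ τ * c i := mul_le_mul_of_nonneg_left (abs_le.1 (hc i)).1 hτ
  have h3 : 0 ≤ 1 - 2 * (l * a i) + τ * c i := by nlinarith
  have := mul_nonneg h3 (hφ i)
  have := mul_nonneg h0 (hφ (i + 1))
  have := mul_nonneg h0 (hφ (i - 1))
  simp only [dualStep, secondDiff]
  nlinarith

lemma dualSeq_nonneg {l τ A K : ℝ} {a c : ℕ → ℤ → ℝ} {ψ : ℤ → ℝ} (hl : 0 ≤ l) (hτ : 0 ≤ τ)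
    (ha : ∀ j i, 0 ≤ a j i ∧ a j i ≤ A) (hc : ∀ j i, |c j i| ≤ K)
    (hs : 3 * l * A + τ * K ≤ 1) (hψ : ∀ i, 0 ≤ ψ i) (j : ℕ) (i : ℤ) :
    0 ≤ dualSeq l τ a c ψ j i := by
  induction j generalizing i with
  | zero => exact hψ i
  | succ j ih => exact dualStep_nonneg hl hτ (ha j) (hc j) hs ih i

lemma dualStep_abs_le {N : ℕ} {l τ A K B : ℝ} {a c φ : ℤ → ℝ} (hl : 0 ≤ l) (hτ : 0 ≤ τ)
    (hB : 0 ≤ B) (hav : VanishOut N a)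
    (ha : ∀ i, 0 ≤ a i ∧ a i ≤ A) (hc : ∀ i, |c i| ≤ K) (hs : 3 * l * A + τ * K ≤ 1)
    (hφ : ∀ i : ℤ, |i| ≤ N → |φ i| ≤ B * (N - |(i : ℝ)|)) (i : ℤ) (hi : |i| ≤ N) :
    |dualStep l τ a c φ i| ≤ (1 + τ * K) * B * (N - |(i : ℝ)|) := by
  have h2 := abs_le.1 (hc i)
  have hc1 : τ * c i ≤ τ * K := mul_le_mul_of_nonneg_left h2.2 hτ
  have hc2 : τ * (-K) ≤ τ * c i := mul_le_mul_of_nonneg_left h2.1 hτ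
  have h1 : l * a i ≤ l * A := mul_le_mul_of_nonneg_left (ha i).2 hl
  have h0 : 0 ≤ l * a i := mul_nonneg hl (ha i).1
  have h3 : 0 ≤ 1 - 2 * (l * a i) + τ * c i := by nlinarith
  have hbi := hφ i hi
  have hNi : 0 ≤ (N : ℝ) - |(i : ℝ)| := by
    have : ((|i| : ℤ) : ℝ) ≤ (N : ℝ) := by exact_mod_cast hi
    push_cast at this; linarith
  rcases hi.lt_or_eq with hlt | heq
  · have e1 : dualStep l τ a c φ i = (1 - 2 * (l * a i) + τ * c i) * φ i
        + l * a i * (φ (i + 1) + φ (i - 1)) := by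
      simp only [dualStep, secondDiff]; ring
    have hp := hφ (i + 1) (by rw [abs_lt] at hlt; rw [abs_le]; omega)
    have hm := hφ (i - 1) (by rw [abs_lt] at hlt; rw [abs_le]; omega)
    push_cast at hp hm
    have hconv : 2 * |(i : ℝ)| ≤ |(i : ℝ) + 1| + |(i : ℝ) - 1| := by
      have := abs_add_le ((i : ℝ) + 1) ((i : ℝ) - 1)
      rw [show (i : ℝ) + 1 + (i - 1) = 2 * i by ring, abs_mul, abs_two] at this
      exact this
    have hsum : |φ (i + 1) + φ (i - 1)| ≤ B * (2 * (N - |(i : ℝ)|)) := by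
      refine (abs_add_le _ _).trans ?_
      nlinarith
    rw [e1]
    refine (abs_add_le _ _).trans ?_
    rw [abs_mul, abs_mul, abs_of_nonneg h3, abs_of_nonneg h0]
    have i1 := mul_le_mul_of_nonneg_left hbi h3
    have i2 := mul_le_mul_of_nonneg_left hsum h0
    have i3 : 0 ≤ (τ * K - τ * c i) * (B * (N - |(i : ℝ)|)) :=
      mul_nonneg (by linarith) (mul_nonneg hB hNi)
    nlinarith
  · have hz : a i = 0 := hav i heq.ge
    have hr : |(i : ℝ)| = N := by exact_mod_cast heq
    rw [hr] at hbi ⊢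
    have : φ i = 0 := by
      rw [sub_self, mul_zero] at hbi
      exact abs_nonpos_iff.1 hbi
    simp [dualStep, hz, this]

lemma dualSeq_abs_le {N : ℕ} {l τ A K B : ℝ} {a c : ℕ → ℤ → ℝ} {ψ : ℤ → ℝ} (hl : 0 ≤ l)
    (hτ : 0 ≤ τ) (hB : 0 ≤ B) (hK : 0 ≤ K) (hav : ∀ j, VanishOut N (a j))
    (ha : ∀ j i, 0 ≤ a j i ∧ a j i ≤ A) (hc : ∀ j i, |c j i| ≤ K)
    (hs : 3 * l * A + τ * K ≤ 1)
    (hψ : ∀ i : ℤ, |i| ≤ N → |ψ i| ≤ B * (N - |(i : ℝ)|)) (j : ℕ) (i : ℤ) (hi : |i| ≤ N) :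
    |dualSeq l τ a c ψ j i| ≤ (1 + τ * K) ^ j * B * (N - |(i : ℝ)|) := by
  induction j generalizing i with
  | zero => simpa [dualSeq] using hψ i hi
  | succ j ih =>
    have := dualStep_abs_le (c := c j) hl hτ
      (mul_nonneg (pow_nonneg (by positivity : 0 ≤ 1 + τ * K) j) hB) (hav j) (ha j) (hc j) hs ih i hi
    rw [pow_succ']
    simpa [dualSeq, mul_assoc] using this

lemma SignPattern.dualStep {l τ A K : ℝ} {a c φ : ℤ → ℝ} (hl : 0 ≤ l) (hτ : 0 ≤ τ)
    (ha : ∀ i, 0 ≤ a i ∧ a i ≤ A) (hc : ∀ i, |c i| ≤ K) (hs : 3 * l * A + τ * K ≤ 1)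
    (hφ : SignPattern φ) : SignPattern (dualStep l τ a c φ) := by
  obtain ⟨k, hk1, hk2⟩ := hφ
  have e1 : ∀ i, _root_.dualStep l τ a c φ i = (1 - 2 * (l * a i) + τ * c i) * φ i
      + l * a i * φ (i + 1) + l * a i * φ (i - 1) := fun i => by
    simp only [_root_.dualStep, secondDiff]; ring
  have h1 : ∀ i, l * a i ≤ l * A := fun i => mul_le_mul_of_nonneg_left (ha i).2 hl
  have h0 : ∀ i, 0 ≤ l * a i := fun i => mul_nonneg hl (ha i).1
  have h3 : ∀ i, l * A ≤ 1 - 2 * (l * a i) + τ * c i := fun i => by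
    have := mul_le_mul_of_nonneg_left (abs_le.1 (hc i)).1 hτ
    have := h1 i
    linarith
  have hA : 0 ≤ l * A := (h0 0).trans (h1 0)
  have h4 : ∀ i, 0 ≤ 1 - 2 * (l * a i) + τ * c i := fun i => hA.trans (h3 i)
  have hpos : ∀ i ≤ k - 1, 0 ≤ _root_.dualStep l τ a c φ i := fun i hi => by
    rw [e1]
    have := mul_nonneg (h4 i) (hk1 i (by omega))
    have := mul_nonneg (h0 i) (hk1 (i + 1) (by omega))
    have := mul_nonneg (h0 i) (hk1 (i - 1) (by omega))
    linarith
  have hneg : ∀ i > k + 1, _root_.dualStep l τ a c φ i ≤ 0 := fun i hi => by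
    rw [e1]
    have := mul_nonpos_of_nonneg_of_nonpos (h4 i) (hk2 i (by omega))
    have := mul_nonpos_of_nonneg_of_nonpos (h0 i) (hk2 (i + 1) (by omega))
    have := mul_nonpos_of_nonneg_of_nonpos (h0 i) (hk2 (i - 1) (by omega))
    linarith
  have hor : 0 ≤ _root_.dualStep l τ a c φ k ∨ _root_.dualStep l τ a c φ (k + 1) ≤ 0 := by
    by_contra! hcon
    obtain ⟨c1, c2⟩ := hcon
    rw [e1] at c1 c2
    rw [show k + 1 - 1 = k by ring] at c2
    have p0 := hk1 k le_rfl
    have p1 := hk2 (k + 1) (by omega)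
    have q0 := mul_nonneg (h0 k) (hk1 (k - 1) (by omega))
    have q1 := mul_nonpos_of_nonneg_of_nonpos (h0 (k + 1)) (hk2 (k + 1 + 1) (by omega))
    have r0 := mul_le_mul_of_nonneg_right (h3 k) p0
    have r1 := mul_le_mul_of_nonpos_right (h3 (k + 1)) p1
    have s0 := mul_le_mul_of_nonneg_right (h1 (k + 1)) p0
    have s1 := mul_le_mul_of_nonpos_right (h1 k) p1
    linarith
  by_cases hk : 0 ≤ _root_.dualStep l τ a c φ k
  · by_cases hk' : _root_.dualStep l τ a c φ (k + 1) ≤ 0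
    · refine ⟨k, fun i hi => ?_, fun i hi => ?_⟩
      · rcases hi.lt_or_eq with h | rfl
        · exact hpos i (by omega)
        · exact hk
      · rcases (show k + 1 ≤ i by omega).lt_or_eq with h | rfl
        · exact hneg i h
        · exact hk'
    · refine ⟨k + 1, fun i hi => ?_, hneg⟩
      rcases hi.lt_or_eq with h | rfl
      · rcases (show i ≤ k by omega).lt_or_eq with h | rfl
        · exact hpos i (by omega)
        · exact hk
      · exact (not_le.1 hk').le
  · refine ⟨k - 1, hpos, fun i hi => ?_⟩
    rcases (show k ≤ i by omega).lt_or_eq with h | rfl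
    · rcases (show k + 1 ≤ i by omega).lt_or_eq with h | rfl
      · exact hneg i h
      · exact hor.resolve_left hk
    · exact (not_le.1 hk).le

lemma SignPattern.dualSeq {l τ A K : ℝ} {a c : ℕ → ℤ → ℝ} {ψ : ℤ → ℝ} (hl : 0 ≤ l)
    (hτ : 0 ≤ τ) (ha : ∀ j i, 0 ≤ a j i ∧ a j i ≤ A) (hc : ∀ j i, |c j i| ≤ K)
    (hs : 3 * l * A + τ * K ≤ 1) (hψ : SignPattern ψ) (j : ℕ) :
    SignPattern (dualSeq l τ a c ψ j) := by
  induction j with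
  | zero => exact hψ
  | succ j ih => exact SignPattern.dualStep hl hτ (ha j) (hc j) hs ih

lemma sum_Icc_shift {N : ℕ} {F : ℤ → ℝ} (h1 : ∀ i : ℤ, (N : ℤ) < |i| → F i = 0)
    (h2 : ∀ i : ℤ, (N : ℤ) < |i| → F (i + 1) = 0) :
    ∑ i ∈ Finset.Icc (-(N : ℤ)) N, F (i + 1) = ∑ i ∈ Finset.Icc (-(N : ℤ)) N, F i := by
  have hout : ∀ i : ℤ, i ∉ Finset.Icc (-(N : ℤ)) N → (N : ℤ) < |i| := fun i hi => by
    rw [Finset.mem_Icc, ← abs_le] at hi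
    exact not_le.1 hi
  have t1 : ∑' i, F (i + 1) = ∑ i ∈ Finset.Icc (-(N : ℤ)) N, F (i + 1) :=
    tsum_eq_sum fun i hi => h2 i (hout i hi)
  have t2 : ∑' i, F i = ∑ i ∈ Finset.Icc (-(N : ℤ)) N, F i :=
    tsum_eq_sum fun i hi => h1 i (hout i hi)
  rw [← t1, ← t2]
  exact (Equiv.addRight (1 : ℤ)).tsum_eq F

lemma sum_mul_secondDiff {N : ℕ} {φ : ℤ → ℝ} (hφ : VanishOut N φ) (ζ : ℤ → ℝ) :
    ∑ i ∈ Finset.Icc (-(N : ℤ)) N, φ i * secondDiff ζ i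
      = ∑ i ∈ Finset.Icc (-(N : ℤ)) N, secondDiff φ i * ζ i := by
  have s1 := sum_Icc_shift (N := N) (F := fun i => φ (i - 1) * ζ i)
    (fun i hi => by rw [hφ (i - 1) (by rw [lt_abs] at hi; rw [le_abs]; omega), zero_mul])
    (fun i hi => by
      rw [show i + 1 - 1 = i by ring, hφ i hi.le, zero_mul])
  have s2 := sum_Icc_shift (N := N) (F := fun i => φ i * ζ (i - 1))
    (fun i hi => by rw [hφ i hi.le, zero_mul])
    (fun i hi => by
      rw [hφ (i + 1) (by rw [lt_abs] at hi; rw [le_abs]; omega), zero_mul])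
  simp only [add_sub_cancel_right] at s1 s2
  simp only [secondDiff, mul_add, mul_sub, add_mul, sub_mul, Finset.sum_add_distrib,
    Finset.sum_sub_distrib]
  rw [s1, ← s2]
  have : ∀ i, φ i * (2 * ζ i) = 2 * φ i * ζ i := fun i => by ring
  simp only [this]
  ring

lemma sum_diff_mul_diff {N : ℕ} {φ ψ : ℤ → ℝ} (hφ : VanishOut N φ) (hψ : VanishOut N ψ) :
    ∑ i ∈ Finset.Icc (-(N : ℤ)) N, (φ (i + 1) - φ i) * (ψ (i + 1) - ψ i)
      = -∑ i ∈ Finset.Icc (-(N : ℤ)) N, secondDiff φ i * ψ i := by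
  have s1 := sum_Icc_shift (N := N) (F := fun i => φ i * ψ i)
    (fun i hi => by rw [hφ i hi.le, zero_mul])
    (fun i hi => by
      rw [hφ (i + 1) (by rw [lt_abs] at hi; rw [le_abs]; omega), zero_mul])
  have s2 := sum_Icc_shift (N := N) (F := fun i => φ (i - 1) * ψ i)
    (fun i hi => by rw [hψ i hi.le, mul_zero])
    (fun i hi => by
      rw [hψ (i + 1) (by rw [lt_abs] at hi; rw [le_abs]; omega), mul_zero])
  simp only [add_sub_cancel_right] at s2
  simp only [secondDiff, mul_sub, add_mul, sub_mul, Finset.sum_add_distrib,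
    Finset.sum_sub_distrib]
  rw [s1, s2]
  simp only [mul_assoc, ← Finset.mul_sum]
  ring

lemma sum_sq_diff_le {N : ℕ} {ψ : ℤ → ℝ} (hψ : VanishOut N ψ) :
    ∑ i ∈ Finset.Icc (-(N : ℤ)) N, (ψ (i + 1) - ψ i) ^ 2
      ≤ 4 * ∑ i ∈ Finset.Icc (-(N : ℤ)) N, ψ i ^ 2 := by
  have s1 := sum_Icc_shift (N := N) (F := fun i => ψ i ^ 2)
    (fun i hi => by simp [hψ i hi.le])
    (fun i hi => by simp [hψ (i + 1) (by rw [lt_abs] at hi; rw [le_abs]; omega)])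
  calc _ ≤ ∑ i ∈ Finset.Icc (-(N : ℤ)) N, (2 * ψ (i + 1) ^ 2 + 2 * ψ i ^ 2) :=
        Finset.sum_le_sum fun i _ => by nlinarith [sq_nonneg (ψ (i + 1) + ψ i)]
    _ = _ := by rw [Finset.sum_add_distrib, ← Finset.mul_sum, ← Finset.mul_sum, s1]; ring

/-- The discrete Dirichlet energy, multiplied by the mesh size. -/
def gridEnergy (N : ℕ) (φ : ℤ → ℝ) : ℝ :=
  ∑ i ∈ Finset.Icc (-(N : ℤ)) N, (φ (i + 1) - φ i) ^ 2

lemma gridEnergy_dualStep_le {N : ℕ} {l τ A K d : ℝ} {a c φ : ℤ → ℝ} (hl : 0 ≤ l) (hτ : 0 ≤ τ)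
    (hav : VanishOut N a) (hφ : VanishOut N φ)
    (ha : ∀ i, 0 ≤ a i ∧ a i ≤ A) (hc : ∀ i, |c i| ≤ K)
    (hcd : ∀ i, |c (i + 1) - c i| ≤ d) (hs : 8 * l * A ≤ 1) :
    gridEnergy N (dualStep l τ a c φ)
        + l * ∑ i ∈ Finset.Icc (-(N : ℤ)) N, a i * secondDiff φ i ^ 2
      ≤ (1 + τ * (2 * K + 1)) * gridEnergy N φ
        + (τ * d ^ 2 + 8 * τ ^ 2 * K ^ 2) * ∑ i ∈ Finset.Icc (-(N : ℤ)) N, φ i ^ 2 := by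
  set S := Finset.Icc (-(N : ℤ)) N
  set ψ : ℤ → ℝ := fun i => l * a i * secondDiff φ i + τ * c i * φ i with hψdef
  have hψ : VanishOut N ψ := fun i hi => by simp [hψdef, hav i hi, hφ i hi]
  have hcφ : VanishOut N (fun i => c i * φ i) := fun i hi => by simp [hφ i hi]
  set Q := ∑ i ∈ S, a i * secondDiff φ i ^ 2 with hQ
  set P := ∑ i ∈ S, φ i ^ 2 with hP
  set X := ∑ i ∈ S, secondDiff φ i * (c i * φ i) with hX
  have e1 : gridEnergy N (dualStep l τ a c φ) = gridEnergy N φ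
      + 2 * (∑ i ∈ S, (φ (i + 1) - φ i) * (ψ (i + 1) - ψ i))
      + ∑ i ∈ S, (ψ (i + 1) - ψ i) ^ 2 := by
    rw [gridEnergy, gridEnergy, Finset.mul_sum, ← Finset.sum_add_distrib,
      ← Finset.sum_add_distrib]
    refine Finset.sum_congr rfl fun i _ => ?_
    simp only [dualStep, hψdef]; ring
  have e2 : ∑ i ∈ S, secondDiff φ i * ψ i = l * Q + τ * X := by
    rw [hQ, hX, Finset.mul_sum, Finset.mul_sum, ← Finset.sum_add_distrib]
    refine Finset.sum_congr rfl fun i _ => ?_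
    simp only [hψdef]; ring
  have e3 : -X ≤ (K + 1 / 2) * gridEnergy N φ + 1 / 2 * d ^ 2 * P := by
    rw [hX, ← sum_diff_mul_diff hφ hcφ, gridEnergy, hP, Finset.mul_sum, Finset.mul_sum,
      ← Finset.sum_add_distrib]
    refine Finset.sum_le_sum fun i _ => ?_
    have h1 : c (i + 1) * (φ (i + 1) - φ i) ^ 2 ≤ K * (φ (i + 1) - φ i) ^ 2 :=
      mul_le_mul_of_nonneg_right (abs_le.1 (hc _)).2 (sq_nonneg _)
    have h2 : (c (i + 1) - c i) ^ 2 ≤ d ^ 2 := by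
      rw [← sq_abs]; exact pow_le_pow_left₀ (abs_nonneg _) (hcd i) 2
    have h3 := mul_le_mul_of_nonneg_right h2 (sq_nonneg (φ i))
    nlinarith [sq_nonneg ((c (i + 1) - c i) * φ i - (φ (i + 1) - φ i))]
  have e4 : ∑ i ∈ S, ψ i ^ 2 ≤ 2 * l ^ 2 * A * Q + 2 * τ ^ 2 * K ^ 2 * P := by
    rw [hQ, hP, Finset.mul_sum, Finset.mul_sum, ← Finset.sum_add_distrib]
    refine Finset.sum_le_sum fun i _ => ?_
    have h2 : c i ^ 2 ≤ K ^ 2 := by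
      rw [← sq_abs]; exact pow_le_pow_left₀ (abs_nonneg _) (hc i) 2
    have h3 := mul_le_mul_of_nonneg_left h2 (mul_nonneg (sq_nonneg τ) (sq_nonneg (φ i)))
    have h4 : a i ^ 2 ≤ A * a i := by nlinarith [(ha i).1, (ha i).2]
    have h5 := mul_le_mul_of_nonneg_left h4 (mul_nonneg (sq_nonneg l) (sq_nonneg (secondDiff φ i)))
    simp only [hψdef]
    nlinarith [sq_nonneg (l * a i * secondDiff φ i - τ * c i * φ i)]
  have e5 := sum_sq_diff_le hψ
  have hQ0 : 0 ≤ Q := Finset.sum_nonneg fun i _ => mul_nonneg (ha i).1 (sq_nonneg _)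
  have e6 : 8 * l * A * (l * Q) ≤ l * Q := by
    simpa using mul_le_mul_of_nonneg_right hs (mul_nonneg hl hQ0)
  have e7 := mul_le_mul_of_nonneg_left e3 hτ
  rw [e1, sum_diff_mul_diff hφ hψ, e2]
  nlinarith

lemma sum_energy_le {n : ℕ} {G Q : ℕ → ℝ} {x y : ℝ} (hx : 0 ≤ x) (hy : 0 ≤ y)
    (hQ : ∀ j, 0 ≤ Q j) (hG : ∀ j, 0 ≤ G j)
    (h : ∀ j < n, G (j + 1) + Q j ≤ (1 + x) * G j + y) :
    ∑ j ∈ Finset.range n, Q j ≤ (1 + x) ^ n * (G 0 + n * y) := by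
  suffices H : ∀ j ≤ n, G j + ∑ i ∈ Finset.range j, Q i ≤ (1 + x) ^ j * (G 0 + j * y) by
    have := H n le_rfl
    linarith [hG n]
  intro j
  induction j with
  | zero => simp
  | succ j ih =>
    intro hj
    have h1 := h j (by omega)
    have h2 := ih (by omega)
    have h3 : 0 ≤ ∑ i ∈ Finset.range j, Q i := Finset.sum_nonneg fun i _ => hQ i
    have h4 := mul_le_mul_of_nonneg_left h2 (by linarith : 0 ≤ 1 + x)
    have h5 : 1 ≤ (1 + x) ^ (j + 1) := one_le_pow₀ (by linarith)
    rw [Finset.sum_range_succ, pow_succ']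
    push_cast
    rw [pow_succ'] at h5
    nlinarith [mul_nonneg hx h3, mul_le_mul_of_nonneg_right h5 hy]

lemma young_mesh {τ h D e μ ε : ℝ} (hτ : 0 ≤ τ) (hh : 0 < h) (hμ : 0 < μ) (hε : 0 < ε) :
    τ / h * (D * e) ≤ μ / 2 * (τ / h ^ 2 / h * (ε * D ^ 2)) + τ * h * (e ^ 2 / (2 * μ * ε)) := by
  have key : μ / 2 * (τ / h ^ 2 / h * (ε * D ^ 2)) + τ * h * (e ^ 2 / (2 * μ * ε))
      - τ / h * (D * e) = τ * h * ((μ * ε * (D / h ^ 2) - e) ^ 2 / (2 * μ * ε)) := by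
    field_simp
    ring
  have : 0 ≤ τ * h * ((μ * ε * (D / h ^ 2) - e) ^ 2 / (2 * μ * ε)) := by positivity
  linarith

lemma duality_step_le {N : ℕ} {τ h B M μ ε e₁ e₂ : ℝ} {a c φ W₀ W₁ zb Hb : ℤ → ℝ}
    (hτ : 0 ≤ τ) (hh : 0 < h) (hμ : 0 < μ) (hε : 0 < ε)
    (hB : 0 ≤ B) (hav : VanishOut N a) (hφ : VanishOut N φ)
    (haε : ∀ i : ℤ, |i| < N → ε ≤ a i)
    (hφB : ∀ i : ℤ, |i| ≤ N → |φ i| ≤ B * (N - |(i : ℝ)|))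
    (hrel : ∀ i, W₀ i = W₁ i + τ * (h * Hb i + secondDiff zb i / h))
    (h₁ : ∀ i : ℤ, |i| < N → |zb i - a i * (W₁ i / h)| ≤ e₁)
    (h₂ : ∀ i : ℤ, |i| ≤ N → |Hb i - c i * (W₁ i / h)| ≤ e₂)
    (hM : ∀ i : ℤ, |zb i| ≤ M) :
    |∑ i ∈ Finset.Icc (-(N : ℤ)) N, φ i * W₀ i
        - ∑ i ∈ Finset.Icc (-(N : ℤ)) N, dualStep (τ / h ^ 2) τ a c φ i * W₁ i|
      ≤ μ / 2 * (τ / h ^ 2 / h * ∑ i ∈ Finset.Icc (-(N : ℤ)) N, a i * secondDiff φ i ^ 2)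
        + τ * (h * (2 * N + 1)) * (e₁ ^ 2 / (2 * μ * ε) + B * N * e₂) + τ * (2 * (B * M / h)) := by
  set S := Finset.Icc (-(N : ℤ)) N
  have hM0 : 0 ≤ M := (abs_nonneg _).trans (hM 0)
  have e1 : ∑ i ∈ S, φ i * W₀ i - ∑ i ∈ S, dualStep (τ / h ^ 2) τ a c φ i * W₁ i
      = ∑ i ∈ S, (τ / h * (secondDiff φ i * (zb i - a i * (W₁ i / h)))
        + τ * h * (φ i * (Hb i - c i * (W₁ i / h)))) := by
    have t1 : ∑ i ∈ S, φ i * W₀ i = ∑ i ∈ S, (φ i * W₁ i + τ * h * (φ i * Hb i))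
        + τ / h * ∑ i ∈ S, φ i * secondDiff zb i := by
      rw [Finset.mul_sum, ← Finset.sum_add_distrib]
      refine Finset.sum_congr rfl fun i _ => ?_
      rw [hrel]; ring
    rw [t1, sum_mul_secondDiff hφ, Finset.mul_sum, ← Finset.sum_add_distrib,
      ← Finset.sum_sub_distrib]
    refine Finset.sum_congr rfl fun i _ => ?_
    rw [dualStep]
    field_simp
    ring
  have hterm : ∀ i ∈ S, |τ / h * (secondDiff φ i * (zb i - a i * (W₁ i / h)))
        + τ * h * (φ i * (Hb i - c i * (W₁ i / h)))|
      ≤ μ / 2 * (τ / h ^ 2 / h * (a i * secondDiff φ i ^ 2))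
        + τ * h * (e₁ ^ 2 / (2 * μ * ε) + B * N * e₂)
        + ((if i = (N : ℤ) then τ * (B * M / h) else 0)
          + if i = -(N : ℤ) then τ * (B * M / h) else 0) := by
    intro i hi
    rw [Finset.mem_Icc, ← abs_le] at hi
    have hnn : ∀ i : ℤ, 0 ≤ (if i = (N : ℤ) then τ * (B * M / h) else 0) ∧
        0 ≤ if i = -(N : ℤ) then τ * (B * M / h) else 0 := fun i => by
      constructor <;> split_ifs <;> positivity
    have b2 : |τ * h * (φ i * (Hb i - c i * (W₁ i / h)))| ≤ τ * h * (B * N * e₂) := by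
      rw [abs_mul (τ * h), abs_mul (φ i), abs_of_nonneg (by positivity : 0 ≤ τ * h)]
      refine mul_le_mul_of_nonneg_left (mul_le_mul ((hφB i hi).trans ?_) (h₂ i hi)
        (abs_nonneg _) (by positivity)) (by positivity)
      exact mul_le_mul_of_nonneg_left (by linarith [abs_nonneg (i : ℝ)]) hB
    refine (abs_add_le _ _).trans ?_
    rw [abs_mul (τ / h), abs_of_nonneg (by positivity : 0 ≤ τ / h), abs_mul (secondDiff φ i)]
    rcases hi.lt_or_eq with hlt | heq
    · have y := young_mesh (D := |secondDiff φ i|) (e := e₁) hτ hh hμ hε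
      have y1 : τ / h * (|secondDiff φ i| * |zb i - a i * (W₁ i / h)|)
          ≤ τ / h * (|secondDiff φ i| * e₁) := by
        gcongr
        exact h₁ i hlt
      have y2 : μ / 2 * (τ / h ^ 2 / h * (ε * |secondDiff φ i| ^ 2))
          ≤ μ / 2 * (τ / h ^ 2 / h * (a i * secondDiff φ i ^ 2)) := by
        rw [sq_abs]
        gcongr
        exact haε i hlt
      have := hnn i
      rw [mul_add (τ * h)]
      linarith
    · have ha0 : a i = 0 := hav i heq.ge
      have hφ0 : φ i = 0 := hφ i heq.ge
      have hD : |secondDiff φ i| ≤ B := by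
        rcases (abs_eq (by positivity)).1 heq with rfl | rfl
        · by_cases hN : N = 0
          · subst hN
            have : ∀ i, φ i = 0 := fun i => hφ i (by simp)
            simpa [secondDiff, this] using hB
          · have h1 : φ ((N : ℤ) + 1) = 0 := hφ _ (by rw [le_abs]; omega)
            have h2 := hφB ((N : ℤ) - 1) (by rw [abs_le]; omega)
            have hN1 : (1 : ℝ) ≤ N := by exact_mod_cast Nat.one_le_iff_ne_zero.2 hN
            push_cast at h2
            rw [abs_of_nonneg (by linarith : (0 : ℝ) ≤ N - 1)] at h2
            simpa [secondDiff, hφ0, h1] using h2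
        · by_cases hN : N = 0
          · subst hN
            have : ∀ i, φ i = 0 := fun i => hφ i (by simp)
            simpa [secondDiff, this] using hB
          · have h1 : φ (-(N : ℤ) - 1) = 0 := hφ _ (by rw [le_abs]; omega)
            have h2 := hφB (-(N : ℤ) + 1) (by rw [abs_le]; omega)
            have hN1 : (1 : ℝ) ≤ N := by exact_mod_cast Nat.one_le_iff_ne_zero.2 hN
            push_cast at h2
            rw [abs_of_nonpos (by linarith : -(N : ℝ) + 1 ≤ 0)] at h2
            simp only [secondDiff, hφ0, h1]
            ring_nf at h2 ⊢
            exact h2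
      have hbd : τ / h * (|secondDiff φ i| * |zb i - a i * (W₁ i / h)|) ≤ τ * (B * M / h) := by
        rw [ha0, zero_mul, sub_zero, show τ * (B * M / h) = τ / h * (B * M) by ring]
        gcongr
        exact hM i
      have hq : 0 ≤ τ * h * (e₁ ^ 2 / (2 * μ * ε)) := by positivity
      have hor : τ * (B * M / h) ≤ (if i = (N : ℤ) then τ * (B * M / h) else 0)
          + if i = -(N : ℤ) then τ * (B * M / h) else 0 := by
        rcases (abs_eq (by positivity)).1 heq with h' | h'
        · rw [if_pos h']; linarith [(hnn i).2]
        · rw [if_pos h']; linarith [(hnn i).1]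
      have hz : μ / 2 * (τ / h ^ 2 / h * (a i * secondDiff φ i ^ 2)) = 0 := by rw [ha0]; ring
      rw [mul_add (τ * h), hz]
      linarith
  rw [e1]
  refine (Finset.abs_sum_le_sum_abs _ _).trans ((Finset.sum_le_sum hterm).trans ?_)
  rw [Finset.sum_add_distrib, Finset.sum_add_distrib, Finset.sum_add_distrib,
    ← Finset.mul_sum, ← Finset.mul_sum, Finset.sum_const, Finset.sum_ite_eq', Finset.sum_ite_eq',
    if_pos (by simp [S]), if_pos (by simp [S]), Int.card_Icc, nsmul_eq_mul]
  have : (((N : ℤ) + 1 - -(N : ℤ)).toNat : ℝ) = 2 * N + 1 := by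
    have : ((N : ℤ) + 1 - -(N : ℤ)).toNat = 2 * N + 1 := by omega
    rw [this]; push_cast; ring
  rw [this]
  apply le_of_eq
  ring

lemma duality_error_le {N n : ℕ} {τ h B M μ ε E : ℝ} {e₁ e₂ : ℕ → ℝ} {a c : ℕ → ℤ → ℝ}
    {ψ : ℤ → ℝ} {W zb Hb : ℕ → ℤ → ℝ}
    (hτ : 0 ≤ τ) (hh : 0 < h) (hμ : 0 < μ) (hε : 0 < ε)
    (hB : 0 ≤ B) (hav : ∀ j, VanishOut N (a j)) (hψ : VanishOut N ψ)
    (haε : ∀ j, ∀ i : ℤ, |i| < N → ε ≤ a j i)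
    (hφB : ∀ j < n, ∀ i : ℤ, |i| ≤ N →
      |dualSeq (τ / h ^ 2) τ a c ψ j i| ≤ B * (N - |(i : ℝ)|))
    (hrel : ∀ j < n, ∀ i, W j i = W (j + 1) i + τ * (h * Hb j i + secondDiff (zb j) i / h))
    (h₁ : ∀ j < n, ∀ i : ℤ, |i| < N → |zb j i - a j i * (W (j + 1) i / h)| ≤ e₁ j)
    (h₂ : ∀ j < n, ∀ i : ℤ, |i| ≤ N → |Hb j i - c j i * (W (j + 1) i / h)| ≤ e₂ j)
    (hM : ∀ j < n, ∀ i : ℤ, |zb j i| ≤ M)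
    (hE : ∑ j ∈ Finset.range n, τ / h ^ 2 / h * ∑ i ∈ Finset.Icc (-(N : ℤ)) N,
      a j i * secondDiff (dualSeq (τ / h ^ 2) τ a c ψ j) i ^ 2 ≤ E) :
    |∑ i ∈ Finset.Icc (-(N : ℤ)) N, ψ i * W 0 i
        - ∑ i ∈ Finset.Icc (-(N : ℤ)) N, dualSeq (τ / h ^ 2) τ a c ψ n i * W n i|
      ≤ μ / 2 * E + h * (2 * N + 1) * ((∑ j ∈ Finset.range n, τ * e₁ j ^ 2) / (2 * μ * ε)
        + B * N * ∑ j ∈ Finset.range n, τ * e₂ j) + n * τ * (2 * (B * M / h)) := by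
  set I : ℕ → ℝ := fun j =>
    ∑ i ∈ Finset.Icc (-(N : ℤ)) N, dualSeq (τ / h ^ 2) τ a c ψ j i * W j i with hI
  have htel : I 0 - I n = ∑ j ∈ Finset.range n, (I j - I (j + 1)) := by
    rw [Finset.sum_range_sub']
  change |I 0 - I n| ≤ _
  rw [htel]
  refine (Finset.abs_sum_le_sum_abs _ _).trans ((Finset.sum_le_sum fun j hj => ?_).trans
    (b := ∑ j ∈ Finset.range n, (μ / 2 * (τ / h ^ 2 / h * ∑ i ∈ Finset.Icc (-(N : ℤ)) N,
        a j i * secondDiff (dualSeq (τ / h ^ 2) τ a c ψ j) i ^ 2)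
      + τ * (h * (2 * N + 1)) * (e₁ j ^ 2 / (2 * μ * ε) + B * N * e₂ j)
      + τ * (2 * (B * M / h)))) ?_)
  · have hj := Finset.mem_range.1 hj
    exact duality_step_le hτ hh hμ hε hB (hav j) (VanishOut.dualSeq hav hψ j)
      (haε j) (hφB j hj) (hrel j hj) (h₁ j hj) (h₂ j hj) (hM j hj)
  · rw [Finset.sum_add_distrib, Finset.sum_add_distrib, Finset.sum_const, Finset.card_range,
      nsmul_eq_mul, ← Finset.mul_sum]
    have : ∑ j ∈ Finset.range n, τ * (h * (2 * N + 1)) * (e₁ j ^ 2 / (2 * μ * ε) + B * N * e₂ j)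
        = h * (2 * N + 1) * ((∑ j ∈ Finset.range n, τ * e₁ j ^ 2) / (2 * μ * ε)
        + B * N * ∑ j ∈ Finset.range n, τ * e₂ j) := by
      rw [Finset.sum_div, Finset.mul_sum, ← Finset.sum_add_distrib, Finset.mul_sum]
      refine Finset.sum_congr rfl fun j _ => ?_
      ring
    rw [this]
    have := mul_le_mul_of_nonneg_left hE (by positivity : 0 ≤ μ / 2)
    linarith

/-- Space-time energy bound for the dual scheme. -/
lemma dualSeq_energy_le {N n : ℕ} {τ h A B K L P T : ℝ} {a c : ℕ → ℤ → ℝ} {ψ : ℤ → ℝ}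
    (hτ : 0 ≤ τ) (hh : 0 < h) (hK : 0 ≤ K) (hN : 1 ≤ N) (hnT : n * τ = T)
    (hav : ∀ j, VanishOut N (a j)) (hψ : VanishOut N ψ)
    (ha : ∀ j i, 0 ≤ a j i ∧ a j i ≤ A) (hc : ∀ j i, |c j i| ≤ K)
    (hcL : ∀ j i, |c j (i + 1) - c j i| ≤ L * h) (hs : 8 * (τ / h ^ 2) * A ≤ 1)
    (hτh : τ ≤ h ^ 2) (hψP : ∀ i, |ψ (i + 1) - ψ i| ≤ P * h)
    (hB : ∀ j < n, ∀ i, |dualSeq (τ / h ^ 2) τ a c ψ j i| ≤ B) :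
    ∑ j ∈ Finset.range n, τ / h ^ 2 / h * ∑ i ∈ Finset.Icc (-(N : ℤ)) N,
        a j i * secondDiff (dualSeq (τ / h ^ 2) τ a c ψ j) i ^ 2
      ≤ Real.exp (T * (2 * K + 1)) * (3 * (N * h) * P ^ 2
        + T * ((L ^ 2 + 8 * K ^ 2) * (3 * (N * h) * B ^ 2))) := by
  have hN1 : (1 : ℝ) ≤ N := by exact_mod_cast hN
  have hcard : ∀ {F : ℤ → ℝ} {b : ℝ}, 0 ≤ b → (∀ i, F i ^ 2 ≤ b) →
      ∑ i ∈ Finset.Icc (-(N : ℤ)) N, F i ^ 2 ≤ 3 * N * b := by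
    intro F b hb hF
    refine (Finset.sum_le_card_nsmul _ _ b fun i _ => hF i).trans ?_
    rw [Int.card_Icc, nsmul_eq_mul]
    have : ((N : ℤ) + 1 - -(N : ℤ)).toNat = 2 * N + 1 := by omega
    rw [this]; push_cast
    exact mul_le_mul_of_nonneg_right (by linarith) hb
  have hl : 0 ≤ τ / h ^ 2 := by positivity
  have h0 : gridEnergy N ψ ≤ 3 * N * (P * h) ^ 2 :=
    hcard (F := fun i => ψ (i + 1) - ψ i) (sq_nonneg _) fun i => by
      rw [← sq_abs]; exact pow_le_pow_left₀ (abs_nonneg _) (hψP i) 2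
  set y := (L ^ 2 + 8 * K ^ 2) * (3 * (N * h) * B ^ 2) with hy
  have hy0 : 0 ≤ y := by positivity
  have hstep := sum_energy_le (n := n) (x := τ * (2 * K + 1)) (y := τ * h * y)
    (G := fun j => gridEnergy N (dualSeq (τ / h ^ 2) τ a c ψ j))
    (Q := fun j => τ / h ^ 2 * ∑ i ∈ Finset.Icc (-(N : ℤ)) N,
        a j i * secondDiff (dualSeq (τ / h ^ 2) τ a c ψ j) i ^ 2)
    (by positivity) (by positivity)
    (fun j => mul_nonneg hl (Finset.sum_nonneg fun i _ => mul_nonneg (ha j i).1 (sq_nonneg _)))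
    (fun j => Finset.sum_nonneg fun i _ => sq_nonneg _)
    (fun j hj => by
      have h1 := gridEnergy_dualStep_le hl hτ (hav j)
        (VanishOut.dualSeq (l := τ / h ^ 2) (τ := τ) (c := c) hav hψ j) (ha j) (hc j)
        (hcL j) hs (l := τ / h ^ 2) (τ := τ)
      have h2 := hcard (F := dualSeq (τ / h ^ 2) τ a c ψ j) (sq_nonneg B) fun i => by
        rw [← sq_abs]; exact pow_le_pow_left₀ (abs_nonneg _) (hB j hj i) 2
      refine h1.trans (by
        refine add_le_add le_rfl ?_
        refine (mul_le_mul_of_nonneg_left h2 (by positivity)).trans ?_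
        have h3 : τ * (L * h) ^ 2 + 8 * τ ^ 2 * K ^ 2 ≤ τ * h ^ 2 * (L ^ 2 + 8 * K ^ 2) := by
          nlinarith [mul_le_mul_of_nonneg_left hτh (mul_nonneg hτ (sq_nonneg K))]
        refine (mul_le_mul_of_nonneg_right h3 (by positivity)).trans (le_of_eq ?_)
        rw [hy]; ring))
  have hexp : (1 + τ * (2 * K + 1)) ^ n ≤ Real.exp (T * (2 * K + 1)) := by
    rw [← hnT, mul_assoc, Real.exp_nat_mul]
    refine pow_le_pow_left₀ (by positivity) ?_ n
    linarith [Real.add_one_le_exp (τ * (2 * K + 1))]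
  have hfin : (1 + τ * (2 * K + 1)) ^ n * (gridEnergy N ψ + n * (τ * h * y))
      ≤ h * (Real.exp (T * (2 * K + 1)) * (3 * (N * h) * P ^ 2 + T * y)) := by
    have : gridEnergy N ψ + n * (τ * h * y) ≤ h * (3 * (N * h) * P ^ 2 + T * y) := by
      rw [← hnT]; nlinarith
    have hTn : 0 ≤ T := by rw [← hnT]; positivity
    refine (mul_le_mul hexp this ?_ (Real.exp_pos _).le).trans (le_of_eq (by ring))
    exact add_nonneg (Finset.sum_nonneg fun i _ => sq_nonneg _) (by positivity)
  have hall := hstep.trans hfin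
  rw [← Finset.mul_sum] at hall ⊢
  rw [show ∀ x, τ / h ^ 2 / h * x = (τ / h ^ 2 * x) / h from fun x => by ring,
    div_le_iff₀ hh]
  linarith

/-! ### Hat functions and averages -/

/-- The piecewise linear hat of height `1` and half-width `h` centred at `x₀`. -/
def hat (x₀ h x : ℝ) : ℝ := max 0 (1 - |x - x₀| / h)

lemma hat_nonneg (x₀ h x : ℝ) : 0 ≤ hat x₀ h x := le_max_left _ _

lemma continuous_hat (x₀ h : ℝ) : Continuous (hat x₀ h) := by
  unfold hat
  fun_prop

lemma hat_le_one {h : ℝ} (hh : 0 < h) (x₀ x : ℝ) : hat x₀ h x ≤ 1 :=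
  max_le zero_le_one (by have : 0 ≤ |x - x₀| / h := by positivity
                         linarith)

lemma hat_eq_zero {x₀ h x : ℝ} (hh : 0 < h) (hx : h ≤ |x - x₀|) : hat x₀ h x = 0 :=
  max_eq_left (by have := (one_le_div hh).2 hx
                  linarith)

lemma hasCompactSupport_hat {h : ℝ} (hh : 0 < h) (x₀ : ℝ) : HasCompactSupport (hat x₀ h) := by
  refine HasCompactSupport.of_support_subset_isCompact (isCompact_Icc (a := x₀ - h) (b := x₀ + h))
    fun x hx => ?_
  by_contra hx'
  refine hx (hat_eq_zero hh ?_)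
  rw [mem_Icc, not_and_or, not_le, not_le] at hx'
  rw [le_abs]
  rcases hx' with h' | h'
  · right; linarith
  · left; linarith

lemma integrable_hat {h : ℝ} (hh : 0 < h) (x₀ : ℝ) : Integrable (hat x₀ h) :=
  (continuous_hat x₀ h).integrable_of_hasCompactSupport (hasCompactSupport_hat hh x₀)

lemma integral_hat {h : ℝ} (hh : 0 < h) (x₀ : ℝ) : ∫ x, hat x₀ h x = h := by
  have h0 : ∫ x, hat x₀ h x = ∫ x in (x₀ - h)..(x₀ + h), hat x₀ h x := by
    rw [intervalIntegral.integral_of_le (by linarith)]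
    refine (setIntegral_eq_integral_of_forall_compl_eq_zero fun x hx => ?_).symm
    refine hat_eq_zero hh ?_
    rw [mem_Ioc, not_and_or, not_lt, not_le] at hx
    rw [le_abs]
    rcases hx with h' | h'
    · right; linarith
    · left; linarith
  rw [h0, ← intervalIntegral.integral_add_adjacent_intervals (b := x₀)
    ((continuous_hat x₀ h).intervalIntegrable _ _) ((continuous_hat x₀ h).intervalIntegrable _ _)]
  have h1 : ∫ x in (x₀ - h)..x₀, hat x₀ h x = ∫ x in (x₀ - h)..x₀, (1 + (x - x₀) / h) := by
    refine intervalIntegral.integral_congr fun x hx => ?_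
    rw [uIcc_of_le (by linarith)] at hx
    have : (x - x₀) / h ≥ -1 := by rw [ge_iff_le, le_div_iff₀ hh]; linarith [hx.1]
    simp only [hat]
    rw [abs_of_nonpos (by linarith [hx.2]), neg_div, sub_neg_eq_add, max_eq_right (by linarith)]
  have h2 : ∫ x in x₀..(x₀ + h), hat x₀ h x = ∫ x in x₀..(x₀ + h), (1 - (x - x₀) / h) := by
    refine intervalIntegral.integral_congr fun x hx => ?_
    rw [uIcc_of_le (by linarith)] at hx
    have : (x - x₀) / h ≤ 1 := by rw [div_le_iff₀ hh]; linarith [hx.2]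
    simp only [hat]
    rw [abs_of_nonneg (by linarith [hx.1]), max_eq_right (by linarith)]
  rw [h1, h2]
  have i1 : ∀ a b : ℝ, ∫ x in a..b, (1 + (x - x₀) / h)
      = (b - a) + ((b ^ 2 - a ^ 2) / 2 - x₀ * (b - a)) / h := by
    intro a b
    rw [intervalIntegral.integral_add (by simp) (by
      exact Continuous.intervalIntegrable (by fun_prop) _ _),
      intervalIntegral.integral_div, intervalIntegral.integral_sub (by simp) (by simp)]
    simp
    ring
  have i2 : ∀ a b : ℝ, ∫ x in a..b, (1 - (x - x₀) / h)
      = (b - a) - ((b ^ 2 - a ^ 2) / 2 - x₀ * (b - a)) / h := by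
    intro a b
    rw [intervalIntegral.integral_sub (by simp) (by
      exact Continuous.intervalIntegrable (by fun_prop) _ _),
      intervalIntegral.integral_div, intervalIntegral.integral_sub (by simp) (by simp)]
    simp
    ring
  rw [i1, i2]
  field_simp
  ring

lemma abs_integral_mul_hat_le {F : ℝ → ℝ} {M h : ℝ} (hh : 0 < h) (x₀ : ℝ)
    (hF : ∀ x, |F x| ≤ M) : |∫ x, F x * hat x₀ h x| ≤ M * h := by
  have := norm_integral_le_of_norm_le ((integrable_hat hh x₀).const_mul M)
    (f := fun x => F x * hat x₀ h x) (Eventually.of_forall fun x => by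
      rw [Real.norm_eq_abs, abs_mul, abs_of_nonneg (hat_nonneg _ _ _)]
      exact mul_le_mul_of_nonneg_right (hF x) (hat_nonneg _ _ _))
  rwa [integral_const_mul, integral_hat hh] at this

lemma integrable_mul_hat {F : ℝ → ℝ} {h M : ℝ} (hh : 0 < h) (x₀ : ℝ) (hF : Measurable F)
    (hM : ∀ x, |F x| ≤ M) : Integrable fun x => F x * hat x₀ h x :=
  (integrable_hat hh x₀).bdd_mul hF.aestronglyMeasurable (Eventually.of_forall hM)

lemma abs_integral_mul_hat_div_sub_le {F : ℝ → ℝ} {v e h M : ℝ} (hh : 0 < h) (x₀ : ℝ)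
    (hF : Measurable F) (hM : ∀ x, |F x| ≤ M)
    (he : ∀ x ∈ Icc (x₀ - h) (x₀ + h), |F x - v| ≤ e) :
    |(∫ x, F x * hat x₀ h x) / h - v| ≤ e := by
  have h1 : ∫ x, (F x - v) * hat x₀ h x = (∫ x, F x * hat x₀ h x) - v * h := by
    simp_rw [sub_mul]
    rw [integral_sub (integrable_mul_hat hh x₀ hF hM) ((integrable_hat hh x₀).const_mul v),
      integral_const_mul, integral_hat hh]
  have h2 := norm_integral_le_of_norm_le ((integrable_hat hh x₀).const_mul e)
    (f := fun x => (F x - v) * hat x₀ h x) (Eventually.of_forall fun x => by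
      rw [Real.norm_eq_abs, abs_mul, abs_of_nonneg (hat_nonneg _ _ _)]
      by_cases hx : h ≤ |x - x₀|
      · rw [hat_eq_zero hh hx]; simp
      · refine mul_le_mul_of_nonneg_right (he x ?_) (hat_nonneg _ _ _)
        have := abs_lt.1 (not_le.1 hx)
        constructor <;> linarith)
  rw [integral_const_mul, integral_hat hh, h1, Real.norm_eq_abs] at h2
  rw [div_sub' hh.ne', abs_div, abs_of_pos hh, div_le_iff₀ hh, mul_comm h v]
  exact h2

lemma abs_average_sub_le {F : ℝ → ℝ} {s τ v e : ℝ} (hτ : 0 < τ)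
    (hF : ContinuousOn F (Icc s (s + τ))) (he : ∀ t ∈ Icc s (s + τ), |F t - v| ≤ e) :
    |(∫ t in s..(s + τ), F t) / τ - v| ≤ e := by
  have h1 : ∫ t in s..(s + τ), (F t - v) = (∫ t in s..(s + τ), F t) - v * τ := by
    rw [intervalIntegral.integral_sub (hF.intervalIntegrable_of_Icc (by linarith)) (by simp)]
    simp; ring
  have h2 := intervalIntegral.norm_integral_le_of_norm_le_const (a := s) (b := s + τ) (C := e)
    (f := fun t => F t - v) fun t ht => by
      rw [uIoc_of_le (by linarith)] at ht
      exact he t ⟨ht.1.le, ht.2⟩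
  rw [h1, Real.norm_eq_abs, add_sub_cancel_left, abs_of_pos hτ] at h2
  rw [div_sub' hτ.ne', abs_div, abs_of_pos hτ, div_le_iff₀ hτ, mul_comm τ v]
  exact h2

lemma abs_average_le {F : ℝ → ℝ} {s τ M : ℝ} (hτ : 0 < τ)
    (he : ∀ t ∈ Icc s (s + τ), |F t| ≤ M) :
    |(∫ t in s..(s + τ), F t) / τ| ≤ M := by
  have h2 := intervalIntegral.norm_integral_le_of_norm_le_const (a := s) (b := s + τ) (C := M)
    (f := F) fun t ht => by
      rw [uIoc_of_le (by linarith)] at ht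
      exact he t ⟨ht.1.le, ht.2⟩
  rw [Real.norm_eq_abs, add_sub_cancel_left, abs_of_pos hτ] at h2
  rwa [abs_div, abs_of_pos hτ, div_le_iff₀ hτ]

/-! ### Elementary facts for the choice of parameters -/

lemma exists_pos_le_mul_le {c x σ : ℝ} (hc : 0 ≤ c) (hx : 0 < x) (hσ : 0 < σ) :
    ∃ y > 0, y ≤ x ∧ c * y ≤ σ := by
  refine ⟨min x (σ / (c + 1)), by positivity, min_le_left _ _, ?_⟩
  calc c * min x (σ / (c + 1)) ≤ c * (σ / (c + 1)) :=
        mul_le_mul_of_nonneg_left (min_le_right _ _) hc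
    _ ≤ (c + 1) * (σ / (c + 1)) := mul_le_mul_of_nonneg_right (by linarith) (by positivity)
    _ = σ := by field_simp

lemma sum_ite_mul_lt_le {τ δ : ℝ} (hτ : 0 ≤ τ) (hδ : 0 ≤ δ) (n : ℕ) :
    ∑ k ∈ Finset.range n, τ * (if k * τ < δ then 1 else 0) ≤ δ + τ := by
  have : ∑ k ∈ Finset.range n, τ * (if (k : ℝ) * τ < δ then (1 : ℝ) else 0) ≤ n * τ ∧
      ∑ k ∈ Finset.range n, τ * (if (k : ℝ) * τ < δ then (1 : ℝ) else 0) ≤ δ + τ := by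
    induction n with
    | zero => simp; linarith
    | succ n ih =>
      rw [Finset.sum_range_succ]
      push_cast
      split_ifs with hn
      · constructor <;> linarith [ih.1]
      · constructor <;> linarith [ih.1, ih.2]
  exact this.2

lemma sum_ite_time_lt_le {τ δ T : ℝ} (hτ : 0 ≤ τ) (hδ : 0 ≤ δ) {n : ℕ} (hn : n * τ = T) :
    ∑ j ∈ Finset.range n, τ * (if T - (j + 1) * τ < δ then 1 else 0) ≤ δ + τ := by
  rw [← Finset.sum_range_reflect]
  refine le_trans (le_of_eq (Finset.sum_congr rfl fun j hj => ?_)) (sum_ite_mul_lt_le hτ hδ n)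
  have hj := Finset.mem_range.1 hj
  have : ((n - 1 - j : ℕ) : ℝ) = n - 1 - j := by
    rw [Nat.cast_sub (by omega), Nat.cast_sub (by omega)]; simp
  rw [this, ← hn, show (n : ℝ) * τ - (n - 1 - j + 1) * τ = j * τ by ring]

/-- If `e ≤ α` in general and `e ≤ β` at times at least `δ`, the sum of `τ * e` is controlled. -/
lemma sum_time_le {τ δ T α β : ℝ} (hτ : 0 ≤ τ) (hδ : 0 ≤ δ) (hα : 0 ≤ α) (hβ : 0 ≤ β) {n : ℕ}
    (hn : n * τ = T) :
    ∑ j ∈ Finset.range n, τ * (if T - (j + 1) * τ < δ then α else β)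
      ≤ T * β + (δ + τ) * α := by
  calc ∑ j ∈ Finset.range n, τ * (if T - (j + 1) * τ < δ then α else β)
      ≤ ∑ j ∈ Finset.range n, (τ * β + (τ * (if T - (j + 1) * τ < δ then 1 else 0)) * α) := by
        refine Finset.sum_le_sum fun j _ => ?_
        split_ifs
        · nlinarith [mul_nonneg hτ hβ]
        · simp
    _ = T * β + (∑ j ∈ Finset.range n, τ * (if T - (j + 1) * τ < δ then 1 else 0)) * α := by
        rw [Finset.sum_add_distrib, Finset.sum_const, Finset.card_range, nsmul_eq_mul,
          ← Finset.sum_mul, ← hn]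
        ring
    _ ≤ _ := by
        have := mul_le_mul_of_nonneg_right (sum_ite_time_lt_le hτ hδ hn) hα
        linarith

/-! ### Lipschitz regularisation of a coefficient -/

/-- Infimal convolution with `L * |·|`. -/
def infConv (L : ℝ) (g : ℝ → ℝ) (x : ℝ) : ℝ := ⨅ y, (g y + L * |x - y|)

lemma infConv_bddBelow {L K : ℝ} {g : ℝ → ℝ} (hL : 0 ≤ L) (hg : ∀ x, |g x| ≤ K) (x : ℝ) :
    BddBelow (range fun y => g y + L * |x - y|) :=
  ⟨-K, by rintro _ ⟨y, rfl⟩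
          have : 0 ≤ L * |x - y| := by positivity
          dsimp only
          linarith [(abs_le.1 (hg y)).1]⟩

lemma infConv_le {L K : ℝ} {g : ℝ → ℝ} (hL : 0 ≤ L) (hg : ∀ x, |g x| ≤ K) (x : ℝ) :
    infConv L g x ≤ g x :=
  (ciInf_le (infConv_bddBelow hL hg x) x).trans (by simp)

lemma abs_infConv_le {L K : ℝ} {g : ℝ → ℝ} (hL : 0 ≤ L) (hg : ∀ x, |g x| ≤ K) (x : ℝ) :
    |infConv L g x| ≤ K := by
  refine abs_le.2 ⟨le_ciInf fun y => ?_, (infConv_le hL hg x).trans (abs_le.1 (hg x)).2⟩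
  have : 0 ≤ L * |x - y| := by positivity
  linarith [(abs_le.1 (hg y)).1]

lemma infConv_le_add {L K : ℝ} {g : ℝ → ℝ} (hL : 0 ≤ L) (hg : ∀ x, |g x| ≤ K) (x y : ℝ) :
    infConv L g x ≤ infConv L g y + L * |x - y| := by
  rw [← sub_le_iff_le_add]
  refine le_ciInf fun z => ?_
  have h1 := ciInf_le (infConv_bddBelow hL hg x) z
  have h2 := mul_le_mul_of_nonneg_left (abs_sub_le x y z) hL
  change infConv L g x ≤ _ at h1
  linarith

lemma abs_infConv_sub_le {L K : ℝ} {g : ℝ → ℝ} (hL : 0 ≤ L) (hg : ∀ x, |g x| ≤ K) (x y : ℝ) :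
    |infConv L g x - infConv L g y| ≤ L * |x - y| := by
  have h1 := infConv_le_add hL hg x y
  have h2 := infConv_le_add hL hg y x
  rw [abs_sub_comm y x] at h2
  exact abs_le.2 ⟨by linarith, by linarith⟩

/-- A coefficient `c` with `H ≈ c * w`, bounded by `K` and Lipschitz in space. -/
lemma exists_lipschitz_coeff {w H : ℝ → ℝ → ℝ} {R δ T K M η : ℝ} (hR : 0 ≤ R) (hK : 0 ≤ K)
    (hM : 0 < M) (hη : 0 < η)
    (hw : ContinuousOn (fun q : ℝ × ℝ => w q.1 q.2) (Icc (-R) R ×ˢ Icc δ T))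
    (hH : ContinuousOn (fun q : ℝ × ℝ => H q.1 q.2) (Icc (-R) R ×ˢ Icc δ T))
    (hwM : ∀ x, ∀ t ∈ Icc δ T, |w x t| ≤ M)
    (hHK : ∀ x, ∀ t ∈ Icc δ T, |H x t| ≤ K * |w x t|) :
    ∃ L ≥ 0, ∃ c : ℝ → ℝ → ℝ, (∀ x t, |c x t| ≤ K) ∧
      (∀ x y t, |c x t - c y t| ≤ L * |x - y|) ∧
      ∀ x ∈ Icc (-R) R, ∀ t ∈ Icc δ T, |H x t - c x t * w x t| ≤ η := by
  obtain ⟨s, hs, -, hsη⟩ := exists_pos_le_mul_le hK one_pos (half_pos hη)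
  set g : ℝ → ℝ → ℝ := fun x t => H x t * w x t / (w x t ^ 2 + s ^ 2) with hg
  have hgK : ∀ x, ∀ t ∈ Icc δ T, |g x t| ≤ K := by
    intro x t ht
    have hpos : 0 < w x t ^ 2 + s ^ 2 := by positivity
    rw [hg, abs_div, abs_mul, abs_of_pos hpos, div_le_iff₀ hpos]
    calc |H x t| * |w x t| ≤ K * |w x t| * |w x t| :=
          mul_le_mul_of_nonneg_right (hHK x t ht) (abs_nonneg _)
      _ = K * w x t ^ 2 := by rw [mul_assoc, ← sq, sq_abs]
      _ ≤ _ := mul_le_mul_of_nonneg_left (by nlinarith) hK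
  have hgw : ∀ x, ∀ t ∈ Icc δ T, |H x t - g x t * w x t| ≤ η / 2 := by
    intro x t ht
    have hpos : 0 < w x t ^ 2 + s ^ 2 := by positivity
    have e : H x t - g x t * w x t = H x t * s ^ 2 / (w x t ^ 2 + s ^ 2) := by
      rw [hg]; field_simp; ring
    rw [e, abs_div, abs_mul, abs_of_pos hpos, abs_of_pos (by positivity : 0 < s ^ 2),
      div_le_iff₀ hpos]
    have h1 : |w x t| * s ≤ w x t ^ 2 + s ^ 2 := by
      rw [← sq_abs (w x t)]; nlinarith [sq_nonneg (|w x t| - s), sq_nonneg (|w x t| + s)]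
    calc |H x t| * s ^ 2 ≤ K * |w x t| * s ^ 2 :=
          mul_le_mul_of_nonneg_right (hHK x t ht) (by positivity)
      _ = K * s * (|w x t| * s) := by ring
      _ ≤ η / 2 * (w x t ^ 2 + s ^ 2) :=
          mul_le_mul hsη h1 (by positivity) (by linarith)
  have hgc : ContinuousOn (fun q : ℝ × ℝ => g q.1 q.2) (Icc (-R) R ×ˢ Icc δ T) :=
    (hH.mul hw).div ((hw.pow 2).add continuousOn_const) fun q _ => by positivity
  have huc := (isCompact_Icc.prod isCompact_Icc).uniformContinuousOn_of_continuous hgc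
  obtain ⟨d, hd, hdg⟩ := Metric.uniformContinuousOn_iff_le.1 huc (η / (2 * M)) (by positivity)
  have hRR : -R ≤ R := by linarith
  set G : ℝ → ℝ → ℝ := fun t x => g (projIcc (-R) R hRR x) t with hG
  have hGK : ∀ t ∈ Icc δ T, ∀ x, |G t x| ≤ K := fun t ht x => hgK _ t ht
  have hL : 0 ≤ 2 * K / d := by positivity
  refine ⟨2 * K / d, hL, fun x t => if t ∈ Icc δ T then infConv (2 * K / d) (G t) x else 0,
    fun x t => ?_, fun x y t => ?_, fun x hx t ht => ?_⟩
  · dsimp only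
    split_ifs with ht
    · exact abs_infConv_le hL (hGK t ht) x
    · simpa using hK
  · dsimp only
    split_ifs with ht
    · exact abs_infConv_sub_le hL (hGK t ht) x y
    · simp; positivity
  · simp only [if_pos ht]
    have hGx : G t x = g x t := by simp only [hG]; rw [projIcc_of_mem hRR hx]
    have h1 := infConv_le hL (hGK t ht) x
    have h2 : g x t - η / (2 * M) ≤ infConv (2 * K / d) (G t) x := by
      refine le_ciInf fun y => ?_
      by_cases hy : |x - y| ≤ d
      · have h3 := hdg (x, t) ⟨hx, ht⟩ (projIcc (-R) R hRR y, t) ⟨Subtype.prop _, ht⟩ (by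
          rw [Prod.dist_eq]
          simp only [dist_self]
          refine max_le ?_ hd.le
          have := abs_projIcc_sub_projIcc (c := x) (d := y) hRR
          rw [projIcc_of_mem hRR hx] at this
          exact this.trans hy)
        rw [Real.dist_eq] at h3
        have h4 := (abs_le.1 h3).2
        have : 0 ≤ 2 * K / d * |x - y| := by positivity
        simp only [hG] at h4 ⊢
        linarith
      · have h3 := (abs_le.1 (hGK t ht y)).1
        have h4 := (abs_le.1 (hgK x t ht)).2
        have h5 : 2 * K / d * d ≤ 2 * K / d * |x - y| :=
          mul_le_mul_of_nonneg_left (not_le.1 hy).le hL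
        rw [div_mul_cancel₀ _ hd.ne'] at h5
        have : 0 < η / (2 * M) := by positivity
        linarith
    rw [hGx] at h1
    set C := infConv (2 * K / d) (G t) x
    have h6 : |(g x t - C) * w x t| ≤ η / 2 := by
      rw [abs_mul]
      calc |g x t - C| * |w x t| ≤ η / (2 * M) * M :=
            mul_le_mul (abs_le.2 ⟨by have : 0 < η / (2 * M) := by positivity
                                     linarith, by linarith⟩) (hwM x t ht) (abs_nonneg _)
              (by positivity)
        _ = η / 2 := by field_simp
    calc |H x t - C * w x t| = |(H x t - g x t * w x t) + (g x t - C) * w x t| := by ring_nf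
      _ ≤ η / 2 + η / 2 := (abs_add_le _ _).trans (add_le_add (hgw x t ht) h6)
      _ = η := by ring

/-! ### Difference systems and approximate duality -/

/-- A bounded weak solution `w` of the linear degenerate equation `w_t = z_xx + H`, where `z` is a
nonnegative bounded multiple of `w` and `H` a bounded multiple of `w`, tested against hats. -/
structure DiffSys (T A K M : ℝ) (w z H : ℝ → ℝ → ℝ) : Prop where
  cont_w : ContinuousOn (fun q : ℝ × ℝ => w q.1 q.2) (univ ×ˢ Ioc 0 T)
  cont_z : ContinuousOn (fun q : ℝ × ℝ => z q.1 q.2) (univ ×ˢ Ioc 0 T)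
  cont_H : ContinuousOn (fun q : ℝ × ℝ => H q.1 q.2) (univ ×ˢ Ioc 0 T)
  meas_zero : Measurable fun x => w x 0
  abs_w_le : ∀ x, ∀ t ∈ Icc 0 T, |w x t| ≤ M
  abs_z_le : ∀ x, ∀ t ∈ Icc 0 T, |z x t| ≤ M
  abs_H_le : ∀ x, ∀ t ∈ Icc 0 T, |H x t| ≤ M
  z_le : ∀ x, ∀ t ∈ Icc 0 T, |z x t| ≤ A * |w x t|
  z_mul_nonneg : ∀ x, ∀ t ∈ Icc 0 T, 0 ≤ z x t * w x t
  H_le : ∀ x, ∀ t ∈ Icc 0 T, |H x t| ≤ K * |w x t|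
  balance : ∀ s t, 0 ≤ s → s ≤ t → t ≤ T → ∀ x₀ h, 0 < h →
    ∫ x, w x t * hat x₀ h x = (∫ x, w x s * hat x₀ h x)
      + (∫ r in s..t, ∫ x, H x r * hat x₀ h x)
      + ((∫ r in s..t, z (x₀ + h) r) - 2 * (∫ r in s..t, z x₀ r)
        + ∫ r in s..t, z (x₀ - h) r) / h

lemma continuous_slice {F : ℝ → ℝ → ℝ} {I : Set ℝ}
    (hF : ContinuousOn (fun q : ℝ × ℝ => F q.1 q.2) (univ ×ˢ I)) {t : ℝ} (ht : t ∈ I) :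
    Continuous fun x => F x t :=
  hF.comp_continuous (f := fun x : ℝ => (x, t)) (by fun_prop) fun _ => ⟨mem_univ _, ht⟩

lemma continuousOn_slice {F : ℝ → ℝ → ℝ} {I : Set ℝ}
    (hF : ContinuousOn (fun q : ℝ × ℝ => F q.1 q.2) (univ ×ˢ I)) (x : ℝ) :
    ContinuousOn (fun t => F x t) I :=
  hF.comp (f := fun t : ℝ => (x, t)) (by fun_prop) fun _ ht => ⟨mem_univ _, ht⟩

lemma continuousOn_integral_mul {F : ℝ → ℝ → ℝ} {I : Set ℝ} {M : ℝ} {φ : ℝ → ℝ}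
    (hF : ContinuousOn (fun q : ℝ × ℝ => F q.1 q.2) (univ ×ˢ I))
    (hM : ∀ x, ∀ t ∈ I, |F x t| ≤ M) (hφ : Integrable φ) :
    ContinuousOn (fun t => ∫ x, F x t * φ x) I := by
  refine continuousOn_of_dominated (bound := fun x => M * |φ x|)
    (fun t ht => (continuous_slice hF ht).aestronglyMeasurable.mul hφ.aestronglyMeasurable)
    (fun t ht => Eventually.of_forall fun x => ?_) (hφ.abs.const_mul M)
    (Eventually.of_forall fun x => (continuousOn_slice hF x).mul continuousOn_const)
  rw [Real.norm_eq_abs, abs_mul]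
  exact mul_le_mul_of_nonneg_right (hM x t ht) (abs_nonneg _)

lemma exists_modulus {F : ℝ → ℝ → ℝ} {T δ R ϖ : ℝ} (hδ : 0 < δ) (hϖ : 0 < ϖ)
    (hF : ContinuousOn (fun q : ℝ × ℝ => F q.1 q.2) (univ ×ˢ Ioc 0 T)) :
    ∃ d > 0, ∀ x ∈ Icc (-R) R, ∀ y ∈ Icc (-R) R, ∀ s ∈ Icc δ T, ∀ t ∈ Icc δ T,
      |x - y| ≤ d → |s - t| ≤ d → |F x s - F y t| ≤ ϖ := by
  have hc : ContinuousOn (fun q : ℝ × ℝ => F q.1 q.2) (Icc (-R) R ×ˢ Icc δ T) :=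
    hF.mono (prod_mono (subset_univ _) fun t ht => ⟨hδ.trans_le ht.1, ht.2⟩)
  have huc := (isCompact_Icc.prod isCompact_Icc).uniformContinuousOn_of_continuous hc
  obtain ⟨d, hd, h⟩ := Metric.uniformContinuousOn_iff_le.1 huc ϖ hϖ
  refine ⟨d, hd, fun x hx y hy s hs t ht hxy hst => ?_⟩
  have := h (x, s) ⟨hx, hs⟩ (y, t) ⟨hy, ht⟩ (by
    rw [Prod.dist_eq, Real.dist_eq, Real.dist_eq]; exact max_le hxy hst)
  rwa [Real.dist_eq] at this

namespace DiffSys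

variable {T A K M : ℝ} {w z H : ℝ → ℝ → ℝ}

/-- The ratio `z / w`, set to zero outside the time interval. -/
def ratio (T : ℝ) (w z : ℝ → ℝ → ℝ) (x t : ℝ) : ℝ := if t ∈ Icc 0 T then z x t / w x t else 0

lemma ratio_mem (S : DiffSys T A K M w z H) (hA : 0 ≤ A) (x t : ℝ) :
    0 ≤ ratio T w z x t ∧ ratio T w z x t ≤ A := by
  rw [ratio]
  split_ifs with ht
  · rcases eq_or_ne (w x t) 0 with h0 | h0
    · simp [h0, hA]
    · have h1 : z x t / w x t = z x t * w x t / w x t ^ 2 := by field_simp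
      constructor
      · rw [h1]
        have := S.z_mul_nonneg x t ht
        positivity
      · refine (le_abs_self _).trans ?_
        rw [abs_div, div_le_iff₀ (abs_pos.2 h0)]
        exact S.z_le x t ht
  · exact ⟨le_rfl, hA⟩

lemma ratio_mul (S : DiffSys T A K M w z H) {x t : ℝ} (ht : t ∈ Icc 0 T) :
    ratio T w z x t * w x t = z x t := by
  rw [ratio, if_pos ht]
  rcases eq_or_ne (w x t) 0 with h0 | h0
  · have := S.z_le x t ht
    rw [h0, abs_zero, mul_zero] at this
    rw [abs_eq_zero.1 (le_antisymm this (abs_nonneg _))]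
    simp
  · field_simp

lemma measurable_slice (S : DiffSys T A K M w z H) {t : ℝ} (ht : t ∈ Icc 0 T) :
    Measurable fun x => w x t := by
  rcases ht.1.eq_or_lt with h | h
  · rw [← h]; exact S.meas_zero
  · exact (continuous_slice S.cont_w ⟨h, ht.2⟩).measurable

lemma slab_z_le (S : DiffSys T A K M w z H) {R δ d ϖ ε h τ s x₀ a : ℝ}
    (hA : 0 ≤ A) (hε : 0 ≤ ε) (hδ : 0 < δ) (hh : 0 < h) (hτ : 0 < τ) (hhd : h ≤ d) (hτd : τ ≤ d)
    (hh1 : h ≤ 1) (hx₀ : x₀ ∈ Icc (-R) R) (hs : δ ≤ s) (hsT : s + τ ≤ T)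
    (hmw : ∀ x ∈ Icc (-(R + 1)) (R + 1), ∀ y ∈ Icc (-(R + 1)) (R + 1), ∀ s ∈ Icc δ T,
      ∀ t ∈ Icc δ T, |x - y| ≤ d → |s - t| ≤ d → |w x s - w y t| ≤ ϖ)
    (hmz : ∀ x ∈ Icc (-(R + 1)) (R + 1), ∀ y ∈ Icc (-(R + 1)) (R + 1), ∀ s ∈ Icc δ T,
      ∀ t ∈ Icc δ T, |x - y| ≤ d → |s - t| ≤ d → |z x s - z y t| ≤ ϖ)
    (ha : a = ratio T w z x₀ s + ε) :
    |(∫ t in s..(s + τ), z x₀ t) / τ - a * ((∫ x, w x s * hat x₀ h x) / h)|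
      ≤ (1 + A) * ϖ + ε * M := by
  have hx1 : x₀ ∈ Icc (-(R + 1)) (R + 1) := ⟨by linarith [hx₀.1], by linarith [hx₀.2]⟩
  have hs0 : s ∈ Icc 0 T := ⟨by linarith, by linarith⟩
  have hsδ : s ∈ Icc δ T := ⟨hs, by linarith⟩
  have e1 := abs_average_sub_le (F := fun t => z x₀ t) (s := s) (v := z x₀ s) (e := ϖ) hτ
    ((continuousOn_slice S.cont_z x₀).mono fun t ht => ⟨by linarith [ht.1], by linarith [ht.2]⟩)
    fun t ht => hmz x₀ hx1 x₀ hx1 t ⟨by linarith [ht.1], by linarith [ht.2]⟩ s hsδ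
      (by simp; linarith) (by rw [abs_of_nonneg (by linarith [ht.1])]; linarith [ht.2])
  have e2 := abs_integral_mul_hat_div_sub_le (F := fun x => w x s) (v := w x₀ s) (e := ϖ) hh x₀
    (S.measurable_slice hs0) (fun x => S.abs_w_le x s hs0) fun x hx =>
      hmw x ⟨by linarith [hx.1, hx₀.1], by linarith [hx.2, hx₀.2]⟩ x₀ hx1 s hsδ s hsδ
        (abs_le.2 ⟨by linarith [hx.1], by linarith [hx.2]⟩) (by simp; linarith)
  have e3 : |(∫ x, w x s * hat x₀ h x) / h| ≤ M := by
    rw [abs_div, abs_of_pos hh, div_le_iff₀ hh]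
    exact abs_integral_mul_hat_le hh x₀ fun x => S.abs_w_le x s hs0
  set Z := (∫ t in s..(s + τ), z x₀ t) / τ
  set W := (∫ x, w x s * hat x₀ h x) / h
  have hr := S.ratio_mem hA x₀ s
  have e4 : Z - a * W = (Z - z x₀ s) - ratio T w z x₀ s * (W - w x₀ s) - ε * W := by
    rw [ha, ← S.ratio_mul hs0]; ring
  have e5 : |ratio T w z x₀ s * (W - w x₀ s)| ≤ A * ϖ := by
    rw [abs_mul, abs_of_nonneg hr.1]
    exact mul_le_mul hr.2 e2 (abs_nonneg _) hA
  have e6 : |ε * W| ≤ ε * M := by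
    rw [abs_mul, abs_of_nonneg hε]; exact mul_le_mul_of_nonneg_left e3 hε
  rw [e4]
  refine (abs_sub _ _).trans ?_
  have := abs_sub (Z - z x₀ s) (ratio T w z x₀ s * (W - w x₀ s))
  linarith

lemma slab_H_le (S : DiffSys T A K M w z H) {R δ d ϖ η h τ s x₀ c : ℝ}
    (hδ : 0 < δ) (hh : 0 < h) (hτ : 0 < τ) (hhd : h ≤ d) (hτd : τ ≤ d)
    (hh1 : h ≤ 1) (hx₀ : x₀ ∈ Icc (-R) R) (hs : δ ≤ s) (hsT : s + τ ≤ T)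
    (hmw : ∀ x ∈ Icc (-(R + 1)) (R + 1), ∀ y ∈ Icc (-(R + 1)) (R + 1), ∀ s ∈ Icc δ T,
      ∀ t ∈ Icc δ T, |x - y| ≤ d → |s - t| ≤ d → |w x s - w y t| ≤ ϖ)
    (hmH : ∀ x ∈ Icc (-(R + 1)) (R + 1), ∀ y ∈ Icc (-(R + 1)) (R + 1), ∀ s ∈ Icc δ T,
      ∀ t ∈ Icc δ T, |x - y| ≤ d → |s - t| ≤ d → |H x s - H y t| ≤ ϖ)
    (hc : |c| ≤ K) (hcw : |H x₀ s - c * w x₀ s| ≤ η) :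
    |(∫ t in s..(s + τ), (∫ x, H x t * hat x₀ h x) / h) / τ
      - c * ((∫ x, w x s * hat x₀ h x) / h)| ≤ (1 + K) * ϖ + η := by
  have hx1 : x₀ ∈ Icc (-(R + 1)) (R + 1) := ⟨by linarith [hx₀.1], by linarith [hx₀.2]⟩
  have hs0 : s ∈ Icc 0 T := ⟨by linarith, by linarith⟩
  have hsδ : s ∈ Icc δ T := ⟨hs, by linarith⟩
  have hsub : Icc s (s + τ) ⊆ Ioc 0 T := fun t ht => ⟨by linarith [ht.1], by linarith [ht.2]⟩
  have e1 := abs_average_sub_le (F := fun t => (∫ x, H x t * hat x₀ h x) / h) (s := s)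
    (v := H x₀ s) (e := ϖ) hτ
    (((continuousOn_integral_mul S.cont_H (fun x t ht => S.abs_H_le x t ⟨ht.1.le, ht.2⟩)
      (integrable_hat hh x₀)).mono hsub).div_const h)
    fun t ht => abs_integral_mul_hat_div_sub_le hh x₀
      (continuous_slice S.cont_H (hsub ht)).measurable
      (fun x => S.abs_H_le x t ⟨(hsub ht).1.le, (hsub ht).2⟩) fun x hx =>
      hmH x ⟨by linarith [hx.1, hx₀.1], by linarith [hx.2, hx₀.2]⟩ x₀ hx1 t
        ⟨by linarith [ht.1], by linarith [ht.2]⟩ s hsδ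
        (abs_le.2 ⟨by linarith [hx.1], by linarith [hx.2]⟩)
        (by rw [abs_of_nonneg (by linarith [ht.1])]; linarith [ht.2])
  have e2 := abs_integral_mul_hat_div_sub_le (F := fun x => w x s) (v := w x₀ s) (e := ϖ) hh x₀
    (S.measurable_slice hs0) (fun x => S.abs_w_le x s hs0) fun x hx =>
      hmw x ⟨by linarith [hx.1, hx₀.1], by linarith [hx.2, hx₀.2]⟩ x₀ hx1 s hsδ s hsδ
        (abs_le.2 ⟨by linarith [hx.1], by linarith [hx.2]⟩) (by simp; linarith)
  set Z := (∫ t in s..(s + τ), (∫ x, H x t * hat x₀ h x) / h) / τ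
  set W := (∫ x, w x s * hat x₀ h x) / h
  have e4 : Z - c * W = (Z - H x₀ s) + (H x₀ s - c * w x₀ s) - c * (W - w x₀ s) := by ring
  have e5 : |c * (W - w x₀ s)| ≤ K * ϖ := by
    rw [abs_mul]
    exact mul_le_mul hc e2 (abs_nonneg _) ((abs_nonneg _).trans hc)
  rw [e4]
  refine (abs_sub _ _).trans ?_
  have := abs_add_le (Z - H x₀ s) (H x₀ s - c * w x₀ s)
  linarith

lemma slab_crude (S : DiffSys T A K M w z H) {h τ s x₀ a c : ℝ}
    (hh : 0 < h) (hτ : 0 < τ) (hs : 0 ≤ s) (hsT : s + τ ≤ T) :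
    |(∫ t in s..(s + τ), z x₀ t) / τ| ≤ M ∧
    |(∫ t in s..(s + τ), z x₀ t) / τ - a * ((∫ x, w x s * hat x₀ h x) / h)| ≤ (1 + |a|) * M ∧
    |(∫ t in s..(s + τ), (∫ x, H x t * hat x₀ h x) / h) / τ
      - c * ((∫ x, w x s * hat x₀ h x) / h)| ≤ (1 + |c|) * M := by
  have hs0 : s ∈ Icc 0 T := ⟨by linarith, by linarith⟩
  have hsub : ∀ t ∈ Icc s (s + τ), t ∈ Icc 0 T := fun t ht =>
    ⟨by linarith [ht.1], by linarith [ht.2]⟩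
  have e3 : |(∫ x, w x s * hat x₀ h x) / h| ≤ M := by
    rw [abs_div, abs_of_pos hh, div_le_iff₀ hh]
    exact abs_integral_mul_hat_le hh x₀ fun x => S.abs_w_le x s hs0
  have e1 : |(∫ t in s..(s + τ), z x₀ t) / τ| ≤ M :=
    abs_average_le hτ fun t ht => S.abs_z_le x₀ t (hsub t ht)
  have e2 : |(∫ t in s..(s + τ), (∫ x, H x t * hat x₀ h x) / h) / τ| ≤ M :=
    abs_average_le hτ fun t ht => by
      rw [abs_div, abs_of_pos hh, div_le_iff₀ hh]
      exact abs_integral_mul_hat_le hh x₀ fun x => S.abs_H_le x t (hsub t ht)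
  have e4 : ∀ b : ℝ, |b * ((∫ x, w x s * hat x₀ h x) / h)| ≤ |b| * M := fun b => by
    rw [abs_mul]; exact mul_le_mul_of_nonneg_left e3 (abs_nonneg _)
  refine ⟨e1, (abs_sub _ _).trans ?_, (abs_sub _ _).trans ?_⟩
  · linarith [e4 a]
  · linarith [e4 c]

end DiffSys

lemma exists_nat_div_le {T x : ℝ} (hT : 0 < T) (hx : 0 < x) :
    ∃ n : ℕ, 1 ≤ n ∧ 0 < T / n ∧ T / n ≤ x ∧ n * (T / n) = T := by
  obtain ⟨n, hn⟩ := exists_nat_ge (T / x)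
  have hn0 : (0 : ℝ) < n := (div_pos hT hx).trans_le hn
  refine ⟨n, by exact_mod_cast hn0, by positivity, ?_, by field_simp⟩
  rw [div_le_iff₀ hn0]
  rwa [div_le_iff₀ hx, mul_comm] at hn

set_option maxHeartbeats 2000000 in
/-- Approximate duality: for every tolerance there is a fine grid and a dual scheme transporting
grid functions `ψ` from time `T` to time `0`. -/
lemma DiffSys.exists_dual_scheme {T A K M : ℝ} {w z H : ℝ → ℝ → ℝ} (S : DiffSys T A K M w z H)
    (hT : 0 < T) (hA : 0 ≤ A) (hK : 0 ≤ K) (hM : 0 < M) {R P σ h₀ : ℝ} (hR : 0 < R)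
    (hσ : 0 < σ) (hh₀ : 0 < h₀) :
    ∃ (N n : ℕ) (h τ : ℝ) (a c : ℕ → ℤ → ℝ), 0 < h ∧ h ≤ h₀ ∧ 1 ≤ N ∧ N * h = R ∧ 0 ≤ τ ∧
      n * τ = T ∧ (∀ j, VanishOut N (a j)) ∧ (∀ j i, 0 ≤ a j i ∧ a j i ≤ A + 1) ∧
      (∀ j i, |c j i| ≤ K) ∧ 3 * (τ / h ^ 2) * (A + 1) + τ * K ≤ 1 ∧
      ∀ ψ : ℤ → ℝ, VanishOut N ψ → (∀ i : ℤ, |i| ≤ N → |ψ i| ≤ 2 / N * (N - |(i : ℝ)|)) →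
        (∀ i, |ψ (i + 1) - ψ i| ≤ P * h) →
        |(∑ i ∈ Finset.Icc (-(N : ℤ)) N, ψ i * ∫ x, w x T * hat (i * h) h x)
          - ∑ i ∈ Finset.Icc (-(N : ℤ)) N,
              dualSeq (τ / h ^ 2) τ a c ψ n i * ∫ x, w x 0 * hat (i * h) h x|
          ≤ σ + T * (4 * Real.exp (K * T) * M / R) := by
  set C := 2 * Real.exp (K * T) with hC
  have hC0 : 0 < C := by positivity
  obtain ⟨η, hη, -, hησ⟩ := exists_pos_le_mul_le (c := 3 * R * C * T) (by positivity) one_pos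
    (by positivity : 0 < σ / 6)
  obtain ⟨δ₁, hδ₁, -, hδ₁σ⟩ := exists_pos_le_mul_le (c := 3 * R * C * (2 * ((1 + K) * M)))
    (by positivity) one_pos (by positivity : 0 < σ / 6)
  have hsub₁ : Icc (-R) R ×ˢ Icc δ₁ T ⊆ univ ×ˢ Ioc 0 T :=
    prod_mono (subset_univ _) fun t ht => ⟨hδ₁.trans_le ht.1, ht.2⟩
  obtain ⟨L, hL, cc, hccK, hccL, hccw⟩ := exists_lipschitz_coeff hR.le hK hM hη
    (S.cont_w.mono hsub₁) (S.cont_H.mono hsub₁)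
    (fun x t ht => S.abs_w_le x t ⟨by linarith [ht.1], ht.2⟩)
    (fun x t ht => S.H_le x t ⟨by linarith [ht.1], ht.2⟩)
  set E := Real.exp (T * (2 * K + 1)) * (3 * R * P ^ 2
        + T * ((L ^ 2 + 8 * K ^ 2) * (3 * R * C ^ 2))) with hE
  have hE0 : 0 ≤ E := by positivity
  obtain ⟨μ, hμ, -, hμσ⟩ := exists_pos_le_mul_le (c := E / 2) (by positivity) one_pos
    (by positivity : 0 < σ / 6)
  obtain ⟨ε, hε, hε1, hεσ⟩ := exists_pos_le_mul_le (c := 3 * R * T * (4 * M ^ 2) / (2 * μ))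
    (by positivity) one_pos (by positivity : 0 < σ / 6)
  obtain ⟨δ, hδ, hδδ₁, hδσ⟩ := exists_pos_le_mul_le
    (c := 3 * R * (2 * ((2 + A) * M) ^ 2) / (2 * μ * ε)) (by positivity) hδ₁
    (by positivity : 0 < σ / 6)
  obtain ⟨ϖ', hϖ', -, hϖ'σ⟩ := exists_pos_le_mul_le (c := 3 * R * C * T * (1 + K))
    (by positivity) one_pos (by positivity : 0 < σ / 6)
  obtain ⟨ϖ, hϖ, hϖle, hϖε⟩ := exists_pos_le_mul_le (c := 1 + A)
    (by positivity) hϖ' (by positivity : 0 < ε * M)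
  have hϖσ : 3 * R * C * T * (1 + K) * ϖ ≤ σ / 6 :=
    (mul_le_mul_of_nonneg_left hϖle (by positivity)).trans hϖ'σ
  obtain ⟨dw, hdw, hmw⟩ := exists_modulus (R := R + 1) hδ hϖ S.cont_w
  obtain ⟨dz, hdz, hmz⟩ := exists_modulus (R := R + 1) hδ hϖ S.cont_z
  obtain ⟨dH, hdH, hmH⟩ := exists_modulus (R := R + 1) hδ hϖ S.cont_H
  set d := min dw (min dz dH) with hd
  have hd0 : 0 < d := by positivity
  have d1 : d ≤ dw := min_le_left _ _
  have d2 : d ≤ dz := (min_le_right _ _).trans (min_le_left _ _)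
  have d3 : d ≤ dH := (min_le_right _ _).trans (min_le_right _ _)
  obtain ⟨N, hN, hh, hhle, hNh⟩ := exists_nat_div_le hR
    (by positivity : 0 < min h₀ (min 1 d))
  set h := R / N with hhdef
  have hhh₀ : h ≤ h₀ := hhle.trans (min_le_left _ _)
  have hh1 : h ≤ 1 := hhle.trans ((min_le_right _ _).trans (min_le_left _ _))
  have hhd : h ≤ d := hhle.trans ((min_le_right _ _).trans (min_le_right _ _))
  obtain ⟨n, hn, hτ, hτle, hnτ⟩ := exists_nat_div_le hT
    (by positivity : 0 < min d (min δ (min (h ^ 2 / (8 * (A + 1))) (1 / (2 * (K + 1))))))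
  set τ := T / n with hτdef
  have hτd : τ ≤ d := hτle.trans (min_le_left _ _)
  have hτδ : τ ≤ δ := hτle.trans ((min_le_right _ _).trans (min_le_left _ _))
  have hτh : τ ≤ h ^ 2 / (8 * (A + 1)) :=
    hτle.trans ((min_le_right _ _).trans ((min_le_right _ _).trans (min_le_left _ _)))
  have hτK : τ ≤ 1 / (2 * (K + 1)) :=
    hτle.trans ((min_le_right _ _).trans ((min_le_right _ _).trans (min_le_right _ _)))
  have hN0 : (0 : ℝ) < N := by exact_mod_cast hN
  have hN1 : (1 : ℝ) ≤ N := by exact_mod_cast hN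
  have hs8 : 8 * (τ / h ^ 2) * (A + 1) ≤ 1 := by
    rw [le_div_iff₀ (by positivity)] at hτh
    rw [show 8 * (τ / h ^ 2) * (A + 1) = τ * (8 * (A + 1)) / h ^ 2 by ring,
      div_le_one (by positivity)]
    exact hτh
  have hs3 : 3 * (τ / h ^ 2) * (A + 1) + τ * K ≤ 1 := by
    rw [le_div_iff₀ (by positivity)] at hτK
    have : 0 ≤ τ / h ^ 2 * (A + 1) := by positivity
    linarith
  have hτh2 : τ ≤ h ^ 2 := by
    refine hτh.trans (div_le_self (by positivity) (by linarith))
  -- coefficients of the scheme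
  set s : ℕ → ℝ := fun j => T - (j + 1) * τ with hs
  set a : ℕ → ℤ → ℝ := fun j i =>
    if |i| < (N : ℤ) then DiffSys.ratio T w z (i * h) (s j) + ε else 0 with ha
  set c : ℕ → ℤ → ℝ := fun j i => cc (i * h) (s j) with hc
  have hav : ∀ j, VanishOut N (a j) := fun j i hi => by
    simp only [ha]; rw [if_neg (not_lt.2 hi)]
  have ha01 : ∀ j i, 0 ≤ a j i ∧ a j i ≤ A + 1 := by
    intro j i
    simp only [ha]
    have := S.ratio_mem hA (i * h) (s j)
    split_ifs
    · constructor <;> linarith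
    · constructor <;> linarith
  have hcK : ∀ j i, |c j i| ≤ K := fun j i => hccK _ _
  refine ⟨N, n, h, τ, a, c, hh, hhh₀, hN, hNh, hτ.le, hnτ, hav, ha01, hcK, hs3,
    fun ψ hψv hψ hψP => ?_⟩
  have hl0 : 0 ≤ τ / h ^ 2 := by positivity
  have hpow : ∀ j ≤ n, (1 + τ * K) ^ j ≤ Real.exp (K * T) := by
    intro j hj
    have h1 : 1 ≤ 1 + τ * K := by linarith [mul_nonneg hτ.le hK]
    refine (pow_le_pow_right₀ h1 hj).trans ?_
    rw [← hnτ, show K * (n * τ) = n * (τ * K) by ring, Real.exp_nat_mul]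
    exact pow_le_pow_left₀ (by linarith) (by linarith [Real.add_one_le_exp (τ * K)]) n
  have hφB : ∀ j < n, ∀ i : ℤ, |i| ≤ N →
      |dualSeq (τ / h ^ 2) τ a c ψ j i| ≤ C / N * (N - |(i : ℝ)|) := by
    intro j hj i hi
    refine (dualSeq_abs_le hl0 hτ.le (by positivity) hK hav ha01 hcK hs3 hψ j i hi).trans ?_
    have : |(i : ℝ)| ≤ N := by exact_mod_cast hi
    refine mul_le_mul_of_nonneg_right ?_ (by linarith)
    rw [hC, mul_comm 2, mul_div_assoc]
    exact mul_le_mul_of_nonneg_right (hpow j hj.le) (by positivity)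
  have hφC : ∀ j < n, ∀ i : ℤ, |dualSeq (τ / h ^ 2) τ a c ψ j i| ≤ C := by
    intro j hj i
    by_cases hi : |i| ≤ N
    · refine (hφB j hj i hi).trans ?_
      rw [div_mul_eq_mul_div, div_le_iff₀ hN0]
      exact mul_le_mul_of_nonneg_left (by linarith [abs_nonneg (i : ℝ)]) hC0.le
    · rw [VanishOut.dualSeq hav hψv j i (not_le.1 hi).le, abs_zero]
      exact hC0.le
  have hen := dualSeq_energy_le hτ.le hh hK hN hnτ hav hψv ha01 hcK (L := L)
    (fun j i => (hccL _ _ _).trans (by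
      push_cast
      rw [add_mul, one_mul, add_sub_cancel_left, abs_of_pos hh])) hs8 hτh2 hψP hφC
  rw [hNh] at hen
  -- data of the balance law
  set W : ℕ → ℤ → ℝ := fun j i => ∫ x, w x (T - j * τ) * hat (i * h) h x with hW
  set zb : ℕ → ℤ → ℝ := fun j i => (∫ t in s j..(s j + τ), z (i * h) t) / τ with hzb
  set Hb : ℕ → ℤ → ℝ := fun j i =>
    (∫ t in s j..(s j + τ), (∫ x, H x t * hat (i * h) h x) / h) / τ with hHb
  have hs0 : ∀ j < n, 0 ≤ s j ∧ s j + τ ≤ T := by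
    intro j hj
    have : ((j : ℝ) + 1) ≤ n := by exact_mod_cast hj
    simp only [hs]
    constructor
    · linarith [mul_le_mul_of_nonneg_right this hτ.le]
    · linarith [mul_nonneg (Nat.cast_nonneg (α := ℝ) j) hτ.le]
  have hWs : ∀ j i, W (j + 1) i = ∫ x, w x (s j) * hat (i * h) h x := by
    intro j i; simp only [hW, hs]; push_cast; rfl
  have hrel : ∀ j < n, ∀ i,
      W j i = W (j + 1) i + τ * (h * Hb j i + secondDiff (zb j) i / h) := by
    intro j hj i
    have h1 := S.balance (s j) (s j + τ) (hs0 j hj).1 (by linarith) (hs0 j hj).2 (i * h) h hh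
    have h2 : s j + τ = T - j * τ := by simp only [hs]; ring
    have h3 : W j i = ∫ x, w x (s j + τ) * hat (i * h) h x := by rw [h2]
    rw [h3, h1, hWs]
    simp only [hHb, hzb, secondDiff, intervalIntegral.integral_div]
    push_cast
    rw [show ((i : ℝ) + 1) * h = i * h + h by ring, show ((i : ℝ) - 1) * h = i * h - h by ring]
    field_simp
    ring
  set e₁ : ℕ → ℝ := fun j => if T - (j + 1) * τ < δ then (2 + A) * M else 2 * (ε * M) with he₁
  set e₂ : ℕ → ℝ := fun j =>
    if T - (j + 1) * τ < δ₁ then (1 + K) * M else (1 + K) * ϖ + η with he₂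
  have hmem : ∀ i : ℤ, |i| ≤ N → (i : ℝ) * h ∈ Icc (-R) R := by
    intro i hi
    have : |(i : ℝ)| ≤ N := by exact_mod_cast hi
    rw [mem_Icc, ← abs_le, abs_mul, abs_of_pos hh, ← hNh]
    exact mul_le_mul_of_nonneg_right this hh.le
  have h₁ : ∀ j < n, ∀ i : ℤ, |i| < N → |zb j i - a j i * (W (j + 1) i / h)| ≤ e₁ j := by
    intro j hj i hi
    rw [hWs]
    simp only [he₁]
    split_ifs with hcase
    · refine (S.slab_crude (c := 0) hh hτ (hs0 j hj).1 (hs0 j hj).2).2.1.trans ?_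
      have := ha01 j i
      rw [abs_of_nonneg this.1]
      exact mul_le_mul_of_nonneg_right (by linarith) hM.le
    · refine (S.slab_z_le hA hε.le hδ hh hτ hhd hτd hh1 (hmem i hi.le) (not_lt.1 hcase)
        (hs0 j hj).2 (fun x hx y hy s hs t ht hxy hst =>
          hmw x hx y hy s hs t ht (hxy.trans d1) (hst.trans d1))
        (fun x hx y hy s hs t ht hxy hst =>
          hmz x hx y hy s hs t ht (hxy.trans d2) (hst.trans d2)) (by
            simp only [ha]; rw [if_pos hi])).trans ?_
      linarith
  have h₂ : ∀ j < n, ∀ i : ℤ, |i| ≤ N → |Hb j i - c j i * (W (j + 1) i / h)| ≤ e₂ j := by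
    intro j hj i hi
    rw [hWs]
    simp only [he₂]
    split_ifs with hcase
    · refine (S.slab_crude (a := 0) hh hτ (hs0 j hj).1 (hs0 j hj).2).2.2.trans ?_
      exact mul_le_mul_of_nonneg_right (by linarith [hcK j i]) hM.le
    · exact S.slab_H_le hδ hh hτ hhd hτd hh1 (hmem i hi) (hδδ₁.trans (not_lt.1 hcase))
        (hs0 j hj).2 (fun x hx y hy s hs t ht hxy hst =>
          hmw x hx y hy s hs t ht (hxy.trans d1) (hst.trans d1))
        (fun x hx y hy s hs t ht hxy hst =>
          hmH x hx y hy s hs t ht (hxy.trans d3) (hst.trans d3)) (hcK j i)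
        (hccw _ (hmem i hi) _ ⟨not_lt.1 hcase, by linarith [(hs0 j hj).2]⟩)
  have hMz : ∀ j < n, ∀ i : ℤ, |zb j i| ≤ M := fun j hj i =>
    (S.slab_crude (a := 0) (c := 0) hh hτ (hs0 j hj).1 (hs0 j hj).2).1
  have key := duality_error_le (ε := ε) hτ.le hh hμ hε (by positivity : 0 ≤ C / N) hav hψv
    (fun j i hi => by
      simp only [ha]; rw [if_pos hi]; linarith [(S.ratio_mem hA (i * h) (s j)).1])
    hφB hrel h₁ h₂ hMz hen
  have hW0 : ∀ i : ℤ, W 0 i = ∫ x, w x T * hat (i * h) h x := by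
    intro i; simp [hW]
  have hWn : ∀ i : ℤ, W n i = ∫ x, w x 0 * hat (i * h) h x := by
    intro i; simp [hW, hnτ]
  simp only [hW0, hWn] at key
  refine key.trans ?_
  have hsum₁ : ∑ j ∈ Finset.range n, τ * e₁ j ^ 2
      ≤ T * (2 * (ε * M)) ^ 2 + 2 * δ * ((2 + A) * M) ^ 2 := by
    have := sum_time_le (α := ((2 + A) * M) ^ 2) (β := (2 * (ε * M)) ^ 2) hτ.le hδ.le
      (sq_nonneg _) (sq_nonneg _) hnτ
    simp only [he₁, ite_pow]
    refine this.trans (add_le_add le_rfl (mul_le_mul_of_nonneg_right (by linarith) (sq_nonneg _)))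
  have hsum₂ : ∑ j ∈ Finset.range n, τ * e₂ j
      ≤ T * ((1 + K) * ϖ + η) + 2 * δ₁ * ((1 + K) * M) := by
    have := sum_time_le (α := (1 + K) * M) (β := (1 + K) * ϖ + η) hτ.le hδ₁.le
      (by positivity) (by positivity) hnτ
    refine this.trans (add_le_add le_rfl (mul_le_mul_of_nonneg_right (by linarith) (by positivity)))
  have hRN : h * (2 * N + 1) ≤ 3 * R := by
    linarith [mul_le_mul_of_nonneg_right hN1 hh.le]
  have hCN : C / N * N = C := by field_simp
  have hlast : n * τ * (2 * (C / N * M / h)) = T * (4 * Real.exp (K * T) * M / R) := by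
    rw [hnτ, hC, ← hNh]; field_simp; ring
  have hT₁ : (∑ j ∈ Finset.range n, τ * e₁ j ^ 2) / (2 * μ * ε) * (3 * R) ≤ σ / 6 + σ / 6 := by
    have h1 := div_le_div_of_nonneg_right hsum₁ (by positivity : 0 ≤ 2 * μ * ε)
    refine (mul_le_mul_of_nonneg_right h1 (by positivity)).trans ?_
    refine le_trans (le_of_eq ?_) (add_le_add hεσ hδσ)
    field_simp
    ring
  have hT₂ : C * (∑ j ∈ Finset.range n, τ * e₂ j) * (3 * R) ≤ σ / 6 + σ / 6 + σ / 6 := by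
    refine (mul_le_mul_of_nonneg_right (mul_le_mul_of_nonneg_left hsum₂ hC0.le)
      (by positivity)).trans ?_
    refine le_trans (le_of_eq ?_) (add_le_add (add_le_add hϖσ hησ) hδ₁σ)
    ring
  have hnn : 0 ≤ (∑ j ∈ Finset.range n, τ * e₁ j ^ 2) / (2 * μ * ε)
      + C * ∑ j ∈ Finset.range n, τ * e₂ j := by
    have h1 : 0 ≤ ∑ j ∈ Finset.range n, τ * e₁ j ^ 2 :=
      Finset.sum_nonneg fun j _ => by positivity
    have h2 : 0 ≤ ∑ j ∈ Finset.range n, τ * e₂ j :=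
      Finset.sum_nonneg fun j _ => mul_nonneg hτ.le (by
        simp only [he₂]; split_ifs <;> positivity)
    positivity
  rw [hlast, hCN]
  have := mul_le_mul_of_nonneg_right hRN hnn
  linarith

lemma abs_hat_sub_le {r : ℝ} (hr : 0 < r) (x₀ x y : ℝ) :
    |hat x₀ r x - hat x₀ r y| ≤ 1 / r * |x - y| := by
  unfold hat
  have h1 := abs_max_sub_max_le_abs (1 - |x - x₀| / r) (1 - |y - x₀| / r) 0
  rw [max_comm 0, max_comm 0]
  refine h1.trans ?_
  rw [show 1 - |x - x₀| / r - (1 - |y - x₀| / r) = 1 / r * (|y - x₀| - |x - x₀|) by ring, abs_mul,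
    abs_of_pos (by positivity : 0 < 1 / r)]
  refine mul_le_mul_of_nonneg_left ?_ (by positivity)
  have h2 := abs_abs_sub_abs_le (y - x₀) (x - x₀)
  rwa [sub_sub_sub_cancel_right, abs_sub_comm y x] at h2

lemma hat_grid_bound {N : ℕ} {h R r x₀ : ℝ} (hh : 0 < h) (hN : 1 ≤ N) (hNh : N * h = R)
    (hr : 0 < r) (hx : |x₀| + r ≤ R / 2) {i : ℤ} (hi : |i| ≤ N) :
    hat x₀ r (i * h) ≤ 2 / N * (N - |(i : ℝ)|) := by
  have hN0 : (0 : ℝ) < N := by exact_mod_cast hN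
  have hiN : |(i : ℝ)| ≤ N := by exact_mod_cast hi
  by_cases hc : r ≤ |i * h - x₀|
  · rw [hat_eq_zero hr hc]
    have : 0 ≤ (N : ℝ) - |(i : ℝ)| := by linarith
    positivity
  · refine (hat_le_one hr _ _).trans ?_
    have h1 : |(i : ℝ)| * h ≤ R / 2 := by
      have : |(i : ℝ) * h| ≤ |i * h - x₀| + |x₀| := by
        have := abs_add_le (i * h - x₀) x₀
        rwa [sub_add_cancel] at this
      rw [abs_mul, abs_of_pos hh] at this
      linarith [not_le.1 hc]
    have h2 : |(i : ℝ)| ≤ N / 2 := by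
      rw [← hNh, mul_div_right_comm] at h1
      exact le_of_mul_le_mul_right h1 hh
    rw [div_mul_eq_mul_div, le_div_iff₀ hN0]
    linarith

lemma vanishOut_hat_grid {N : ℕ} {h R r x₀ : ℝ} (hh : 0 < h) (hNh : N * h = R)
    (hr : 0 < r) (hR : 0 ≤ R) (hx : |x₀| + r ≤ R / 2) :
    VanishOut N fun i => hat x₀ r (i * h) := by
  intro i hi
  refine hat_eq_zero hr ?_
  have hi' : (N : ℝ) ≤ |(i : ℝ)| := by exact_mod_cast hi
  have h1 : R ≤ |(i : ℝ) * h| := by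
    rw [abs_mul, abs_of_pos hh, ← hNh]
    exact mul_le_mul_of_nonneg_right hi' hh.le
  have := abs_add_le (i * h - x₀) x₀
  rw [sub_add_cancel] at this
  linarith

lemma sum_hat_grid_lower {N : ℕ} {h R r x₀ κ : ℝ} {F : ℝ → ℝ} {M : ℝ} (hh : 0 < h)
    (hNh : N * h = R) (hr : 0 < r) (hx : |x₀| + r ≤ R / 2) (hhr : h ≤ r / 2) (hκ : 0 ≤ κ)
    (hF : Measurable F) (hM : ∀ x, |F x| ≤ M) (hFκ : ∀ x, |x - x₀| ≤ 2 * r → κ ≤ F x) :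
    κ * (r / 4) ≤ ∑ i ∈ Finset.Icc (-(N : ℤ)) N,
      hat x₀ r (i * h) * ∫ x, F x * hat (i * h) h x := by
  have hterm : ∀ i : ℤ, κ * h * hat x₀ r (i * h)
      ≤ hat x₀ r (i * h) * ∫ x, F x * hat (i * h) h x := by
    intro i
    by_cases hc : r ≤ |i * h - x₀|
    · rw [hat_eq_zero hr hc]; simp
    · rw [mul_comm]
      refine mul_le_mul_of_nonneg_left ?_ (hat_nonneg _ _ _)
      have h1 : ∫ x, κ * hat (i * h) h x = κ * h := by rw [integral_const_mul, integral_hat hh]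
      rw [← h1]
      refine integral_mono ((integrable_hat hh _).const_mul κ) (integrable_mul_hat hh _ hF hM)
        fun x => ?_
      dsimp only
      by_cases hx' : h ≤ |x - i * h|
      · rw [hat_eq_zero hh hx']; simp
      · refine mul_le_mul_of_nonneg_right (hFκ x ?_) (hat_nonneg _ _ _)
        have := abs_sub_le x (i * h) x₀
        linarith [not_le.1 hc, not_le.1 hx']
  refine le_trans ?_ (Finset.sum_le_sum fun i _ => hterm i)
  rw [← Finset.mul_sum, mul_assoc]
  refine mul_le_mul_of_nonneg_left ?_ hκ
  set J := Finset.Icc ⌈(x₀ - r / 2) / h⌉ ⌊(x₀ + r / 2) / h⌋ with hJ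
  have hJmem : ∀ i ∈ J, |i * h - x₀| ≤ r / 2 := by
    intro i hi
    rw [hJ, Finset.mem_Icc, Int.ceil_le, Int.le_floor, div_le_iff₀ hh, le_div_iff₀ hh] at hi
    exact abs_le.2 ⟨by linarith [hi.1], by linarith [hi.2]⟩
  have hsub : J ⊆ Finset.Icc (-(N : ℤ)) N := by
    intro i hi
    have h1 := hJmem i hi
    have h2 := abs_add_le (i * h - x₀) x₀
    rw [sub_add_cancel, abs_mul, abs_of_pos hh] at h2
    have h3 : |(i : ℝ)| * h ≤ N * h := by
      rw [hNh]; linarith [abs_nonneg x₀]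
    have h4 : |(i : ℝ)| ≤ N := le_of_mul_le_mul_right h3 hh
    rw [Finset.mem_Icc, ← abs_le]
    exact_mod_cast h4
  have hcard : r / h - 1 ≤ J.card := by
    have h1 : (⌊(x₀ + r / 2) / h⌋ + 1 - ⌈(x₀ - r / 2) / h⌉ : ℤ) ≤ J.card := by
      rw [hJ, Int.card_Icc]; exact Int.self_le_toNat _
    have h2 : ((⌊(x₀ + r / 2) / h⌋ : ℝ) + 1 - ⌈(x₀ - r / 2) / h⌉) ≤ J.card := by exact_mod_cast h1
    have h3 := Int.lt_floor_add_one ((x₀ + r / 2) / h)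
    have h4 := Int.ceil_lt_add_one ((x₀ - r / 2) / h)
    have h5 : (x₀ + r / 2) / h - (x₀ - r / 2) / h = r / h := by ring
    linarith
  have h6 : (J.card : ℝ) * (1 / 2) ≤ ∑ i ∈ Finset.Icc (-(N : ℤ)) N, hat x₀ r (i * h) := by
    refine le_trans ?_ (Finset.sum_le_sum_of_subset_of_nonneg hsub fun i _ _ => hat_nonneg _ _ _)
    rw [← nsmul_eq_mul]
    refine Finset.card_nsmul_le_sum _ _ _ fun i hi => le_max_of_le_right ?_
    have : |i * h - x₀| / r ≤ 1 / 2 := by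
      rw [div_le_iff₀ hr]; linarith [hJmem i hi]
    linarith
  have h7 : (r / h - 1) * (1 / 2) * h ≤ h * ∑ i ∈ Finset.Icc (-(N : ℤ)) N, hat x₀ r (i * h) := by
    rw [mul_comm h]
    exact mul_le_mul_of_nonneg_right (by linarith) hh.le
  have h8 : (r / h - 1) * (1 / 2) * h = (r - h) / 2 := by field_simp
  linarith

lemma exists_pos_lower_bound {F : ℝ → ℝ} (hF : Continuous F) {x₀ r₀ : ℝ} (hr₀ : 0 < r₀)
    (hx₀ : 0 < F x₀) :
    ∃ r > 0, r ≤ r₀ ∧ ∀ s, s ≤ r → ∀ x, |x - x₀| ≤ 2 * s → F x₀ / 2 ≤ F x := by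
  have : ∀ᶠ x in nhds x₀, F x₀ / 2 < F x :=
    hF.continuousAt.eventually (lt_mem_nhds (by linarith))
  obtain ⟨d, hd, hball⟩ := Metric.eventually_nhds_iff.1 this
  refine ⟨min r₀ (d / 4), by positivity, min_le_left _ _, fun s hs x hx => (hball ?_).le⟩
  rw [Real.dist_eq]
  have := hs.trans (min_le_right _ _)
  linarith

/-- Comparison principle. -/
theorem DiffSys.nonpos_of_nonpos {T A K M : ℝ} {w z H : ℝ → ℝ → ℝ} (S : DiffSys T A K M w z H)
    (hT : 0 < T) (hA : 0 ≤ A) (hK : 0 ≤ K) (hM : 0 < M) (h0 : ∀ x, w x 0 ≤ 0) (x : ℝ) :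
    w x T ≤ 0 := by
  by_contra! hx
  have hTT : T ∈ Icc 0 T := ⟨hT.le, le_rfl⟩
  obtain ⟨r, hr, hr1, hlow⟩ := exists_pos_lower_bound
    (continuous_slice S.cont_w ⟨hT, le_rfl⟩) one_pos hx
  have hlow := hlow r le_rfl
  set κ := w x T / 2 with hκ
  have hκ0 : 0 < κ := by positivity
  set X := T * (4 * Real.exp (K * T) * M) with hX
  have hX0 : 0 ≤ X := by positivity
  set R := max (2 * (|x| + 1)) (16 * X / (κ * r)) with hR
  have hR0 : 0 < R := lt_max_of_lt_left (by positivity)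
  have hRx : |x| + r ≤ R / 2 := by linarith [le_max_left (2 * (|x| + 1)) (16 * X / (κ * r))]
  have hRX : X / R ≤ κ * r / 16 := by
    have := le_max_right (2 * (|x| + 1)) (16 * X / (κ * r))
    rw [← hR, div_le_iff₀ (by positivity)] at this
    rw [div_le_iff₀ hR0]
    linarith
  obtain ⟨N, n, h, τ, a, c, hh, hhr, hN, hNh, hτ, -, -, ha, hc, hs, hdual⟩ :=
    S.exists_dual_scheme hT hA hK hM (P := 1 / r) (σ := κ * r / 16) (h₀ := r / 2) hR0
      (by positivity) (by positivity)
  have hd := hdual (fun i => hat x r (i * h)) (vanishOut_hat_grid hh hNh hr hR0.le hRx)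
    (fun i hi => by
      rw [abs_of_nonneg (hat_nonneg _ _ _)]
      exact hat_grid_bound hh hN hNh hr hRx hi)
    (fun i => by
      refine (abs_hat_sub_le hr _ _ _).trans (le_of_eq ?_)
      push_cast
      rw [add_mul, one_mul, add_sub_cancel_left, abs_of_pos hh])
  have hl := sum_hat_grid_lower hh hNh hr hRx hhr hκ0.le (S.measurable_slice hTT)
    (fun y => S.abs_w_le y T hTT) hlow
  have hneg : ∑ i ∈ Finset.Icc (-(N : ℤ)) N,
      dualSeq (τ / h ^ 2) τ a c (fun i => hat x r (i * h)) n i * ∫ y, w y 0 * hat (i * h) h y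
      ≤ 0 := by
    refine Finset.sum_nonpos fun i _ => mul_nonpos_of_nonneg_of_nonpos
      (dualSeq_nonneg (by positivity) hτ ha hc hs (fun i => hat_nonneg _ _ _) n i)
      (integral_nonpos fun y => ?_)
    exact mul_nonpos_of_nonpos_of_nonneg (h0 y) (hat_nonneg _ _ _)
  have h1 := (abs_le.1 hd).2
  have h2 : T * (4 * Real.exp (K * T) * M / R) = X / R := by rw [hX]; ring
  rw [h2] at h1
  have : 0 < κ * r := by positivity
  linarith

lemma exists_balanced_combination {φ₁ φ₂ : ℤ → ℝ} (h1 : ∀ i, 0 ≤ φ₁ i) (h2 : ∀ i, 0 ≤ φ₂ i)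
    (hs : ∀ q ∈ Icc (0 : ℝ) 1, SignPattern fun i => (1 - q) * φ₁ i - q * φ₂ i) :
    ∃ q ∈ Icc (0 : ℝ) 1, (∀ i ≤ 0, 0 ≤ (1 - q) * φ₁ i - q * φ₂ i) ∧
      ∀ i > 0, (1 - q) * φ₁ i - q * φ₂ i ≤ 0 := by
  have hX : IsClosed {q : ℝ | ∀ i ≤ (0 : ℤ), 0 ≤ (1 - q) * φ₁ i - q * φ₂ i} := by
    simp only [ofPred_forall]
    exact isClosed_iInter fun i => isClosed_iInter fun _ =>
      isClosed_le continuous_const (by fun_prop)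
  have hY : IsClosed {q : ℝ | ∀ i > (0 : ℤ), (1 - q) * φ₁ i - q * φ₂ i ≤ 0} := by
    simp only [ofPred_forall]
    exact isClosed_iInter fun i => isClosed_iInter fun _ =>
      isClosed_le (by fun_prop) continuous_const
  obtain ⟨q, hq, hqX, hqY⟩ := isPreconnected_closed_iff.1 (isPreconnected_Icc (a := (0 : ℝ)) (b := 1))
    _ _ hX hY (fun q hq => by
      obtain ⟨k, hk1, hk2⟩ := hs q hq
      rcases le_total 0 k with hk | hk
      · left; exact fun i hi => hk1 i (hi.trans hk)
      · right; exact fun i hi => hk2 i (lt_of_le_of_lt hk hi))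
    ⟨0, by simp, fun i _ => by simpa using h1 i⟩ ⟨1, by simp, fun i _ => by simpa using h2 i⟩
  exact ⟨q, hq, hqX, hqY⟩

set_option maxHeartbeats 1000000 in
/-- If `w` changes sign at most once, from nonpositive to nonnegative, initially, then it cannot
be positive to the left of a point where it is negative later. -/
theorem DiffSys.no_descent {T A K M : ℝ} {w z H : ℝ → ℝ → ℝ} (S : DiffSys T A K M w z H)
    (hT : 0 < T) (hA : 0 ≤ A) (hK : 0 ≤ K) (hM : 0 < M) (h0 : ∀ x ≤ 0, w x 0 ≤ 0)
    (h0' : ∀ x > 0, 0 ≤ w x 0) {x₁ x₂ : ℝ} (hx : x₁ < x₂) (h₁ : 0 < w x₁ T) : 0 ≤ w x₂ T := by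
  by_contra! h₂
  have hTT : T ∈ Icc 0 T := ⟨hT.le, le_rfl⟩
  have hcw := continuous_slice S.cont_w ⟨hT, le_rfl⟩
  obtain ⟨r₁, hr₁, hr₁', hlow₁⟩ := exists_pos_lower_bound hcw
    (r₀ := min 1 ((x₂ - x₁) / 2)) (lt_min one_pos (by linarith)) h₁
  obtain ⟨r, hr, hrr₁, hlow₂⟩ := exists_pos_lower_bound hcw.neg (x₀ := x₂) hr₁ (neg_pos.2 h₂)
  have hlow₁ := hlow₁ r hrr₁
  have hlow₂ := hlow₂ r le_rfl
  have hr1 : r ≤ 1 := hrr₁.trans (hr₁'.trans (min_le_left _ _))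
  have hrx : r ≤ (x₂ - x₁) / 2 := hrr₁.trans (hr₁'.trans (min_le_right _ _))
  set κ := min (w x₁ T / 2) (-w x₂ T / 2) with hκ
  have hκ0 : 0 < κ := lt_min (by linarith) (by linarith)
  set X := T * (4 * Real.exp (K * T) * M) with hX
  have hX0 : 0 ≤ X := by positivity
  set R := max (2 * (max |x₁| |x₂| + 1)) (16 * X / (κ * r)) with hR
  have hmx : 0 ≤ max |x₁| |x₂| := (abs_nonneg _).trans (le_max_left _ _)
  have hR0 : 0 < R := lt_max_of_lt_left (by positivity)
  have hRm : max |x₁| |x₂| + r ≤ R / 2 := by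
    linarith [le_max_left (2 * (max |x₁| |x₂| + 1)) (16 * X / (κ * r))]
  have hRx₁ : |x₁| + r ≤ R / 2 := by linarith [le_max_left |x₁| |x₂|]
  have hRx₂ : |x₂| + r ≤ R / 2 := by linarith [le_max_right |x₁| |x₂|]
  have hRX : X / R ≤ κ * r / 16 := by
    have := le_max_right (2 * (max |x₁| |x₂| + 1)) (16 * X / (κ * r))
    rw [← hR, div_le_iff₀ (by positivity)] at this
    rw [div_le_iff₀ hR0]
    linarith
  obtain ⟨h₀, hh₀, hh₀r, hh₀σ⟩ := exists_pos_le_mul_le (c := 2 * Real.exp (K * T) * M)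
    (by positivity) (by positivity : 0 < r / 2) (by positivity : 0 < κ * r / 16)
  obtain ⟨N, n, h, τ, a, c, hh, hhh₀, hN, hNh, hτ, hnτ, hav, ha, hc, hs, hdual⟩ :=
    S.exists_dual_scheme hT hA hK hM (P := 1 / r) (σ := κ * r / 16) (h₀ := h₀) hR0
      (by positivity) hh₀
  have hhr : h ≤ r / 2 := hhh₀.trans hh₀r
  have hl : 0 ≤ τ / h ^ 2 := by positivity
  set ψ₁ : ℤ → ℝ := fun i => hat x₁ r (i * h) with hψ₁
  set ψ₂ : ℤ → ℝ := fun i => hat x₂ r (i * h) with hψ₂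
  have hψ₁0 : ∀ i, 0 ≤ ψ₁ i := fun i => hat_nonneg _ _ _
  have hψ₂0 : ∀ i, 0 ≤ ψ₂ i := fun i => hat_nonneg _ _ _
  have hpat : ∀ q ∈ Icc (0 : ℝ) 1, SignPattern fun i => (1 - q) * ψ₁ i - q * ψ₂ i := by
    intro q hq
    refine ⟨⌊(x₁ + x₂) / 2 / h⌋, fun i hi => ?_, fun i hi => ?_⟩
    · rw [Int.le_floor, le_div_iff₀ hh] at hi
      have : ψ₂ i = 0 := hat_eq_zero hr (by rw [le_abs]; right; linarith)
      dsimp only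
      rw [this, mul_zero, sub_zero]
      exact mul_nonneg (by linarith [hq.2]) (hψ₁0 i)
    · rw [gt_iff_lt, Int.floor_lt, div_lt_iff₀ hh] at hi
      have : ψ₁ i = 0 := hat_eq_zero hr (by rw [le_abs]; left; linarith)
      dsimp only
      rw [this, mul_zero, zero_sub, neg_nonpos]
      exact mul_nonneg hq.1 (hψ₂0 i)
  obtain ⟨q, hq, hq1, hq2⟩ := exists_balanced_combination
    (φ₁ := dualSeq (τ / h ^ 2) τ a c ψ₁ n) (φ₂ := dualSeq (τ / h ^ 2) τ a c ψ₂ n)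
    (dualSeq_nonneg hl hτ ha hc hs hψ₁0 n) (dualSeq_nonneg hl hτ ha hc hs hψ₂0 n)
    fun q hq => by
      have := SignPattern.dualSeq hl hτ ha hc hs (hpat q hq) n
      have e : dualSeq (τ / h ^ 2) τ a c (fun i => (1 - q) * ψ₁ i - q * ψ₂ i) n
          = fun i => (1 - q) * dualSeq (τ / h ^ 2) τ a c ψ₁ n i
            - q * dualSeq (τ / h ^ 2) τ a c ψ₂ n i := by
        funext i; exact dualSeq_linear _ _ _ _ _ _ _ _ _ _
      rwa [e] at this
  simp only [← dualSeq_linear] at hq1 hq2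
  set ψ : ℤ → ℝ := fun i => (1 - q) * ψ₁ i - q * ψ₂ i with hψ
  have hq0 : 0 ≤ 1 - q := by linarith [hq.2]
  have habs : ∀ x y b : ℝ, |x| ≤ b → |y| ≤ b → |(1 - q) * x - q * y| ≤ b := by
    intro x y b hx hy
    refine (abs_sub _ _).trans ?_
    rw [abs_mul, abs_mul, abs_of_nonneg hq0, abs_of_nonneg hq.1]
    have e1 := mul_le_mul_of_nonneg_left hx hq0
    have e2 := mul_le_mul_of_nonneg_left hy hq.1
    linarith
  have hψv : VanishOut N ψ := by
    intro i hi
    have e1 : hat x₁ r (i * h) = 0 := vanishOut_hat_grid hh hNh hr hR0.le hRx₁ i hi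
    have e2 : hat x₂ r (i * h) = 0 := vanishOut_hat_grid hh hNh hr hR0.le hRx₂ i hi
    simp only [hψ, hψ₁, hψ₂]
    rw [e1, e2]; simp
  have hψb : ∀ i : ℤ, |i| ≤ N → |ψ i| ≤ 2 / N * (N - |(i : ℝ)|) := by
    intro i hi
    refine habs _ _ _ ?_ ?_
    · rw [abs_of_nonneg (hψ₁0 i)]
      exact hat_grid_bound hh hN hNh hr hRx₁ hi
    · rw [abs_of_nonneg (hψ₂0 i)]
      exact hat_grid_bound hh hN hNh hr hRx₂ hi
  have hψP : ∀ i, |ψ (i + 1) - ψ i| ≤ 1 / r * h := by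
    intro i
    have e : ψ (i + 1) - ψ i = (1 - q) * (ψ₁ (i + 1) - ψ₁ i) - q * (ψ₂ (i + 1) - ψ₂ i) := by
      simp only [hψ]; ring
    have e' : ∀ x, |hat x r ((i + 1 : ℤ) * h) - hat x r (i * h)| ≤ 1 / r * h := fun x => by
      refine (abs_hat_sub_le hr _ _ _).trans (le_of_eq ?_)
      push_cast
      rw [add_mul, one_mul, add_sub_cancel_left, abs_of_pos hh]
    rw [e]
    exact habs _ _ _ (e' x₁) (e' x₂)
  have hd := hdual ψ hψv hψb hψP
  have hl₁ := sum_hat_grid_lower hh hNh hr hRx₁ hhr hκ0.le (S.measurable_slice hTT)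
    (fun y => S.abs_w_le y T hTT) fun x hx => (min_le_left _ _).trans (hlow₁ x hx)
  have hl₂ := sum_hat_grid_lower (F := fun y => -w y T) hh hNh hr hRx₂ hhr hκ0.le
    (S.measurable_slice hTT).neg
    (fun y => by rw [abs_neg]; exact S.abs_w_le y T hTT)
    fun x hx => (min_le_right _ _).trans (hlow₂ x hx)
  have hsplit : ∑ i ∈ Finset.Icc (-(N : ℤ)) N, ψ i * ∫ x, w x T * hat (i * h) h x
      = (1 - q) * (∑ i ∈ Finset.Icc (-(N : ℤ)) N,
          hat x₁ r (i * h) * ∫ x, w x T * hat (i * h) h x)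
        + q * ∑ i ∈ Finset.Icc (-(N : ℤ)) N,
          hat x₂ r (i * h) * ∫ x, -w x T * hat (i * h) h x := by
    rw [Finset.mul_sum, Finset.mul_sum, ← Finset.sum_add_distrib]
    refine Finset.sum_congr rfl fun i _ => ?_
    simp only [neg_mul, integral_neg, hψ, hψ₁, hψ₂]
    ring
  have hlow : κ * (r / 4) ≤ ∑ i ∈ Finset.Icc (-(N : ℤ)) N, ψ i * ∫ x, w x T * hat (i * h) h x := by
    rw [hsplit]
    have e1 := mul_le_mul_of_nonneg_left hl₁ hq0
    have e2 := mul_le_mul_of_nonneg_left hl₂ hq.1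
    linarith
  have hN0 : (0 : ℝ) < N := by exact_mod_cast hN
  have hφ0 : |dualSeq (τ / h ^ 2) τ a c ψ n 0| ≤ 2 * Real.exp (K * T) := by
    have e1 := dualSeq_abs_le hl hτ (by positivity : (0 : ℝ) ≤ 2 / N) hK hav ha hc hs hψb n 0
      (by simp)
    refine e1.trans ?_
    have e2 : (1 + τ * K) ^ n ≤ Real.exp (K * T) := by
      rw [← hnτ, show K * (n * τ) = n * (τ * K) by ring, Real.exp_nat_mul]
      exact pow_le_pow_left₀ (by positivity) (by linarith [Real.add_one_le_exp (τ * K)]) n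
    rw [show (1 + τ * K) ^ n * (2 / N) * (N - |((0 : ℤ) : ℝ)|) = 2 * (1 + τ * K) ^ n by
      simp; field_simp]
    linarith
  have hup : ∑ i ∈ Finset.Icc (-(N : ℤ)) N,
      dualSeq (τ / h ^ 2) τ a c ψ n i * ∫ y, w y 0 * hat (i * h) h y
      ≤ 2 * Real.exp (K * T) * (M * h) := by
    have hterm : ∀ i ∈ Finset.Icc (-(N : ℤ)) N,
        dualSeq (τ / h ^ 2) τ a c ψ n i * ∫ y, w y 0 * hat (i * h) h y
        ≤ if i = 0 then 2 * Real.exp (K * T) * (M * h) else 0 := by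
      intro i _
      rcases lt_trichotomy i 0 with hi | hi | hi
      · rw [if_neg hi.ne]
        refine mul_nonpos_of_nonneg_of_nonpos (hq1 i hi.le) (integral_nonpos fun y => ?_)
        rcases le_or_gt y 0 with hy | hy
        · exact mul_nonpos_of_nonpos_of_nonneg (h0 y hy) (hat_nonneg _ _ _)
        · have : (i : ℝ) ≤ -1 := by exact_mod_cast Int.le_sub_one_of_lt hi
          have hz : hat (i * h) h y = 0 := hat_eq_zero hh (by
            rw [le_abs]; left; linarith [mul_le_mul_of_nonneg_right this hh.le])
          simp [hz]
      · rw [if_pos hi, hi]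
        refine (le_abs_self _).trans ?_
        rw [abs_mul]
        exact mul_le_mul hφ0 (abs_integral_mul_hat_le hh _ fun y => S.abs_w_le y 0 ⟨le_rfl, hT.le⟩)
          (abs_nonneg _) (by positivity)
      · rw [if_neg hi.ne']
        refine mul_nonpos_of_nonpos_of_nonneg (hq2 i hi) (integral_nonneg fun y => ?_)
        rcases le_or_gt y 0 with hy | hy
        · have : (1 : ℝ) ≤ i := by exact_mod_cast hi
          have hz : hat (i * h) h y = 0 := hat_eq_zero hh (by
            rw [le_abs]; right; linarith [mul_le_mul_of_nonneg_right this hh.le])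
          simp [hz]
        · exact mul_nonneg (h0' y hy) (hat_nonneg _ _ _)
    refine (Finset.sum_le_sum hterm).trans ?_
    rw [Finset.sum_ite_eq', if_pos (by simp)]
  have h1 := (abs_le.1 hd).2
  have h2 : T * (4 * Real.exp (K * T) * M / R) = X / R := by rw [hX]; ring
  rw [h2] at h1
  have h3 : 2 * Real.exp (K * T) * (M * h) ≤ κ * r / 16 := by
    rw [← mul_assoc]
    exact (mul_le_mul_of_nonneg_left hhh₀ (by positivity)).trans hh₀σ
  have : 0 < κ * r := by positivity
  linarith

/-! ### Second derivatives tested against hats -/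

lemma integral_deriv2_mul_hat {G G' G'' : ℝ → ℝ} (h1 : ∀ x, HasDerivAt G (G' x) x)
    (h2 : ∀ x, HasDerivAt G' (G'' x) x) (hc : Continuous G'') {h : ℝ} (hh : 0 < h) (x₀ : ℝ) :
    ∫ x, G'' x * hat x₀ h x = (G (x₀ + h) - 2 * G x₀ + G (x₀ - h)) / h := by
  have h0 : ∫ x, G'' x * hat x₀ h x = ∫ x in (x₀ - h)..(x₀ + h), G'' x * hat x₀ h x := by
    rw [intervalIntegral.integral_of_le (by linarith)]
    refine (setIntegral_eq_integral_of_forall_compl_eq_zero fun x hx => ?_).symm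
    rw [hat_eq_zero hh, mul_zero]
    rw [mem_Ioc, not_and_or, not_lt, not_le] at hx
    rw [le_abs]
    rcases hx with h' | h'
    · right; linarith
    · left; linarith
  have hi : Continuous fun x => G'' x * hat x₀ h x := hc.mul (continuous_hat x₀ h)
  rw [h0, ← intervalIntegral.integral_add_adjacent_intervals (b := x₀)
    (hi.intervalIntegrable _ _) (hi.intervalIntegrable _ _)]
  have hG1 : Continuous G := continuous_iff_continuousAt.2 fun x => (h1 x).continuousAt
  have hG2 : Continuous G' := continuous_iff_continuousAt.2 fun x => (h2 x).continuousAt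
  have e1 : ∫ x in (x₀ - h)..x₀, G'' x * hat x₀ h x
      = ∫ x in (x₀ - h)..x₀, G'' x * (1 + (x - x₀) / h) := by
    refine intervalIntegral.integral_congr fun x hx => ?_
    rw [uIcc_of_le (by linarith)] at hx
    have : (x - x₀) / h ≥ -1 := by rw [ge_iff_le, le_div_iff₀ hh]; linarith [hx.1]
    simp only [hat]
    rw [abs_of_nonpos (by linarith [hx.2]), neg_div, sub_neg_eq_add, max_eq_right (by linarith)]
  have e2 : ∫ x in x₀..(x₀ + h), G'' x * hat x₀ h x
      = ∫ x in x₀..(x₀ + h), G'' x * (1 - (x - x₀) / h) := by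
    refine intervalIntegral.integral_congr fun x hx => ?_
    rw [uIcc_of_le (by linarith)] at hx
    have : (x - x₀) / h ≤ 1 := by rw [div_le_iff₀ hh]; linarith [hx.2]
    simp only [hat]
    rw [abs_of_nonneg (by linarith [hx.1]), max_eq_right (by linarith)]
  have d : ∀ x, HasDerivAt (fun y : ℝ => (y - x₀) / h) (1 / h) x := fun x =>
    ((hasDerivAt_id x).sub_const x₀).div_const h
  have d1 : ∀ x, HasDerivAt (fun y => G' y * (1 + (y - x₀) / h) - G y / h)
      (G'' x * (1 + (x - x₀) / h)) x := fun x => by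
    refine (((h2 x).mul ((d x).const_add 1)).sub ((h1 x).div_const h)).congr_deriv ?_
    ring
  have d2 : ∀ x, HasDerivAt (fun y => G' y * (1 - (y - x₀) / h) + G y / h)
      (G'' x * (1 - (x - x₀) / h)) x := fun x => by
    refine (((h2 x).mul ((d x).const_sub 1)).add ((h1 x).div_const h)).congr_deriv ?_
    ring
  rw [e1, e2, intervalIntegral.integral_eq_sub_of_hasDerivAt (fun x _ => d1 x)
    (Continuous.intervalIntegrable (by fun_prop) _ _),
    intervalIntegral.integral_eq_sub_of_hasDerivAt (fun x _ => d2 x)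
    (Continuous.intervalIntegrable (by fun_prop) _ _)]
  field_simp
  ring

/-- The hat functions are limits of test functions whose second derivatives converge to
combinations of point masses. -/
lemma exists_smooth_hat {h : ℝ} (hh : 0 < h) (x₀ : ℝ) :
    ∃ φ : ℕ → ℝ → ℝ, (∀ n, ContDiff ℝ (⊤ : ℕ∞) (φ n)) ∧ (∀ n, HasCompactSupport (φ n)) ∧
      (∀ n x, |φ n x| ≤ indicator (Icc (x₀ - (h + 1)) (x₀ + (h + 1))) (fun _ => 2) x) ∧
      (∀ x, Tendsto (fun n => φ n x) atTop (nhds (hat x₀ h x))) ∧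
      (∀ F : ℝ → ℝ, Continuous F → ∀ M, (∀ x, |F x| ≤ M) →
        (∀ n, |∫ x, F x * deriv (deriv (φ n)) x| ≤ 12 * M / h) ∧
        Tendsto (fun n => ∫ x, F x * deriv (deriv (φ n)) x) atTop
          (nhds ((F (x₀ + h) - 2 * F x₀ + F (x₀ - h)) / h))) := by
  set ρ : ℕ → ContDiffBump (0 : ℝ) := fun n =>
    ⟨1 / ((n : ℝ) + 1) / 2, 1 / ((n : ℝ) + 1), by positivity, by
      have : (0 : ℝ) < 1 / ((n : ℝ) + 1) := by positivity
      linarith⟩ with hρ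
  have hr : ∀ n, (ρ n).rOut = 1 / ((n : ℝ) + 1) := fun n => rfl
  have hr1 : ∀ n, (ρ n).rOut ≤ 1 := fun n => by
    rw [hr, div_le_one (by positivity)]
    linarith [(Nat.cast_nonneg n : (0 : ℝ) ≤ n)]
  have hr0 : Tendsto (fun n => (ρ n).rOut) atTop (nhds 0) := by
    simp only [hr]; exact tendsto_one_div_add_atTop_nhds_zero_nat
  set r : ℕ → ℝ → ℝ := fun n => (ρ n).normed volume with hr_def
  have hrc : ∀ n, HasCompactSupport (r n) := fun n => (ρ n).hasCompactSupport_normed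
  have hrs : ∀ n, ContDiff ℝ (⊤ : ℕ∞) (r n) := fun n => (ρ n).contDiff_normed
  have hrs' : ∀ n, ContDiff ℝ (⊤ : ℕ∞) (deriv (r n)) := fun n =>
    ((contDiff_infty_iff_deriv).1 (hrs n)).2
  have hrs'' : ∀ n, ContDiff ℝ (⊤ : ℕ∞) (deriv (deriv (r n))) := fun n =>
    ((contDiff_infty_iff_deriv).1 (hrs' n)).2
  have hloc : LocallyIntegrable (hat x₀ h) := (continuous_hat x₀ h).locallyIntegrable
  set φ : ℕ → ℝ → ℝ := fun n =>
    convolution (r n) (hat x₀ h) (ContinuousLinearMap.lsmul ℝ ℝ) volume with hφ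
  have hφd : ∀ n, deriv (φ n) =
      convolution (deriv (r n)) (hat x₀ h) (ContinuousLinearMap.lsmul ℝ ℝ) volume := fun n => by
    funext x
    exact ((hrc n).hasDerivAt_convolution_left _ ((hrs n).of_le (by simp)) hloc x).deriv
  have hφdd : ∀ n x, deriv (deriv (φ n)) x =
      (r n (x - x₀ + h) - 2 * r n (x - x₀) + r n (x - x₀ - h)) / h := fun n x => by
    rw [hφd, ((hrc n).deriv.hasDerivAt_convolution_left _ ((hrs' n).of_le (by simp)) hloc x).deriv,
      convolution_def, ← integral_deriv2_mul_hat (G'' := deriv (deriv (r n)))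
      (fun y => ((hrs n).differentiable (by simp) y).hasDerivAt)
      (fun y => ((hrs' n).differentiable (by simp) y).hasDerivAt) (hrs'' n).continuous hh]
    refine integral_congr_ae (Eventually.of_forall fun t => ?_)
    simp only [ContinuousLinearMap.lsmul_apply, smul_eq_mul, hat]
    rw [show x - t - x₀ = -(t - (x - x₀)) by ring, abs_neg]
  have hφc : ∀ n, HasCompactSupport (φ n) := fun n =>
    (hrc n).convolution _ (hasCompactSupport_hat hh x₀)
  refine ⟨φ, fun n => (hrc n).contDiff_convolution_left _ (hrs n) hloc, hφc, fun n x => ?_,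
    fun x => ?_, fun F hF M hM => ?_⟩
  · by_cases hx : x ∈ Icc (x₀ - (h + 1)) (x₀ + (h + 1))
    · rw [indicator_of_mem hx]
      have := (ρ n).dist_normed_convolution_le (μ := volume) (g := hat x₀ h) (x₀ := x) (ε := 1)
        hloc.aestronglyMeasurable fun y _ => by
          rw [Real.dist_eq, abs_le]
          constructor <;> linarith [hat_nonneg x₀ h x, hat_nonneg x₀ h y, hat_le_one hh x₀ x,
            hat_le_one hh x₀ y]
      rw [Real.dist_eq, abs_le] at this
      have h1 := hat_nonneg x₀ h x
      have h2 := hat_le_one hh x₀ x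
      rw [abs_le]
      exact ⟨by linarith [this.1], by linarith [this.2]⟩
    · rw [indicator_of_notMem hx]
      have hx' : h + 1 ≤ |x - x₀| := by
        rw [mem_Icc, not_and_or, not_le, not_le] at hx
        rw [le_abs]
        rcases hx with h' | h'
        · right; linarith
        · left; linarith
      have hx0 : hat x₀ h x = 0 := hat_eq_zero hh (by linarith)
      have : φ n x = hat x₀ h x := (ρ n).normed_convolution_eq_right fun y hy => by
        rw [Metric.mem_ball, Real.dist_eq] at hy
        rw [hx0]
        refine hat_eq_zero hh ?_
        have := abs_sub_le x y x₀
        rw [abs_sub_comm x y] at this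
        linarith [hr1 n]
      rw [this, hx0, abs_zero]
  · exact ContDiffBump.convolution_tendsto_right_of_continuous hr0 (continuous_hat x₀ h) x
  · have hri : ∀ n a, Integrable fun x => F x * r n (x - a) := fun n a =>
      (((hrs n).continuous.comp (continuous_id.sub continuous_const)).integrable_of_hasCompactSupport
        ((hrc n).comp_homeomorph (Homeomorph.subRight a))).bdd_mul hF.aestronglyMeasurable
        (Eventually.of_forall hM)
    have hconv : ∀ n a, ∫ x, F x * r n (x - a) =
        convolution (r n) F (ContinuousLinearMap.lsmul ℝ ℝ) volume a := fun n a => by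
      rw [convolution_eq_swap]
      refine integral_congr_ae (Eventually.of_forall fun t => ?_)
      simp only [ContinuousLinearMap.lsmul_apply, smul_eq_mul]
      rw [mul_comm, ← neg_sub a t, hr_def]
      simp only [ContDiffBump.normed_neg]
    have hsplit : ∀ n, ∫ x, F x * deriv (deriv (φ n)) x =
        ((∫ x, F x * r n (x - (x₀ - h))) - 2 * (∫ x, F x * r n (x - x₀))
          + ∫ x, F x * r n (x - (x₀ + h))) / h := fun n => by
      have h12 : Integrable fun x => F x * r n (x - (x₀ - h)) - 2 * (F x * r n (x - x₀)) :=
        (hri _ _).sub ((hri _ _).const_mul _)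
      rw [← integral_const_mul, ← integral_sub (hri _ _) ((hri _ _).const_mul _),
        ← integral_add h12 (hri _ _), ← integral_div]
      refine integral_congr_ae (Eventually.of_forall fun x => ?_)
      simp only [hφdd]
      rw [show x - (x₀ - h) = x - x₀ + h by ring, show x - (x₀ + h) = x - x₀ - h by ring]
      ring
    have hbd : ∀ n a, |∫ x, F x * r n (x - a)| ≤ 3 * M := fun n a => by
      rw [hconv]
      have := (ρ n).dist_normed_convolution_le (μ := volume) (g := F) (x₀ := a) (ε := 2 * M)
        hF.aestronglyMeasurable fun y _ => by
          rw [Real.dist_eq]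
          refine (abs_sub _ _).trans ?_
          linarith [hM y, hM a]
      rw [Real.dist_eq, abs_le] at this
      have h1 := abs_le.1 (hM a)
      rw [abs_le]
      exact ⟨by linarith [this.1, h1.1], by linarith [this.2, h1.2]⟩
    have hlim : ∀ a, Tendsto (fun n => ∫ x, F x * r n (x - a)) atTop (nhds (F a)) := fun a => by
      simp only [hconv]
      exact ContDiffBump.convolution_tendsto_right_of_continuous hr0 hF a
    refine ⟨fun n => ?_, ?_⟩
    · rw [hsplit, abs_div, abs_of_pos hh]
      refine div_le_div_of_nonneg_right ?_ hh.le
      have h1 := abs_le.1 (hbd n (x₀ - h))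
      have h2 := abs_le.1 (hbd n x₀)
      have h3 := abs_le.1 (hbd n (x₀ + h))
      rw [abs_le]
      exact ⟨by linarith [h1.1, h2.2, h3.1], by linarith [h1.2, h2.1, h3.2]⟩
    · simp only [hsplit]
      have := (((hlim (x₀ - h)).sub ((hlim x₀).const_mul 2)).add (hlim (x₀ + h))).div_const h
      convert this using 2
      ring

/-! ### Bounded evolutions tested against hats -/

/-- `U` is a nonnegative weak solution of `U_t = (U^m)_xx + g(x,U)` on `[0,T]` bounded by `M`,
tested against hats. -/
structure Evol (m : ℝ) (g : ℝ → ℝ → ℝ) (T M : ℝ) (U : ℝ → ℝ → ℝ) : Prop where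
  cont : ContinuousOn (fun q : ℝ × ℝ => U q.1 q.2) (univ ×ˢ Ioc 0 T)
  meas_zero : Measurable fun x => U x 0
  mem_Icc : ∀ x, ∀ t ∈ Icc 0 T, U x t ∈ Icc 0 M
  balance : ∀ s t, 0 ≤ s → s ≤ t → t ≤ T → ∀ x₀ h, 0 < h →
    ∫ x, U x t * hat x₀ h x = (∫ x, U x s * hat x₀ h x)
      + (∫ r in s..t, ∫ x, g x (U x r) * hat x₀ h x)
      + ((∫ r in s..t, U (x₀ + h) r ^ m) - 2 * (∫ r in s..t, U x₀ r ^ m)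
        + ∫ r in s..t, U (x₀ - h) r ^ m) / h

lemma intervalIntegrable_of_bdd_continuousOn {F : ℝ → ℝ} {T C s t : ℝ}
    (hF : ContinuousOn F (Ioc 0 T)) (hC : ∀ r ∈ Ioc 0 T, |F r| ≤ C) (hs : 0 ≤ s) (hst : s ≤ t)
    (ht : t ≤ T) : IntervalIntegrable F volume s t := by
  rw [intervalIntegrable_iff_integrableOn_Ioc_of_le hst]
  have hsub : Ioc s t ⊆ Ioc 0 T := Ioc_subset_Ioc hs ht
  refine Integrable.of_bound ((hF.mono hsub).aestronglyMeasurable measurableSet_Ioc) C ?_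
  exact (ae_restrict_iff' measurableSet_Ioc).2 (Eventually.of_forall fun r hr => hC r (hsub hr))

lemma exists_rpow_lipschitz {m : ℝ} (hm : 1 ≤ m) (M : ℝ) :
    ∃ A ≥ 0, ∀ u ∈ Icc 0 M, ∀ v ∈ Icc 0 M, |u ^ m - v ^ m| ≤ A * |u - v| := by
  have h1 : LocallyLipschitz fun x : ℝ => x ^ m :=
    (Real.contDiff_rpow_const_of_le (n := 1) (by simpa using hm)).locallyLipschitz
  obtain ⟨A, hA⟩ := (h1.locallyLipschitzOn (s := Icc 0 M)).exists_lipschitzOnWith_of_compact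
    isCompact_Icc
  refine ⟨A, A.2, fun u hu v hv => ?_⟩
  have := hA.dist_le_mul u hu v hv
  rwa [Real.dist_eq, Real.dist_eq] at this

lemma rpow_sub_mul_sub_nonneg {m u v : ℝ} (hm : 0 ≤ m) (hu : 0 ≤ u) (hv : 0 ≤ v) :
    0 ≤ (u ^ m - v ^ m) * (u - v) := by
  rcases le_total u v with h | h
  · exact mul_nonneg_of_nonpos_of_nonpos (sub_nonpos.2 (Real.rpow_le_rpow hu h hm))
      (sub_nonpos.2 h)
  · exact mul_nonneg (sub_nonneg.2 (Real.rpow_le_rpow hv h hm)) (sub_nonneg.2 h)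

namespace Evol

variable {m T M K : ℝ} {g : ℝ → ℝ → ℝ} {U V : ℝ → ℝ → ℝ}

lemma cont_rpow (E : Evol m g T M U) (hm : 0 ≤ m) :
    ContinuousOn (fun q : ℝ × ℝ => U q.1 q.2 ^ m) (univ ×ˢ Ioc 0 T) :=
  E.cont.rpow_const fun _ _ => Or.inr hm

lemma cont_react (E : Evol m g T M U) (hg : Continuous (Function.uncurry g)) :
    ContinuousOn (fun q : ℝ × ℝ => g q.1 (U q.1 q.2)) (univ ×ˢ Ioc 0 T) :=
  hg.comp_continuousOn (continuousOn_fst.prodMk E.cont)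

lemma measurable_slice (E : Evol m g T M U) {t : ℝ} (ht : t ∈ Icc 0 T) :
    Measurable fun x => U x t := by
  rcases ht.1.eq_or_lt with h | h
  · rw [← h]; exact E.meas_zero
  · exact (continuous_slice E.cont ⟨h, ht.2⟩).measurable

lemma rpow_mem (E : Evol m g T M U) (hm : 0 ≤ m) (x : ℝ) {t : ℝ} (ht : t ∈ Icc 0 T) :
    U x t ^ m ∈ Icc 0 (M ^ m) :=
  ⟨Real.rpow_nonneg (E.mem_Icc x t ht).1 _,
    Real.rpow_le_rpow (E.mem_Icc x t ht).1 (E.mem_Icc x t ht).2 hm⟩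

lemma abs_react_le (E : Evol m g T M U) (hg0 : ∀ x, g x 0 = 0)
    (hgK : ∀ x, ∀ u ∈ Icc 0 M, ∀ v ∈ Icc 0 M, |g x u - g x v| ≤ K * |u - v|) (hK : 0 ≤ K)
    (x : ℝ) {t : ℝ} (ht : t ∈ Icc 0 T) : |g x (U x t)| ≤ K * M := by
  have hU := E.mem_Icc x t ht
  have := hgK x (U x t) hU 0 ⟨le_rfl, hU.1.trans hU.2⟩
  rw [hg0, sub_zero, sub_zero, abs_of_nonneg hU.1] at this
  exact this.trans (mul_le_mul_of_nonneg_left hU.2 hK)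

lemma intervalIntegrable_react (E : Evol m g T M U) (hg : Continuous (Function.uncurry g))
    (hg0 : ∀ x, g x 0 = 0)
    (hgK : ∀ x, ∀ u ∈ Icc 0 M, ∀ v ∈ Icc 0 M, |g x u - g x v| ≤ K * |u - v|) (hK : 0 ≤ K)
    {s t : ℝ} (hs : 0 ≤ s) (hst : s ≤ t) (ht : t ≤ T) (x₀ : ℝ) {h : ℝ} (hh : 0 < h) :
    IntervalIntegrable (fun r => ∫ x, g x (U x r) * hat x₀ h x) volume s t :=
  intervalIntegrable_of_bdd_continuousOn
    (continuousOn_integral_mul (F := fun x r => g x (U x r)) (E.cont_react hg)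
      (fun x _ hr => E.abs_react_le hg0 hgK hK x (Ioc_subset_Icc_self hr)) (integrable_hat hh x₀))
    (fun _ hr => abs_integral_mul_hat_le hh x₀ fun x =>
      E.abs_react_le hg0 hgK hK x (Ioc_subset_Icc_self hr)) hs hst ht

lemma intervalIntegrable_rpow (E : Evol m g T M U) (hm : 0 ≤ m) {s t : ℝ} (hs : 0 ≤ s)
    (hst : s ≤ t) (ht : t ≤ T) (x : ℝ) : IntervalIntegrable (fun r => U x r ^ m) volume s t :=
  intervalIntegrable_of_bdd_continuousOn (continuousOn_slice (F := fun x r => U x r ^ m)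
    (E.cont_rpow hm) x) (C := M ^ m) (fun r hr => by
      have := E.rpow_mem hm x (Ioc_subset_Icc_self hr)
      rw [abs_of_nonneg this.1]
      exact this.2) hs hst ht

lemma exists_diffSys (E : Evol m g T M U) (E' : Evol m g T M V) (hm : 1 ≤ m)
    (hM : 0 ≤ M) (hg : Continuous (Function.uncurry g)) (hg0 : ∀ x, g x 0 = 0)
    (hgK : ∀ x, ∀ u ∈ Icc 0 M, ∀ v ∈ Icc 0 M, |g x u - g x v| ≤ K * |u - v|) (hK : 0 ≤ K) :
    ∃ A M' : ℝ, 0 ≤ A ∧ 0 < M' ∧ DiffSys T A K M' (fun x t => U x t - V x t)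
      (fun x t => U x t ^ m - V x t ^ m) (fun x t => g x (U x t) - g x (V x t)) := by
  have hm0 : 0 ≤ m := by linarith
  obtain ⟨A, hA, hAL⟩ := exists_rpow_lipschitz hm M
  have hw : ∀ x, ∀ t ∈ Icc 0 T, |U x t - V x t| ≤ M := fun x t ht => by
    have h1 := E.mem_Icc x t ht
    have h2 := E'.mem_Icc x t ht
    rw [abs_le]; exact ⟨by linarith [h1.1, h2.2], by linarith [h1.2, h2.1]⟩
  have hz : ∀ x, ∀ t ∈ Icc 0 T, |U x t ^ m - V x t ^ m| ≤ A * |U x t - V x t| :=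
    fun x t ht => hAL _ (E.mem_Icc x t ht) _ (E'.mem_Icc x t ht)
  have hH : ∀ x, ∀ t ∈ Icc 0 T, |g x (U x t) - g x (V x t)| ≤ K * |U x t - V x t| :=
    fun x t ht => hgK x _ (E.mem_Icc x t ht) _ (E'.mem_Icc x t ht)
  have hM' : M ≤ (1 + A + K) * M + 1 := by nlinarith [mul_nonneg hA hM, mul_nonneg hK hM]
  have hAM : A * M ≤ (1 + A + K) * M + 1 := by nlinarith [mul_nonneg hA hM, mul_nonneg hK hM]
  have hKM : K * M ≤ (1 + A + K) * M + 1 := by nlinarith [mul_nonneg hA hM, mul_nonneg hK hM]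
  refine ⟨A, (1 + A + K) * M + 1, hA, by positivity, ?_⟩
  refine
    { cont_w := E.cont.sub E'.cont
      cont_z := (E.cont_rpow hm0).sub (E'.cont_rpow hm0)
      cont_H := (E.cont_react hg).sub (E'.cont_react hg)
      meas_zero := E.meas_zero.sub E'.meas_zero
      abs_w_le := fun x t ht => (hw x t ht).trans hM'
      abs_z_le := fun x t ht => ((hz x t ht).trans
        (mul_le_mul_of_nonneg_left (hw x t ht) hA)).trans hAM
      abs_H_le := fun x t ht => ((hH x t ht).trans
        (mul_le_mul_of_nonneg_left (hw x t ht) hK)).trans hKM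
      z_le := hz
      z_mul_nonneg := fun x t ht =>
        rpow_sub_mul_sub_nonneg hm0 (E.mem_Icc x t ht).1 (E'.mem_Icc x t ht).1
      H_le := hH
      balance := fun s t hs hst ht x₀ h hh => ?_ }
  have hiU : ∀ r ∈ Icc 0 T, Integrable fun x => U x r * hat x₀ h x := fun r hr =>
    integrable_mul_hat hh x₀ (E.measurable_slice hr) (M := M) fun x => by
      have := E.mem_Icc x r hr
      rw [abs_of_nonneg this.1]; exact this.2
  have hiV : ∀ r ∈ Icc 0 T, Integrable fun x => V x r * hat x₀ h x := fun r hr =>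
    integrable_mul_hat hh x₀ (E'.measurable_slice hr) (M := M) fun x => by
      have := E'.mem_Icc x r hr
      rw [abs_of_nonneg this.1]; exact this.2
  have hd : ∀ r ∈ Icc 0 T, ∫ x, (U x r - V x r) * hat x₀ h x =
      (∫ x, U x r * hat x₀ h x) - ∫ x, V x r * hat x₀ h x := fun r hr => by
    simp only [sub_mul]
    exact integral_sub (hiU r hr) (hiV r hr)
  have hz' : ∀ y, ∫ r in s..t, (U y r ^ m - V y r ^ m) =
      (∫ r in s..t, U y r ^ m) - ∫ r in s..t, V y r ^ m := fun y =>
    intervalIntegral.integral_sub (E.intervalIntegrable_rpow hm0 hs hst ht y)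
      (E'.intervalIntegrable_rpow hm0 hs hst ht y)
  have hH' : ∫ r in s..t, ∫ x, (g x (U x r) - g x (V x r)) * hat x₀ h x =
      (∫ r in s..t, ∫ x, g x (U x r) * hat x₀ h x) - ∫ r in s..t, ∫ x, g x (V x r) * hat x₀ h x := by
    rw [← intervalIntegral.integral_sub (E.intervalIntegrable_react hg hg0 hgK hK hs hst ht x₀ hh)
      (E'.intervalIntegrable_react hg hg0 hgK hK hs hst ht x₀ hh)]
    rw [intervalIntegral.integral_of_le hst, intervalIntegral.integral_of_le hst]
    refine setIntegral_congr_fun measurableSet_Ioc fun r hr => ?_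
    have hr' : r ∈ Ioc 0 T := Ioc_subset_Ioc hs ht hr
    have hr'' := Ioc_subset_Icc_self hr'
    simp only [sub_mul]
    exact integral_sub
      (integrable_mul_hat hh x₀ (continuous_slice (F := fun x r => g x (U x r))
        (E.cont_react hg) hr').measurable fun x => E.abs_react_le hg0 hgK hK x hr'')
      (integrable_mul_hat hh x₀ (continuous_slice (F := fun x r => g x (V x r))
        (E'.cont_react hg) hr').measurable fun x => E'.abs_react_le hg0 hgK hK x hr'')
  rw [hd t ⟨hs.trans hst, ht⟩, hd s ⟨hs, hst.trans ht⟩, hz', hz', hz', hH',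
    E.balance s t hs hst ht x₀ h hh, E'.balance s t hs hst ht x₀ h hh]
  ring

/-- Translating an evolution by a period of the reaction term and forward in time. -/
lemma shift (E : Evol m g T M U) {ξ s : ℝ} (hξ : ∀ x u, g (x + ξ) u = g x u) (hs : 0 ≤ s)
    {T' : ℝ} (hT' : 0 ≤ T') (hsT : T' + s ≤ T) :
    Evol m g T' M fun x t => U (x + ξ) (t + s) where
  cont := E.cont.comp (f := fun q : ℝ × ℝ => (q.1 + ξ, q.2 + s)) (by fun_prop) fun q hq =>
    ⟨mem_univ _, by
      have := hq.2
      exact ⟨by linarith [this.1], by linarith [this.2]⟩⟩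
  meas_zero := (E.measurable_slice ⟨by linarith, by linarith⟩).comp (measurable_add_const ξ)
  mem_Icc x t ht := E.mem_Icc _ _ ⟨by linarith [ht.1], by linarith [ht.2]⟩
  balance a t ha hat' ht x₀ h hh := by
    have e : ∀ y, hat x₀ h y = hat (x₀ + ξ) h (y + ξ) := fun y => by simp [hat]
    have e1 : ∀ r, ∫ x, U (x + ξ) r * hat x₀ h x = ∫ x, U x r * hat (x₀ + ξ) h x := fun r => by
      simp only [e]
      exact integral_add_right_eq_self (fun x => U x r * hat (x₀ + ξ) h x) ξ
    have e2 : ∀ r, ∫ x, g x (U (x + ξ) r) * hat x₀ h x =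
        ∫ x, g x (U x r) * hat (x₀ + ξ) h x := fun r => by
      simp only [e]
      rw [← integral_add_right_eq_self (fun x => g x (U x r) * hat (x₀ + ξ) h x) ξ]
      simp only [hξ]
    have := E.balance (a + s) (t + s) (by linarith) (by linarith) (by linarith) (x₀ + ξ) h hh
    simp only [e1, e2]
    rw [this, intervalIntegral.integral_comp_add_right
        (fun r => ∫ x, g x (U x r) * hat (x₀ + ξ) h x),
      intervalIntegral.integral_comp_add_right (fun r => U (x₀ + h + ξ) r ^ m),
      intervalIntegral.integral_comp_add_right (fun r => U (x₀ + ξ) r ^ m),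
      intervalIntegral.integral_comp_add_right (fun r => U (x₀ - h + ξ) r ^ m),
      add_right_comm x₀ ξ h, sub_add_eq_add_sub x₀ h ξ]

/-- A positive stationary solution is an evolution. -/
lemma stationary {p : ℝ → ℝ} (hp : ContDiff ℝ 2 p) (hp0 : ∀ x, 0 < p x) (hpM : ∀ x, p x ≤ M)
    (heq : ∀ x, deriv (deriv fun y => p y ^ m) x + g x (p x) = 0) :
    Evol m g T M fun x _ => p x where
  cont := (hp.continuous.comp continuous_fst).continuousOn
  meas_zero := hp.continuous.measurable
  mem_Icc x _ _ := ⟨(hp0 x).le, hpM x⟩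
  balance s t _ _ _ x₀ h hh := by
    have hG : ContDiff ℝ 2 fun y => p y ^ m := hp.rpow_const_of_ne fun x => (hp0 x).ne'
    have hG' : ContDiff ℝ 1 (deriv fun y => p y ^ m) :=
      ((contDiff_succ_iff_deriv (n := 1)).1 hG).2.2
    have e := integral_deriv2_mul_hat (fun x => (hG.differentiable (by simp) x).hasDerivAt)
      (fun x => (hG'.differentiable (by simp) x).hasDerivAt)
      (hG'.continuous_deriv le_rfl) hh x₀
    have e2 : ∀ x, deriv (deriv fun y => p y ^ m) x = -g x (p x) := fun x => by linarith [heq x]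
    simp only [e2, neg_mul, integral_neg] at e
    simp only [intervalIntegral.integral_const, smul_eq_mul]
    have e3 : (t - s) * p (x₀ + h) ^ m - 2 * ((t - s) * p x₀ ^ m) + (t - s) * p (x₀ - h) ^ m
        = (t - s) * (p (x₀ + h) ^ m - 2 * p x₀ ^ m + p (x₀ - h) ^ m) := by ring
    rw [e3, mul_div_assoc, ← e]
    ring

end Evol

/-! ### Very weak solutions are evolutions -/

lemma VeryWeakSol.integral_test {m τ : ℝ} {f : ℝ → ℝ → ℝ} {κ u₀ : ℝ → ℝ} {u : ℝ → ℝ → ℝ}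
    (hu : VeryWeakSol m f κ τ u₀ u) (hτ : 0 < τ) {φ : ℝ → ℝ} (hφ : ContDiff ℝ (⊤ : ℕ∞) φ)
    (hφc : HasCompactSupport φ) :
    ∫ x, u x τ * φ x = (∫ x, u₀ x * φ x)
      + (∫ t in Ioo (0 : ℝ) τ, ∫ x, f x (u x t) * (κ x - u x t) * φ x)
      + ∫ t in Ioo (0 : ℝ) τ, ∫ x, u x t ^ m * deriv (deriv φ) x := by
  set χ : ContDiffBump (0 : ℝ) := ⟨τ + 1, τ + 2, by linarith, by linarith⟩ with hχ
  have hχ1 : ∀ t ∈ Icc 0 τ, χ t = 1 := fun t ht => χ.one_of_mem_closedBall (by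
    rw [Metric.mem_closedBall, Real.dist_eq, sub_zero, abs_of_nonneg ht.1]
    show t ≤ τ + 1
    linarith [ht.2])
  have hχ' : ∀ t ∈ Ioo 0 τ, deriv (fun s => χ s) t = 0 := fun t ht => by
    have : (fun s => χ s) =ᶠ[nhds t] fun _ => (1 : ℝ) := by
      filter_upwards [Ioo_mem_nhds ht.1 ht.2] with s hs
      exact hχ1 s (Ioo_subset_Icc_self hs)
    rw [this.deriv_eq, deriv_const]
  have h := hu.2.2 (fun x t => φ x * χ t) ((hφ.comp contDiff_fst).mul
    ((χ.contDiff).comp contDiff_snd)) (by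
      refine HasCompactSupport.of_support_subset_isCompact (hφc.isCompact.prod
        χ.hasCompactSupport.isCompact) fun q hq => ⟨subset_tsupport _ ?_, subset_tsupport _ ?_⟩
      · exact left_ne_zero_of_mul hq
      · exact right_ne_zero_of_mul hq)
  simp only [hχ1 τ ⟨hτ.le, le_rfl⟩, hχ1 0 ⟨le_rfl, hτ.le⟩, mul_one] at h
  rw [h]
  refine congrArg₂ (· + ·) (congrArg₂ (· + ·) rfl ?_) ?_
  · refine setIntegral_congr_fun measurableSet_Ioo fun t ht => ?_
    simp only [hχ1 t (Ioo_subset_Icc_self ht), mul_one]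
  · refine setIntegral_congr_fun measurableSet_Ioo fun t ht => ?_
    simp only [hχ1 t (Ioo_subset_Icc_self ht), mul_one]
    refine integral_congr_ae (Eventually.of_forall fun x => ?_)
    simp only [deriv_const_mul_field, hχ' t ht, mul_zero, zero_add]

lemma tendsto_integral_mul_of_le_indicator {F hb : ℝ → ℝ} {φ : ℕ → ℝ → ℝ} {M a b : ℝ}
    (hF : Measurable F) (hM : ∀ x, |F x| ≤ M) (hφ : ∀ n, Continuous (φ n))
    (hφb : ∀ n x, |φ n x| ≤ indicator (Icc a b) (fun _ => 2) x)
    (hlim : ∀ x, Tendsto (fun n => φ n x) atTop (nhds (hb x))) :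
    Tendsto (fun n => ∫ x, F x * φ n x) atTop (nhds (∫ x, F x * hb x)) ∧
      ∀ n, |∫ x, F x * φ n x| ≤ ∫ x, M * indicator (Icc a b) (fun _ => (2 : ℝ)) x := by
  have hi : Integrable fun x => M * indicator (Icc a b) (fun _ => (2 : ℝ)) x :=
    ((integrable_indicator_iff measurableSet_Icc).2 (integrableOn_const
      (by simp))).const_mul M
  have hle : ∀ n x, ‖F x * φ n x‖ ≤ M * indicator (Icc a b) (fun _ => (2 : ℝ)) x := fun n x => by
    rw [norm_mul]
    exact mul_le_mul (hM x) (hφb n x) (norm_nonneg _) ((abs_nonneg _).trans (hM x))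
  exact ⟨tendsto_integral_of_dominated_convergence _
    (fun n => hF.aestronglyMeasurable.mul (hφ n).aestronglyMeasurable) hi
    (fun n => Eventually.of_forall (hle n))
    (Eventually.of_forall fun x => (hlim x).const_mul _),
    fun n => norm_integral_le_of_norm_le hi (Eventually.of_forall (hle n))⟩

lemma VeryWeakSol.integral_hat {m τ C : ℝ} {f : ℝ → ℝ → ℝ} {κ u₀ : ℝ → ℝ} {u : ℝ → ℝ → ℝ}
    (hu : VeryWeakSol m f κ τ u₀ u) (hτ : 0 < τ) (hm : 0 ≤ m)
    (hu₀ : Measurable u₀) (hu₀C : ∀ x, |u₀ x| ≤ C)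
    (hg : Continuous (Function.uncurry fun x v => f x v * (κ x - v)))
    (huC : ∀ x, ∀ t ∈ Ioc 0 τ, |u x t| ≤ C) (hmC : ∀ x, ∀ t ∈ Ioc 0 τ, |u x t ^ m| ≤ C)
    (hgC : ∀ x, ∀ t ∈ Ioc 0 τ, |f x (u x t) * (κ x - u x t)| ≤ C)
    (x₀ : ℝ) {h : ℝ} (hh : 0 < h) :
    ∫ x, u x τ * hat x₀ h x = (∫ x, u₀ x * hat x₀ h x)
      + (∫ t in Ioo (0 : ℝ) τ, ∫ x, f x (u x t) * (κ x - u x t) * hat x₀ h x)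
      + ∫ t in Ioo (0 : ℝ) τ, (u (x₀ + h) t ^ m - 2 * u x₀ t ^ m + u (x₀ - h) t ^ m) / h := by
  obtain ⟨φ, hφs, hφc, hφb, hφl, hφd⟩ := exists_smooth_hat hh x₀
  have hcg : ContinuousOn (fun q : ℝ × ℝ => f q.1 (u q.1 q.2) * (κ q.1 - u q.1 q.2))
      (univ ×ˢ Ioc 0 τ) := hg.comp_continuousOn (continuousOn_fst.prodMk hu.1)
  have hcm : ContinuousOn (fun q : ℝ × ℝ => u q.1 q.2 ^ m) (univ ×ˢ Ioc 0 τ) :=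
    hu.1.rpow_const fun _ _ => Or.inr hm
  have hττ : τ ∈ Ioc 0 τ := ⟨hτ, le_rfl⟩
  have hfin : IsFiniteMeasure (volume.restrict (Ioo 0 τ)) := ⟨by simp⟩
  have l1 := (tendsto_integral_mul_of_le_indicator (continuous_slice hu.1 hττ).measurable
    (fun x => huC x τ hττ) (fun n => (hφs n).continuous) hφb hφl).1
  have l2 := (tendsto_integral_mul_of_le_indicator hu₀ hu₀C
    (fun n => (hφs n).continuous) hφb hφl).1
  have l3' : ∀ t ∈ Ioo 0 τ, _ := fun t ht => tendsto_integral_mul_of_le_indicator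
    (continuous_slice (F := fun x t => f x (u x t) * (κ x - u x t)) hcg
      (Ioo_subset_Ioc_self ht)).measurable
    (fun x => hgC x t (Ioo_subset_Ioc_self ht)) (fun n => (hφs n).continuous) hφb hφl
  have l4' : ∀ t ∈ Ioo 0 τ, _ := fun t ht => hφd (fun x => u x t ^ m)
    (continuous_slice (F := fun x t => u x t ^ m) hcm (Ioo_subset_Ioc_self ht)) C
    fun x => hmC x t (Ioo_subset_Ioc_self ht)
  have l3 := tendsto_integral_of_dominated_convergence (μ := volume.restrict (Ioo 0 τ))
    (F := fun n t => ∫ x, f x (u x t) * (κ x - u x t) * φ n x)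
    (f := fun t => ∫ x, f x (u x t) * (κ x - u x t) * hat x₀ h x)
    (fun _ => ∫ x, C * indicator (Icc (x₀ - (h + 1)) (x₀ + (h + 1))) (fun _ => (2 : ℝ)) x)
    (fun n => ((continuousOn_integral_mul (F := fun x t => f x (u x t) * (κ x - u x t)) hcg hgC
      ((hφs n).continuous.integrable_of_hasCompactSupport (hφc n))).mono
      Ioo_subset_Ioc_self).aestronglyMeasurable measurableSet_Ioo) (integrable_const _)
    (fun n => (ae_restrict_iff' measurableSet_Ioo).2 (Eventually.of_forall fun t ht =>
      (l3' t ht).2 n))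
    ((ae_restrict_iff' measurableSet_Ioo).2 (Eventually.of_forall fun t ht => (l3' t ht).1))
  have l4 := tendsto_integral_of_dominated_convergence (μ := volume.restrict (Ioo 0 τ))
    (F := fun n t => ∫ x, u x t ^ m * deriv (deriv (φ n)) x)
    (f := fun t => (u (x₀ + h) t ^ m - 2 * u x₀ t ^ m + u (x₀ - h) t ^ m) / h)
    (fun _ => 12 * C / h)
    (fun n => ((continuousOn_integral_mul (F := fun x t => u x t ^ m) hcm hmC
      (((contDiff_infty_iff_deriv.1 (contDiff_infty_iff_deriv.1
        (hφs n)).2).2.continuous).integrable_of_hasCompactSupport (hφc n).deriv.deriv)).mono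
      Ioo_subset_Ioc_self).aestronglyMeasurable measurableSet_Ioo) (integrable_const _)
    (fun n => (ae_restrict_iff' measurableSet_Ioo).2 (Eventually.of_forall fun t ht =>
      (l4' t ht).1 n))
    ((ae_restrict_iff' measurableSet_Ioo).2 (Eventually.of_forall fun t ht => (l4' t ht).2))
  refine tendsto_nhds_unique l1 (((l2.add l3).add l4).congr fun n => ?_)
  exact (hu.integral_test hτ (hφs n) (hφc n)).symm

/-- A global very weak solution with values in `[0, M]` is an evolution once its initial data are
included. -/
lemma GlobalVeryWeakSol.evol {m T M K : ℝ} {f : ℝ → ℝ → ℝ} {κ u₀ : ℝ → ℝ} {u : ℝ → ℝ → ℝ}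
    (hu : GlobalVeryWeakSol m f κ u₀ u) (hT : 0 < T) (hm : 0 ≤ m)
    (hu₀ : Measurable u₀) (hu₀M : ∀ x, u₀ x ∈ Icc 0 M)
    (hg : Continuous (Function.uncurry fun x v => f x v * (κ x - v)))
    (huM : ∀ x, ∀ t ∈ Ioc 0 T, u x t ∈ Icc 0 M)
    (hgK : ∀ x, ∀ v ∈ Icc 0 M, |f x v * (κ x - v)| ≤ K) :
    Evol m (fun x v => f x v * (κ x - v)) T M fun x t => if t ≤ 0 then u₀ x else u x t := by
  set U : ℝ → ℝ → ℝ := fun x t => if t ≤ 0 then u₀ x else u x t with hU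
  have hpos : ∀ x t, 0 < t → U x t = u x t := fun x t ht => if_neg (not_le.2 ht)
  have hzero : ∀ x, U x 0 = u₀ x := fun x => if_pos le_rfl
  have hmem : ∀ x, ∀ t ∈ Icc 0 T, U x t ∈ Icc 0 M := fun x t ht => by
    rcases ht.1.eq_or_lt with h | h
    · rw [← h, hzero]; exact hu₀M x
    · rw [hpos x t h]; exact huM x t ⟨h, ht.2⟩
  have hcont : ContinuousOn (fun q : ℝ × ℝ => U q.1 q.2) (univ ×ˢ Ioc 0 T) :=
    (hu T hT).1.congr fun q hq => hpos q.1 q.2 hq.2.1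
  have hcg : ContinuousOn (fun q : ℝ × ℝ => f q.1 (U q.1 q.2) * (κ q.1 - U q.1 q.2))
      (univ ×ˢ Ioc 0 T) := hg.comp_continuousOn (continuousOn_fst.prodMk hcont)
  have hcm : ContinuousOn (fun q : ℝ × ℝ => U q.1 q.2 ^ m) (univ ×ˢ Ioc 0 T) :=
    hcont.rpow_const fun _ _ => Or.inr hm
  have hrpow : ∀ v ∈ Icc 0 M, |v ^ m| ≤ M ^ m := fun v hv => by
    rw [abs_of_nonneg (Real.rpow_nonneg hv.1 _)]
    exact Real.rpow_le_rpow hv.1 hv.2 hm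
  have iz : ∀ y s t, 0 ≤ s → s ≤ t → t ≤ T →
      IntervalIntegrable (fun r => U y r ^ m) volume s t := fun y s t hs hst ht =>
    intervalIntegrable_of_bdd_continuousOn (continuousOn_slice (F := fun x r => U x r ^ m) hcm y)
      (fun r hr => hrpow _ (hmem y r (Ioc_subset_Icc_self hr))) hs hst ht
  have ig : ∀ x₀ h, 0 < h → ∀ s t, 0 ≤ s → s ≤ t → t ≤ T →
      IntervalIntegrable (fun r => ∫ x, f x (U x r) * (κ x - U x r) * hat x₀ h x) volume s t :=
    fun x₀ h hh s t hs hst ht => intervalIntegrable_of_bdd_continuousOn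
      (continuousOn_integral_mul (F := fun x r => f x (U x r) * (κ x - U x r)) hcg
        (fun x r hr => hgK x _ (hmem x r (Ioc_subset_Icc_self hr))) (integrable_hat hh x₀))
      (fun r hr => abs_integral_mul_hat_le hh x₀ fun x =>
        hgK x _ (hmem x r (Ioc_subset_Icc_self hr))) hs hst ht
  have key : ∀ t, 0 ≤ t → t ≤ T → ∀ x₀ h, 0 < h →
      ∫ x, U x t * hat x₀ h x = (∫ x, u₀ x * hat x₀ h x)
        + (∫ r in (0 : ℝ)..t, ∫ x, f x (U x r) * (κ x - U x r) * hat x₀ h x)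
        + ((∫ r in (0 : ℝ)..t, U (x₀ + h) r ^ m) - 2 * (∫ r in (0 : ℝ)..t, U x₀ r ^ m)
          + ∫ r in (0 : ℝ)..t, U (x₀ - h) r ^ m) / h := by
    intro t ht0 htT x₀ h hh
    rcases ht0.eq_or_lt with ht | ht
    · subst ht
      simp [hzero]
    have hsub : Ioc 0 t ⊆ Ioc 0 T := Ioc_subset_Ioc le_rfl htT
    set C := max M (max (M ^ m) K) with hC
    have hCM : ∀ v ∈ Icc 0 M, |v| ≤ C := fun v hv => by
      rw [abs_of_nonneg hv.1]; exact hv.2.trans (le_max_left _ _)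
    have e := (hu t ht).integral_hat (C := C) ht hm hu₀ (fun x => hCM _ (hu₀M x)) hg
      (fun x r hr => hCM _ (huM x r (hsub hr)))
      (fun x r hr => (hrpow _ (huM x r (hsub hr))).trans
        ((le_max_left _ _).trans (le_max_right _ _)))
      (fun x r hr => (hgK x _ (huM x r (hsub hr))).trans
        ((le_max_right _ _).trans (le_max_right _ _))) x₀ hh
    have e1 : ∫ r in Ioo (0 : ℝ) t, ∫ x, f x (u x r) * (κ x - u x r) * hat x₀ h x =
        ∫ r in (0 : ℝ)..t, ∫ x, f x (U x r) * (κ x - U x r) * hat x₀ h x := by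
      rw [intervalIntegral.integral_of_le ht0, integral_Ioc_eq_integral_Ioo]
      refine setIntegral_congr_fun measurableSet_Ioo fun r hr => ?_
      simp only [hpos _ r hr.1]
    have e2 : ∫ r in Ioo (0 : ℝ) t, (u (x₀ + h) r ^ m - 2 * u x₀ r ^ m + u (x₀ - h) r ^ m) / h =
        ((∫ r in (0 : ℝ)..t, U (x₀ + h) r ^ m) - 2 * (∫ r in (0 : ℝ)..t, U x₀ r ^ m)
          + ∫ r in (0 : ℝ)..t, U (x₀ - h) r ^ m) / h := by
      have i1 := iz (x₀ + h) 0 t le_rfl ht0 htT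
      have i2 := (iz x₀ 0 t le_rfl ht0 htT).const_mul 2
      have i3 := iz (x₀ - h) 0 t le_rfl ht0 htT
      rw [← intervalIntegral.integral_const_mul, ← intervalIntegral.integral_sub i1 i2,
        ← intervalIntegral.integral_add (i1.sub i2) i3, ← intervalIntegral.integral_div,
        intervalIntegral.integral_of_le ht0, integral_Ioc_eq_integral_Ioo]
      refine setIntegral_congr_fun measurableSet_Ioo fun r hr => ?_
      simp only [hpos _ r hr.1]
    simp only [hpos _ t ht]
    rw [e, e1, e2]
  refine
    { cont := hcont
      meas_zero := by simpa only [hzero] using hu₀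
      mem_Icc := hmem
      balance := fun s t hs hst ht x₀ h hh => ?_ }
  have a1 : ∀ y, ∫ r in s..t, U y r ^ m =
      (∫ r in (0 : ℝ)..t, U y r ^ m) - ∫ r in (0 : ℝ)..s, U y r ^ m := fun y =>
    (intervalIntegral.integral_interval_sub_left (iz y 0 t le_rfl (hs.trans hst) ht)
      (iz y 0 s le_rfl hs (hst.trans ht))).symm
  have a2 := (intervalIntegral.integral_interval_sub_left
    (ig x₀ h hh 0 t le_rfl (hs.trans hst) ht) (ig x₀ h hh 0 s le_rfl hs (hst.trans ht))).symm
  rw [key t (hs.trans hst) ht x₀ h hh, key s hs (hst.trans ht) x₀ h hh, a1, a1, a1, a2]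
  ring

/-! ### Comparison of evolutions -/

namespace Evol

variable {m T M K : ℝ} {g : ℝ → ℝ → ℝ} {U V : ℝ → ℝ → ℝ}

lemma le_of_le (E : Evol m g T M U) (E' : Evol m g T M V) (hT : 0 < T) (hm : 1 ≤ m)
    (hM : 0 ≤ M) (hg : Continuous (Function.uncurry g)) (hg0 : ∀ x, g x 0 = 0)
    (hgK : ∀ x, ∀ u ∈ Icc 0 M, ∀ v ∈ Icc 0 M, |g x u - g x v| ≤ K * |u - v|) (hK : 0 ≤ K)
    (h0 : ∀ x, U x 0 ≤ V x 0) (x : ℝ) : U x T ≤ V x T := by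
  obtain ⟨A, M', hA, hM', S⟩ := E.exists_diffSys E' hm hM hg hg0 hgK hK
  exact sub_nonpos.1 (S.nonpos_of_nonpos hT hA hK hM' (fun x => sub_nonpos.2 (h0 x)) x)

lemma le_of_lt_of_crossing (E : Evol m g T M U) (E' : Evol m g T M V) (hT : 0 < T) (hm : 1 ≤ m)
    (hM : 0 ≤ M) (hg : Continuous (Function.uncurry g)) (hg0 : ∀ x, g x 0 = 0)
    (hgK : ∀ x, ∀ u ∈ Icc 0 M, ∀ v ∈ Icc 0 M, |g x u - g x v| ≤ K * |u - v|) (hK : 0 ≤ K)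
    (h0 : ∀ x ≤ 0, U x 0 ≤ V x 0) (h0' : ∀ x > 0, V x 0 ≤ U x 0) {x₁ x₂ : ℝ} (hx : x₁ < x₂)
    (h₁ : V x₁ T < U x₁ T) : V x₂ T ≤ U x₂ T := by
  obtain ⟨A, M', hA, hM', S⟩ := E.exists_diffSys E' hm hM hg hg0 hgK hK
  exact sub_nonneg.1 (S.no_descent hT hA hK hM' (fun x hx => sub_nonpos.2 (h0 x hx))
    (fun x hx => sub_nonneg.2 (h0' x hx)) hx (sub_pos.2 h₁))

end Evol

lemma apply_fract_of_add_one {α : Type*} {F : ℝ → α} (hF : ∀ x, F (x + 1) = F x) (x : ℝ) :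
    F (Int.fract x) = F x := by
  have := (show Function.Periodic F 1 from hF).sub_int_mul_eq ⌊x⌋ (x := x)
  rwa [mul_one] at this

lemma exists_react_lipschitz {g : ℝ → ℝ → ℝ} (hg : ContDiff ℝ 1 (Function.uncurry g))
    (hper : ∀ x u, g (x + 1) u = g x u) (M : ℝ) :
    ∃ K ≥ 0, ∀ x, ∀ u ∈ Icc 0 M, ∀ v ∈ Icc 0 M, |g x u - g x v| ≤ K * |u - v| := by
  obtain ⟨K, hK⟩ := (hg.locallyLipschitz.locallyLipschitzOn
    (s := Icc (0 : ℝ) 1 ×ˢ Icc 0 M)).exists_lipschitzOnWith_of_compact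
    (isCompact_Icc.prod isCompact_Icc)
  refine ⟨K, K.2, fun x u hu v hv => ?_⟩
  have hx : Int.fract x ∈ Icc (0 : ℝ) 1 := ⟨Int.fract_nonneg x, (Int.fract_lt_one x).le⟩
  have := hK.dist_le_mul (Int.fract x, u) ⟨hx, hu⟩ (Int.fract x, v) ⟨hx, hv⟩
  have e : ∀ w, g (Int.fract x) w = g x w := fun w =>
    apply_fract_of_add_one (F := fun x => g x w) (fun x => hper x w) x
  rwa [Real.dist_eq, Prod.dist_eq, dist_self, Real.dist_eq, max_eq_right (abs_nonneg _),
    Function.uncurry_apply_pair, Function.uncurry_apply_pair, e, e] at this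

lemma exists_neg_pos_of_deriv_pos {D : ℝ → ℝ} {t₀ : ℝ} (ht₀ : 0 < t₀) (h0 : D t₀ = 0)
    (hD : 0 < deriv D t₀) : (∃ t, 0 < t ∧ t < t₀ ∧ D t < 0) ∧ ∃ t, t₀ < t ∧ 0 < D t := by
  have hev := eventually_nhdsWithin_sign_eq_of_deriv_pos hD h0
  rw [Metric.eventually_nhds_iff] at hev
  obtain ⟨e, he, h⟩ := hev
  constructor
  · have hm : 0 < min (e / 2) (t₀ / 2) := by positivity
    have hle := min_le_left (e / 2) (t₀ / 2)
    have hle' := min_le_right (e / 2) (t₀ / 2)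
    refine ⟨t₀ - min (e / 2) (t₀ / 2), by linarith, by linarith, ?_⟩
    have := h (y := t₀ - min (e / 2) (t₀ / 2))
      (by rw [Real.dist_eq, sub_sub_cancel_left, abs_neg, abs_of_pos hm]; linarith)
    rw [sign_neg (by linarith : t₀ - min (e / 2) (t₀ / 2) - t₀ < 0)] at this
    exact sign_eq_neg_one_iff.1 this
  · refine ⟨t₀ + e / 2, by linarith, ?_⟩
    have := h (y := t₀ + e / 2)
      (by rw [Real.dist_eq, add_sub_cancel_left, abs_of_pos (by positivity)]; linarith)
    rw [sign_pos (by linarith : 0 < t₀ + e / 2 - t₀)] at this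
    exact sign_eq_one_iff.1 this

/-- If the unit space translate, delayed by `s`, of the free boundary is behind at time `t₁`, then
it cannot be ahead at a later time. -/
lemma RenormSetting.not_overtake {m : ℝ} (hm : 1 < m) {f : ℝ → ℝ → ℝ} {κ : ℝ → ℝ} {θ c₀ l₀ : ℝ}
    {φ₀ p : ℝ → ℝ} {u : ℝ → ℝ → ℝ} {b ty : ℝ → ℝ}
    (hset : RenormSetting m f κ θ c₀ l₀ φ₀ p u b ty) {s t₁ t₂ : ℝ} (hs : 0 < s) (ht₁ : 0 < t₁)
    (ht : t₁ < t₂) (hb₁ : b (t₁ + s) - 1 < b t₁) : b (t₂ + s) - 1 ≤ b t₂ := by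
  obtain ⟨⟨hf, hκ, hfper, hκper, hf0, -, -, -⟩, -, hp, hp0, hpper, hpeq, -, -, hu, -, -, hub, -⟩ :=
    hset
  by_contra! hb₂
  set T := t₂ + s with hT
  set g : ℝ → ℝ → ℝ := fun x v => f x v * (κ x - v) with hg_def
  have hg1 : ContDiff ℝ 1 (Function.uncurry g) :=
    (hf.mul ((hκ.comp contDiff_fst).sub contDiff_snd)).of_le (by norm_num)
  have hgc : Continuous (Function.uncurry g) := hg1.continuous
  have hgper : ∀ x v, g (x + 1) v = g x v := fun x v => by simp only [hg_def, hfper, hκper]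
  have hg0 : ∀ x, g x 0 = 0 := fun x => by simp [hg_def, hf0]
  obtain ⟨M₁, hM₁⟩ := (hu T (by linarith)).2.1
  obtain ⟨M₂, hM₂⟩ := (isCompact_Icc (a := (0 : ℝ)) (b := 1)).bddAbove_image hp.continuous.continuousOn
  set M := max M₁ M₂ with hM
  have hpM : ∀ x, p x ≤ M := fun x => by
    rw [← apply_fract_of_add_one hpper x]
    exact (hM₂ ⟨_, ⟨Int.fract_nonneg x, (Int.fract_lt_one x).le⟩, rfl⟩).trans (le_max_right _ _)
  have hM0 : 0 ≤ M := (hp0 0).le.trans (hpM 0)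
  obtain ⟨K, hK, hgK⟩ := exists_react_lipschitz hg1 hgper M
  have hu₀m : Measurable fun x => if x ≤ 0 then p x else 0 :=
    Measurable.ite measurableSet_Iic hp.continuous.measurable measurable_const
  have hu₀M : ∀ x, (if x ≤ 0 then p x else 0) ∈ Icc 0 M := fun x => by
    split_ifs
    · exact ⟨(hp0 x).le, hpM x⟩
    · exact ⟨le_rfl, hM0⟩
  have huM : ∀ x, ∀ t ∈ Ioc 0 T, u x t ∈ Icc 0 M := fun x t ht =>
    ⟨(lt_or_ge x (b t)).elim (fun h => ((hub t ht.1 x).1 h).le) fun h => ((hub t ht.1 x).2 h).ge,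
      (le_abs_self _).trans ((hM₁ x t ht).trans (le_max_left _ _))⟩
  have E := hu.evol (K := K * M) (by linarith : 0 < T) (by linarith) hu₀m hu₀M hgc huM
    fun x v hv => by
      have := hgK x v hv 0 ⟨le_rfl, hM0⟩
      rw [hg0, sub_zero, sub_zero, abs_of_nonneg hv.1] at this
      exact this.trans (mul_le_mul_of_nonneg_left hv.2 hK)
  set U : ℝ → ℝ → ℝ := fun x t => if t ≤ 0 then (if x ≤ 0 then p x else 0) else u x t with hU
  have hUpos : ∀ x t, 0 < t → U x t = u x t := fun x t ht => if_neg (not_le.2 ht)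
  have hUzero : ∀ x, U x 0 = if x ≤ 0 then p x else 0 := fun x => if_pos le_rfl
  have hper0 : ∀ x v, g (x + 0) v = g x v := fun x v => by rw [add_zero]
  have hUp : ∀ x, U x s ≤ p x := by
    have h := (E.shift hper0 le_rfl hs.le (by linarith)).le_of_le
      (Evol.stationary hp hp0 hpM hpeq) hs hm.le hM0 hgc hg0 hgK hK fun x => by
        simp only [add_zero, hUzero]
        split_ifs
        · exact le_rfl
        · exact (hp0 x).le
    simpa only [add_zero] using h
  have hcross : ∀ x, U (x + 1) (t₁ + s) ≤ U x t₁ := by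
    intro x
    by_contra! hx
    rw [hUpos _ _ ht₁, hUpos _ _ (by linarith)] at hx
    have hxb : x + 1 < b (t₁ + s) := by
      by_contra! hxb
      rw [(hub _ (by linarith) _).2 hxb] at hx
      exact absurd hx (not_lt.2 (huM x t₁ ⟨ht₁, by linarith⟩).1)
    have h := (E.shift hgper hs.le ht₁.le (by linarith)).le_of_lt_of_crossing
      (E.shift hper0 le_rfl ht₁.le (by linarith)) ht₁ hm.le hM0 hgc hg0 hgK hK
      (fun x hx => by
        simp only [add_zero, zero_add, hUzero, if_pos hx]
        exact (hUp _).trans (hpper x).le)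
      (fun x hx => by
        simp only [add_zero, zero_add, hUzero, if_neg (not_le.2 hx)]
        exact (E.mem_Icc _ s ⟨hs.le, by linarith⟩).1)
      (x₁ := x) (x₂ := (b (t₁ + s) - 1 + b t₁) / 2) (by linarith) (by
        rw [add_zero, add_zero, hUpos _ _ ht₁, hUpos _ _ (by linarith)]
        exact hx)
    rw [add_zero, add_zero, hUpos _ _ ht₁, hUpos _ _ (by linarith),
      (hub (t₁ + s) (by linarith) _).2 (by linarith)] at h
    exact absurd ((hub t₁ ht₁ _).1 (by linarith)) (not_lt.2 h)
  have h := (E.shift (s := t₁ + s) (T' := t₂ - t₁) hgper (by linarith) (by linarith)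
    (by linarith)).le_of_le (E.shift (s := t₁) hper0 ht₁.le (by linarith) (by linarith))
    (by linarith) hm.le hM0 hgc hg0 hgK hK (fun x => by
      simp only [add_zero, zero_add]
      exact hcross x) (b t₂)
  rw [add_zero, sub_add_cancel, show t₂ - t₁ + (t₁ + s) = t₂ + s by ring, hUpos _ _ (by linarith),
    hUpos _ _ (by linarith), (hub t₂ (by linarith) _).2 le_rfl] at h
  exact absurd ((hub (t₂ + s) (by linarith) _).1 (by linarith)) (not_lt.2 h)

lemma RenormSetting.deriv_add_one_le {m : ℝ} (hm : 1 < m) {f : ℝ → ℝ → ℝ} {κ : ℝ → ℝ}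
    {θ c₀ l₀ : ℝ} {φ₀ p : ℝ → ℝ} {u : ℝ → ℝ → ℝ} {b ty : ℝ → ℝ}
    (hset : RenormSetting m f κ θ c₀ l₀ φ₀ p u b ty) {y : ℝ} (hy : 0 < y) :
    deriv b (ty (y + 1)) ≤ deriv b (ty y) := by
  have hset' := hset
  obtain ⟨-, -, -, -, -, -, -, -, -, hdiff, -, -, hmono, -, -, -, hty⟩ := hset'
  by_contra! hlt
  obtain ⟨ht, hbt⟩ := hty y hy
  obtain ⟨ht', hbt'⟩ := hty (y + 1) (by linarith)
  set s := ty (y + 1) - ty y with hs_def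
  have hts : ty y + s = ty (y + 1) := by rw [hs_def]; ring
  have hs : 0 < s := sub_pos.2 ((hmono.lt_iff_lt ht ht').1 (by rw [hbt, hbt']; linarith))
  have hd : HasDerivAt (fun t => b (t + s) - 1 - b t) (deriv b (ty (y + 1)) - deriv b (ty y))
      (ty y) := by
    have h1 : HasDerivAt b (deriv b (ty (y + 1))) (ty y + s) := by
      rw [hts]; exact (hdiff _ ht').hasDerivAt
    exact ((h1.comp_add_const _ _).sub_const 1).sub (hdiff _ ht).hasDerivAt
  obtain ⟨⟨t₁, ht₁, ht₁', hD₁⟩, t₂, ht₂, hD₂⟩ := exists_neg_pos_of_deriv_pos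
    (D := fun t => b (t + s) - 1 - b t) ht (by simp only [hts, hbt, hbt']; ring)
    (by rw [hd.deriv]; linarith)
  have := hset.not_overtake hm hs ht₁ (ht₁'.trans ht₂) (by linarith)
  linarith

/-- In the renormalization setting, the free boundary moves no faster when
crossing `y + 1` than when crossing `y`; consequently `0 ≤ b'(t) ≤ c̄` for `t ≥ t₂`, where
`c̄ = max_{z ∈ [1,2]} b'(t_z)`. -/
theorem free_boundary_speed_monotone_and_bounded
    (m : ℝ) (hm : 1 < m) (f : ℝ → ℝ → ℝ) (κ : ℝ → ℝ) (θ c₀ l₀ : ℝ) (φ₀ p : ℝ → ℝ)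
    (u : ℝ → ℝ → ℝ) (b : ℝ → ℝ) (ty : ℝ → ℝ)
    (hset : RenormSetting m f κ θ c₀ l₀ φ₀ p u b ty) :
    (∀ y > (0:ℝ), deriv b (ty (y + 1)) ≤ deriv b (ty y)) ∧
    (∀ t : ℝ, ty 2 ≤ t →
      0 ≤ deriv b t ∧ deriv b t ≤ sSup ((fun z => deriv b (ty z)) '' Icc (1:ℝ) 2)) := by
  have hstep : ∀ y > (0:ℝ), deriv b (ty (y + 1)) ≤ deriv b (ty y) := fun y hy =>
    hset.deriv_add_one_le hm hy
  obtain ⟨-, -, -, -, -, -, -, -, -, -, hcont, -, hmono, -, -, hdarcy, hty⟩ := hset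
  refine ⟨hstep, fun t ht => ?_⟩
  obtain ⟨h2, hb2⟩ := hty 2 two_pos
  obtain ⟨h1, hb1⟩ := hty 1 one_pos
  have ht0 : 0 < t := h2.trans_le ht
  refine ⟨(hdarcy t ht0).2, ?_⟩
  have hiter : ∀ n : ℕ, ∀ y > (0 : ℝ), deriv b (ty (y + n)) ≤ deriv b (ty y) := by
    intro n
    induction n with
    | zero => intro y _; simp
    | succ k ih =>
      intro y hy
      have := hstep (y + k) (by positivity)
      rw [add_assoc] at this
      push_cast
      exact this.trans (ih y hy)
  have hbt : 2 ≤ b t := hb2 ▸ (hmono.le_iff_le h2 ht0).2 ht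
  have hfl := Nat.floor_le (by linarith : 0 ≤ b t - 1)
  have hfl' := Nat.lt_floor_add_one (b t - 1)
  set n := ⌊b t - 1⌋₊ with hn
  have hmem : b t - n ∈ Icc (1 : ℝ) 2 := ⟨by linarith, by linarith⟩
  have htyt : ty (b t - n + n) = t := by
    rw [sub_add_cancel]
    obtain ⟨h, hb⟩ := hty (b t) (by linarith)
    exact hmono.injOn h ht0 hb
  have hle := hiter n (b t - n) (by linarith [hmem.1])
  rw [htyt] at hle
  refine hle.trans (le_csSup ?_ ⟨_, hmem, rfl⟩)
  refine (isCompact_Icc.bddAbove_image (hcont.mono fun r (hr : r ∈ Icc (ty 1) (ty 2)) =>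
    h1.trans_le hr.1)).mono ?_
  rintro _ ⟨z, hz, rfl⟩
  obtain ⟨h, hb⟩ := hty z (by linarith [hz.1])
  exact ⟨ty z, ⟨(hmono.le_iff_le h1 h).1 (by rw [hb1, hb]; exact hz.1),
    (hmono.le_iff_le h h2).1 (by rw [hb2, hb]; exact hz.2)⟩, rfl⟩
end
end

section
/- Let m > 1, K > 0, δ > 0 and x₀ ∈ ℝ. Define A := ((m−1)/(4m))^{1/(m−1)}, ρ(t) := δ^{1/2} (t+1)^{1/2} e^{(m−1)K(t+1)/2}, and ū(x,t) := A e^{K(t+1)} ( δ − (x−x₀)² / ((t+1) e^{(m−1)K(t+1)}) )₊^{1/(m−1)}, where s₊ := max{s,0}. Then for every t > 0 and every x with |x − x₀| < ρ(t), the function ū is smooth in a neighborhood of (x,t) and satisfies the supersolution inequality ∂_t ū(x,t) − ∂²_x(ū^m)(x,t) − K ū(x,t) ≥ 0. -/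
open MeasureTheory Set Filter

noncomputable section

/-- The Barenblatt pressure is positive strictly inside the front `|y| = δ^{1/2} s^{1/2} e^{κ s/2}`. -/
theorem barenblatt_pressure_pos {κ δ s y : ℝ} (hδ : 0 < δ) (hs : 0 < s)
    (hy : |y| < δ ^ ((1:ℝ)/2) * s ^ ((1:ℝ)/2) * Real.exp (κ * s / 2)) :
    0 < δ - y ^ 2 / (s * Real.exp (κ * s)) := by
  have hsq : (δ ^ ((1:ℝ)/2) * s ^ ((1:ℝ)/2) * Real.exp (κ * s / 2)) ^ 2
      = δ * (s * Real.exp (κ * s)) := by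
    rw [mul_pow, mul_pow, ← Real.sqrt_eq_rpow, ← Real.sqrt_eq_rpow, Real.sq_sqrt hδ.le,
      Real.sq_sqrt hs.le, ← Real.exp_nat_mul]
    push_cast
    rw [mul_div_cancel₀ _ (two_ne_zero), mul_assoc]
  have h := sq_lt_sq' (by linarith [abs_nonneg y]) hy
  rw [sq_abs, hsq] at h
  rw [sub_pos, div_lt_iff₀ (by positivity)]
  exact h

/-- Second derivative of a power of a concave parabola at a point where the parabola is positive. -/
theorem deriv_deriv_rpow_parabola {δ c a x₀ x p : ℝ} {f : ℝ → ℝ}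
    (hx : 0 < δ - (x - x₀) ^ 2 / c)
    (hf : ∀ y, 0 < δ - (y - x₀) ^ 2 / c → f y = a * (δ - (y - x₀) ^ 2 / c) ^ (p + 1)) :
    deriv (deriv f) x = a * (p + 1) * (p * (δ - (x - x₀) ^ 2 / c) ^ (p - 1) *
      (2 * (x - x₀) / c) ^ 2 - (δ - (x - x₀) ^ 2 / c) ^ p * (2 / c)) := by
  have hcont : Continuous fun y : ℝ => δ - (y - x₀) ^ 2 / c := by fun_prop
  have hopen : IsOpen {y : ℝ | 0 < δ - (y - x₀) ^ 2 / c} := isOpen_lt continuous_const hcont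
  have hW : ∀ y, HasDerivAt (fun y : ℝ => δ - (y - x₀) ^ 2 / c) (-(2 * (y - x₀) / c)) y := by
    intro y
    refine (((((hasDerivAt_id y).sub_const x₀).pow 2).div_const c).const_sub δ).congr_deriv ?_
    simp
  have hf' : ∀ y, 0 < δ - (y - x₀) ^ 2 / c → deriv f y =
      a * (p + 1) * ((δ - (y - x₀) ^ 2 / c) ^ p * (-(2 * (y - x₀) / c))) := by
    intro y hy
    have he : f =ᶠ[nhds y] fun y => a * (δ - (y - x₀) ^ 2 / c) ^ (p + 1) :=
      Filter.eventually_of_mem (hopen.mem_nhds hy) hf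
    rw [he.deriv_eq, (((hW y).rpow_const (p := p + 1) (Or.inl hy.ne')).const_mul a).deriv,
      add_sub_cancel_right]
    ring
  have he : deriv f =ᶠ[nhds x] fun y =>
      a * (p + 1) * ((δ - (y - x₀) ^ 2 / c) ^ p * (-(2 * (y - x₀) / c))) :=
    Filter.eventually_of_mem (hopen.mem_nhds hx) hf'
  have hlin : HasDerivAt (fun y : ℝ => -(2 * (y - x₀) / c)) (-(2 / c)) x := by
    refine (((((hasDerivAt_id x).sub_const x₀).const_mul 2).div_const c).neg).congr_deriv ?_
    simp
  rw [he.deriv_eq,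
    ((((hW x).rpow_const (p := p) (Or.inl hx.ne')).fun_mul hlin).const_mul (a * (p + 1))).deriv]
  ring

/-- Time derivative of the Barenblatt-type profile at a point where its pressure is positive. -/
theorem hasDerivAt_barenblatt {A K κ δ y p t : ℝ} (ht : 0 < t + 1)
    (hw : 0 < δ - y ^ 2 / ((t + 1) * Real.exp (κ * (t + 1)))) :
    HasDerivAt (fun s : ℝ => A * Real.exp (K * (s + 1)) *
        (δ - y ^ 2 / ((s + 1) * Real.exp (κ * (s + 1)))) ^ p)
      (A * Real.exp (K * (t + 1)) *
        (K * (δ - y ^ 2 / ((t + 1) * Real.exp (κ * (t + 1)))) ^ p +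
          p * (δ - y ^ 2 / ((t + 1) * Real.exp (κ * (t + 1)))) ^ (p - 1) *
            (y ^ 2 * (1 + κ * (t + 1)) / ((t + 1) ^ 2 * Real.exp (κ * (t + 1)))))) t := by
  have hadd : HasDerivAt (fun s : ℝ => s + 1) 1 t := (hasDerivAt_id t).add_const 1
  have hexp : ∀ b : ℝ, HasDerivAt (fun s : ℝ => Real.exp (b * (s + 1)))
      (Real.exp (b * (t + 1)) * (b * 1)) t := fun b => (hadd.const_mul b).exp
  have hne : (t + 1) * Real.exp (κ * (t + 1)) ≠ 0 := by positivity
  have hw' := ((hasDerivAt_const t (y ^ 2)).div (hadd.mul (hexp κ)) hne).const_sub δ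
  refine (((hexp K).const_mul A).mul (hw'.rpow_const (p := p) (Or.inl hw.ne'))).congr_deriv ?_
  simp only [Pi.mul_apply, Pi.div_apply]
  have hE := (Real.exp_pos (κ * (t + 1))).ne'
  have hfrac : -((0 * ((t + 1) * Real.exp (κ * (t + 1))) - y ^ 2 *
      (1 * Real.exp (κ * (t + 1)) + (t + 1) * (Real.exp (κ * (t + 1)) * (κ * 1)))) /
      ((t + 1) * Real.exp (κ * (t + 1))) ^ 2) =
      y ^ 2 * (1 + κ * (t + 1)) / ((t + 1) ^ 2 * Real.exp (κ * (t + 1))) := by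
    field_simp
    ring
  rw [hfrac]
  ring

/-- The explicit Barenblatt-type function
`ū(x,t) = A e^{K(t+1)} (δ - (x-x₀)²/((t+1)e^{(m-1)K(t+1)}))₊^{1/(m-1)}`, with
`A = ((m-1)/(4m))^{1/(m-1)}`, is smooth on the region `|x - x₀| < ρ(t)` where
`ρ(t) = δ^{1/2}(t+1)^{1/2} e^{(m-1)K(t+1)/2}`, and satisfies there the supersolution
inequality `ū_t - (ū^m)_{xx} - K ū ≥ 0`. -/
theorem barenblatt_supersolution
    (m K δ x₀ : ℝ) (hm : 1 < m) (hK : 0 < K) (hδ : 0 < δ) :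
    ∀ (A : ℝ) (ρ : ℝ → ℝ) (ubar : ℝ → ℝ → ℝ),
      A = ((m - 1) / (4 * m)) ^ (1 / (m - 1)) →
      ρ = (fun t : ℝ => δ ^ ((1:ℝ)/2) * (t + 1) ^ ((1:ℝ)/2) *
        Real.exp ((m - 1) * K * (t + 1) / 2)) →
      ubar = (fun x t : ℝ => A * Real.exp (K * (t + 1)) *
        (max (δ - (x - x₀) ^ 2 / ((t + 1) * Real.exp ((m - 1) * K * (t + 1)))) 0)
          ^ (1 / (m - 1))) →
      ∀ t > (0:ℝ), ∀ x : ℝ, |x - x₀| < ρ t →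
        (∃ ε > (0:ℝ), ContDiffOn ℝ (⊤ : ℕ∞) (fun q : ℝ × ℝ => ubar q.1 q.2)
          (Metric.ball (x, t) ε)) ∧
        0 ≤ deriv (fun s => ubar x s) t
            - deriv (deriv (fun y => ubar y t ^ m)) x - K * ubar x t := by
  rintro A ρ ubar hA rfl rfl t ht x hx
  have hs : 0 < t + 1 := by linarith
  have hm1 : 0 < m - 1 := sub_pos.2 hm
  have hw : 0 < δ - (x - x₀) ^ 2 / ((t + 1) * Real.exp ((m - 1) * K * (t + 1))) :=
    barenblatt_pressure_pos hδ hs hx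
  have hcd : ∀ q : ℝ × ℝ, 0 < q.2 + 1 → ContDiffAt ℝ (⊤ : ℕ∞) (fun q : ℝ × ℝ =>
      δ - (q.1 - x₀) ^ 2 / ((q.2 + 1) * Real.exp ((m - 1) * K * (q.2 + 1)))) q := by
    intro q hq
    have hne : (q.2 + 1) * Real.exp ((m - 1) * K * (q.2 + 1)) ≠ 0 := by positivity
    exact contDiffAt_const.sub (ContDiffAt.div (by fun_prop) (by fun_prop) hne)
  have hev : ∀ᶠ q : ℝ × ℝ in nhds (x, t), 0 < q.2 + 1 ∧
      0 < δ - (q.1 - x₀) ^ 2 / ((q.2 + 1) * Real.exp ((m - 1) * K * (q.2 + 1))) := by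
    refine Filter.Eventually.and ?_ ((hcd (x, t) hs).continuousAt.eventually_const_lt hw)
    have hc : Continuous fun q : ℝ × ℝ => q.2 + 1 := by fun_prop
    exact hc.continuousAt.eventually_const_lt hs
  refine ⟨?_, ?_⟩
  · obtain ⟨ε, hε, hball⟩ := Metric.eventually_nhds_iff_ball.1 hev
    refine ⟨ε, hε, ContDiffOn.congr (f := fun q : ℝ × ℝ => A * Real.exp (K * (q.2 + 1)) *
      (δ - (q.1 - x₀) ^ 2 / ((q.2 + 1) * Real.exp ((m - 1) * K * (q.2 + 1))))
        ^ (1 / (m - 1))) ?_ ?_⟩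
    · intro q hq
      obtain ⟨h1, h2⟩ := hball q hq
      exact (ContDiffAt.mul (by fun_prop)
        ((hcd q h1).rpow_const_of_ne h2.ne')).contDiffWithinAt
    · intro q hq
      simp only [max_eq_left (hball q hq).2.le]
  · have hp : 0 < 1 / (m - 1) := by positivity
    have hpm : 1 / (m - 1) * m = 1 / (m - 1) + 1 := by field_simp; ring
    have hA0 : 0 < A := by rw [hA]; positivity
    have hAm : A ^ m = A * ((m - 1) / (4 * m)) := by
      have hb : 0 < (m - 1) / (4 * m) := by positivity
      rw [hA, ← Real.rpow_mul hb.le, hpm, Real.rpow_add_one hb.ne']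
    have hem : Real.exp (K * (t + 1)) ^ m
        = Real.exp (K * (t + 1)) * Real.exp ((m - 1) * K * (t + 1)) := by
      rw [← Real.exp_mul, ← Real.exp_add]
      ring_nf
    have htime : (fun s : ℝ => A * Real.exp (K * (s + 1)) *
        (max (δ - (x - x₀) ^ 2 / ((s + 1) * Real.exp ((m - 1) * K * (s + 1)))) 0)
          ^ (1 / (m - 1))) =ᶠ[nhds t] fun s : ℝ => A * Real.exp (K * (s + 1)) *
        (δ - (x - x₀) ^ 2 / ((s + 1) * Real.exp ((m - 1) * K * (s + 1)))) ^ (1 / (m - 1)) := by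
      have hc : Continuous fun s : ℝ => (x, s) := by fun_prop
      filter_upwards [hc.continuousAt.eventually hev] with s h
      rw [max_eq_left h.2.le]
    have hspace := deriv_deriv_rpow_parabola (p := 1 / (m - 1)) (a := A ^ m *
      Real.exp (K * (t + 1)) ^ m) (f := fun y => (A * Real.exp (K * (t + 1)) *
        (max (δ - (y - x₀) ^ 2 / ((t + 1) * Real.exp ((m - 1) * K * (t + 1)))) 0)
          ^ (1 / (m - 1))) ^ m) hw (by
      intro y hy
      simp only [max_eq_left hy.le]
      rw [Real.mul_rpow (by positivity) (Real.rpow_nonneg hy.le _),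
        Real.mul_rpow hA0.le (Real.exp_pos _).le, ← Real.rpow_mul hy.le, hpm])
    rw [htime.deriv_eq, (hasDerivAt_barenblatt hs hw).deriv, hspace, hAm, hem]
    simp only [max_eq_left hw.le]
    have hP := Real.rpow_pos_of_pos hw (1 / (m - 1))
    have hQ := Real.rpow_pos_of_pos hw (1 / (m - 1) - 1)
    have hE := Real.exp_pos ((m - 1) * K * (t + 1))
    have hF := Real.exp_pos (K * (t + 1))
    generalize (δ - (x - x₀) ^ 2 / ((t + 1) * Real.exp ((m - 1) * K * (t + 1))))
      ^ (1 / (m - 1)) = P at *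
    generalize (δ - (x - x₀) ^ 2 / ((t + 1) * Real.exp ((m - 1) * K * (t + 1))))
      ^ (1 / (m - 1) - 1) = Q at *
    generalize Real.exp ((m - 1) * K * (t + 1)) = E at *
    generalize Real.exp (K * (t + 1)) = F at *
    have hres : 0 ≤ A * F * (Q * ((x - x₀) ^ 2 * K) / ((t + 1) * E) + P / (2 * (t + 1))) := by
      positivity
    refine hres.trans_eq ?_
    field_simp
    ring
end
end
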